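/- Let k be a number field and let a, b, a', b' be nonzero elements of k. Then there exists a field extension K of k of degree 2 such that both conics z² = a x² + b y² and z² = a' x² + b' y² acquire a nontrivial K-rational point, i.e. each of the equations a x² + b y² = z² and a' x² + b' y² = z² has a solution (x, y, z) in K³ with (x, y, z) ≠ (0, 0, 0); equivalently, both conics become isomorphic to the projective line over K. -/

import Mathlib

section

open IsDedekindDomain NumberField
open scoped WithZero

namespace TwoConics

section Local

variable {F : Type} [Field F] (v : Valuation F ℤᵐ⁰)

theorem isSquare_of_mul {x y : ℤᵐ⁰} (hx : x ≠ 0) (h1 : IsSquare x) (h2 : IsSquare (x * y)) :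
    IsSquare y := by
  have : y = (x * y) / x := by field_simp
  rw [this]
  exact h2.div h1

theorem sub_sq_isSquare {t : F} (ht : ∀ z : F, v z ≤ 1 → v (z ^ 2 + z - t) = 1) (h2 : v 2 ≠ 0)
    (x y : F) (hxy : y ≠ 0) :
    x ^ 2 - (1 + 4 * t) * y ^ 2 ≠ 0 ∧ IsSquare (v (x ^ 2 - (1 + 4 * t) * y ^ 2)) := by
  have h20 : (2 : F) ≠ 0 := by
    intro h; rw [h] at h2; simp at h2
  have ht0 : v t = 1 := by
    have := ht 0 (by simp)
    simpa using this
  set z := (x / y - 1) / 2 with hz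
  have key : x ^ 2 - (1 + 4 * t) * y ^ 2 = (2 * y) ^ 2 * (z ^ 2 + z - t) := by
    rw [hz]; field_simp; ring
  have hval : v (z ^ 2 + z - t) ≠ 0 ∧ IsSquare (v (z ^ 2 + z - t)) := by
    rcases le_or_gt (v z) 1 with h | h
    · rw [ht z h]; exact ⟨one_ne_zero, ⟨1, by simp⟩⟩
    · have hz0 : v z ≠ 0 := by
        intro h'; rw [h'] at h; simp at h
      have e1 : v (z ^ 2) = v z * v z := by rw [sq, map_mul]
      have hlt : v z < v z * v z := by
        conv_lhs => rw [← mul_one (v z)]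
        exact mul_lt_mul_of_pos_left h (zero_lt_iff.2 hz0)
      have : v (z ^ 2 + z - t) = v (z ^ 2) := by
        have h3 : v (z - t) < v (z ^ 2) := by
          rw [e1]
          refine lt_of_le_of_lt (v.map_sub _ _) (max_lt hlt ?_)
          rw [ht0]; exact h.trans hlt
        rw [add_sub_assoc]
        exact v.map_add_eq_of_lt_left h3
      rw [this, e1]
      exact ⟨mul_ne_zero hz0 hz0, ⟨v z, rfl⟩⟩
  constructor
  · rw [key]
    refine mul_ne_zero (pow_ne_zero _ (mul_ne_zero h20 hxy)) ?_
    intro h; rw [h] at hval; simp at hval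
  · rw [key, map_mul, map_pow]
    exact (IsSquare.sq _).mul hval.2

/-- changing `t` by something small keeps irreducibility -/
theorem irr_of_close {t t' : F} (ht : ∀ z : F, v z ≤ 1 → v (z ^ 2 + z - t) = 1)
    (h : v (t' - t) < 1) : ∀ z : F, v z ≤ 1 → v (z ^ 2 + z - t') = 1 := by
  intro z hz
  have : z ^ 2 + z - t' = (z ^ 2 + z - t) - (t' - t) := by ring
  rw [this, Valuation.map_sub_eq_of_lt_left]
  · exact ht z hz
  · rw [ht z hz]; exact h

/-- If every element is, up to a local square, a norm from `F(√a)`, then `a` is a local square. -/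
theorem loc_nonnorm (hsurj : Function.Surjective v) (h2 : v 2 ≠ 0) (h2' : v 2 ≤ 1)
    (R1 : ∃ t : F, v t ≤ 1 ∧ ∀ z : F, v z ≤ 1 → v (z ^ 2 + z - t) = 1)
    (R2 : v 2 < 1 → ∀ x : F, v x ≤ 1 → ∃ m : F, v m ≤ 1 ∧ v (x - m ^ 2) < 1)
    (a : F) (ha : a ≠ 0)
    (hall : ∀ c : F, c ≠ 0 → ∃ u q x y : F, q ≠ 0 ∧ v (u - 1) < v 4 ∧
      c * q ^ 2 * u = x ^ 2 - a * y ^ 2) :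
    ∃ q : F, q ≠ 0 ∧ v (a * q ^ 2 - 1) < v 4 := by
  by_contra hcon
  push Not at hcon
  obtain ⟨t, ht1, ht⟩ := R1
  have h20 : (2 : F) ≠ 0 := by
    intro h; rw [h] at h2; simp at h2
  have h4 : v 4 = v 2 * v 2 := by rw [← map_mul]; norm_num
  have h40 : v 4 ≠ 0 := by rw [h4]; exact mul_ne_zero h2 h2
  have h4F : (4 : F) ≠ 0 := by intro h; rw [h] at h40; simp at h40
  have h41 : v 4 ≤ 1 := by rw [h4]; exact mul_le_one' h2' h2'
  have hu1 : ∀ u, v (u - 1) < v 4 → v u = 1 := by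
    intro u hu
    have : u = 1 + (u - 1) := by ring
    rw [this, Valuation.map_add_eq_of_lt_left]
    · simp
    · simpa using hu.trans_le h41
  obtain ⟨π, hπ⟩ := hsurj (WithZero.exp (-1 : ℤ))
  have hπ0 : π ≠ 0 := by rintro rfl; simp at hπ; exact WithZero.exp_ne_zero hπ.symm
  have hπsq : ¬ IsSquare (v π) := by
    rw [hπ]
    rintro ⟨r, hr⟩
    have hr0 : r ≠ 0 := by rintro rfl; simp at hr
    obtain ⟨n, rfl⟩ : ∃ n : ℤ, r = WithZero.exp n := ⟨WithZero.log r, (WithZero.exp_log hr0).symm⟩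
    rw [← WithZero.exp_add, WithZero.exp_inj] at hr
    omega
  by_cases hodd : IsSquare (v a)
  swap
  · -- odd valuation
    have hc0 : (1 + 4 * t : F) ≠ 0 := by
      have := (sub_sq_isSquare v ht h2 0 1 one_ne_zero).1
      intro h; apply this; rw [h]; ring
    obtain ⟨u, q, x, y, hq, hu, he⟩ := hall _ hc0
    have ht' : ∀ z : F, v z ≤ 1 → v (z ^ 2 + z - (t + (u - 1) * (1 + 4 * t) / 4)) = 1 := by
      refine irr_of_close v ht ?_
      have : v (1 + 4 * t) ≤ 1 := by
        refine (v.map_add _ _).trans (max_le (by simp) ?_)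
        rw [map_mul]; exact mul_le_one' h41 ht1
      rw [add_sub_cancel_left, map_div₀, map_mul]
      rw [div_lt_one₀ (zero_lt_iff.2 h40)]
      calc v (u - 1) * v (1 + 4 * t) ≤ v (u - 1) * 1 := by gcongr
        _ < v 4 := by simpa using hu
    have h3 := sub_sq_isSquare v ht' h2 x q hq
    have e : x ^ 2 - (1 + 4 * (t + (u - 1) * (1 + 4 * t) / 4)) * q ^ 2 = a * y ^ 2 := by
      have : (1 + 4 * (t + (u - 1) * (1 + 4 * t) / 4)) = (1 + 4 * t) * u := by
        field_simp; ring
      rw [this]; linear_combination (-1) * he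
    rw [e] at h3
    have hy : y ≠ 0 := by rintro rfl; simp at h3
    apply hodd
    refine isSquare_of_mul (x := v (y ^ 2)) ((v.ne_zero_iff).2 (pow_ne_zero _ hy)) ?_ ?_
    · rw [map_pow]; exact IsSquare.sq _
    · rw [← map_mul, mul_comm]; exact h3.2
  · -- even valuation; choose the best square multiple
    obtain ⟨r, hr⟩ := hodd
    obtain ⟨r', rfl⟩ := hsurj r
    have hr0 : r' ≠ 0 := by rintro rfl; simp at hr; exact ha hr
    have hr'0 : v r' ≠ 0 := (v.ne_zero_iff).2 hr0
    have hrinv : v (a * r'⁻¹ ^ 2) = 1 := by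
      rw [map_mul, hr, map_pow, map_inv₀]; field_simp
    have hform : ∀ q : F, q ≠ 0 → v (a * q ^ 2 - 1) = v 4 * WithZero.exp
          (((WithZero.log (v (a * q ^ 2 - 1)) - WithZero.log (v 4)).toNat : ℕ) : ℤ) := by
      intro p hp
      have h := hcon p hp
      have hne0 : v (a * p ^ 2 - 1) ≠ 0 := fun h' => by
        rw [h'] at h; exact h40 (le_zero_iff.1 h)
      have := (WithZero.log_le_log h40 hne0).2 h
      rw [Int.toNat_of_nonneg (by omega), WithZero.exp_sub, WithZero.exp_log h40,
        WithZero.exp_log hne0]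
      field_simp
    have hne : ∃ n : ℕ, ∃ q : F, (q ≠ 0 ∧ v (a * q ^ 2) = 1) ∧
        v (a * q ^ 2 - 1) = v 4 * WithZero.exp (n : ℤ) :=
      ⟨_, r'⁻¹, ⟨inv_ne_zero hr0, hrinv⟩, hform _ (inv_ne_zero hr0)⟩
    classical
    obtain ⟨q, ⟨hq0, hb1'⟩, hq⟩ := Nat.find_spec hne
    set n := Nat.find hne with hn
    have hmin : ∀ p : F, p ≠ 0 → v (a * p ^ 2) = 1 → v (a * q ^ 2 - 1) ≤ v (a * p ^ 2 - 1) := by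
      intro p hp hp1
      have hfin := Nat.find_min' hne ⟨p, ⟨hp, hp1⟩, hform p hp⟩
      rw [hq, hform p hp]
      gcongr
      rw [WithZero.exp_le_exp]
      exact_mod_cast hfin
    -- replace a by b = a q^2
    set b := a * q ^ 2 with hb
    have hle1 : v (b - 1) ≤ 1 := (v.map_sub _ _).trans (max_le hb1'.le (by simp))
    have hb0 : b ≠ 0 := mul_ne_zero ha (pow_ne_zero _ hq0)
    have hconb : ∀ p : F, v p = 1 → v (b - 1) ≤ v (b * p ^ 2 - 1) := by
      intro p hp
      have hp0 : p ≠ 0 := by rintro rfl; simp at hp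
      have := hmin (q * p) (mul_ne_zero hq0 hp0) (by
        rw [mul_pow, ← mul_assoc, map_mul, ← hb, hb1', map_pow, hp]; simp)
      rwa [mul_pow, ← mul_assoc] at this
    have h4le : v 4 ≤ v (b - 1) := hcon q hq0
    have hallb : ∀ c : F, c ≠ 0 → ∃ u q x y : F, q ≠ 0 ∧ v (u - 1) < v 4 ∧
        c * q ^ 2 * u = x ^ 2 - b * y ^ 2 := by
      intro c hc
      obtain ⟨u, p, x, y, h1, h2, h3⟩ := hall c hc
      refine ⟨u, p, x, y / q, h1, h2, ?_⟩
      rw [h3, hb]; field_simp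
    rcases eq_or_lt_of_le h4le with heq | hlt4
    · -- unramified case
      set τ := (b - 1) / 4 with hτ
      have hbτ : b = 1 + 4 * τ := by rw [hτ]; field_simp; ring
      have hτ1 : v τ = 1 := by
        rw [hτ, map_div₀, ← heq, div_self h40]
      have hirr : ∀ z : F, v z ≤ 1 → v (z ^ 2 + z - τ) = 1 := by
        intro z hz
        by_contra hne1
        have hle : v (z ^ 2 + z - τ) ≤ 1 := by
          refine (v.map_sub _ _).trans (max_le ((v.map_add _ _).trans (max_le ?_ hz)) hτ1.le)
          rw [map_pow]; exact pow_le_one' hz 2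
        have hlt : v (z ^ 2 + z - τ) < 1 := lt_of_le_of_ne hle hne1
        have e : (1 + 2 * z) ^ 2 - b = 4 * (z ^ 2 + z - τ) := by rw [hbτ]; ring
        have hlt' : v ((1 + 2 * z) ^ 2 - b) < v 4 := by
          rw [e, map_mul]
          calc v 4 * v (z ^ 2 + z - τ) < v 4 * 1 := mul_lt_mul_of_pos_left hlt (zero_lt_iff.2 h40)
            _ = v 4 := mul_one _
        have h1z : v ((1 + 2 * z) ^ 2) = 1 := by
          have : (1 + 2 * z) ^ 2 = b + ((1 + 2 * z) ^ 2 - b) := by ring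
          rw [this, Valuation.map_add_eq_of_lt_left, hb1']
          rw [hb1']; exact hlt'.trans_le h41
        have h1z0 : (1 + 2 * z) ≠ 0 := by
          intro h; rw [h] at h1z; simp at h1z
        have hv1z : v (1 + 2 * z) = 1 := by
          rw [map_pow] at h1z
          exact (pow_eq_one_iff_of_nonneg zero_le two_ne_zero).1 h1z
        have := hconb (1 + 2 * z)⁻¹ (by rw [map_inv₀, hv1z, inv_one])
        rw [← heq] at this
        have e2 : b * (1 + 2 * z)⁻¹ ^ 2 - 1 = -((1 + 2 * z) ^ 2 - b) / (1 + 2 * z) ^ 2 := by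
          field_simp; ring
        rw [e2, map_div₀, h1z, div_one, Valuation.map_neg] at this
        exact absurd hlt' (not_lt.2 this)
      obtain ⟨u, p, x, y, hp, hu, he⟩ := hallb π hπ0
      apply hπsq
      have hv : IsSquare (v (x ^ 2 - b * y ^ 2)) := by
        by_cases hy : y = 0
        · rw [hy]; simp only [ne_eq, OfNat.ofNat_ne_zero, not_false_eq_true, zero_pow, mul_zero, sub_zero, map_pow]; exact IsSquare.sq _
        · rw [hbτ]; exact (sub_sq_isSquare v hirr h2 x y hy).2
      rw [← he, map_mul, map_mul, hu1 u hu, mul_one, mul_comm, map_pow] at hv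
      exact isSquare_of_mul (pow_ne_zero _ ((v.ne_zero_iff).2 hp)) (IsSquare.sq _) hv
    · obtain ⟨δ, hδ⟩ : ∃ δ, δ = 1 - b := ⟨_, rfl⟩
      have hδb : v (b - 1) = v δ := by rw [hδ, Valuation.map_sub_swap]
      rw [hδb] at hlt4 hconb hle1
      have hδ0 : v δ ≠ 0 := (lt_of_le_of_lt zero_le hlt4).ne'
      have hδF : δ ≠ 0 := (v.ne_zero_iff).1 hδ0
      have hv2 : v 2 < 1 := by
        refine lt_of_le_of_ne h2' fun h => ?_
        rw [h4, h, one_mul] at hlt4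
        exact absurd hle1 (not_le.2 hlt4)
      have hδ1 : v δ < 1 := by
        refine lt_of_le_of_ne hle1 fun h => ?_
        obtain ⟨m, hm1, hm⟩ := R2 hv2 b⁻¹ (by rw [map_inv₀, hb1', inv_one])
        have hvm : v m = 1 := by
          refine le_antisymm hm1 ?_
          by_contra hlt
          have : v (b⁻¹ - m ^ 2) = 1 := by
            rw [Valuation.map_sub_eq_of_lt_left, map_inv₀, hb1', inv_one]
            rw [map_inv₀, hb1', inv_one, map_pow]
            exact pow_lt_one₀ zero_le (not_le.1 hlt) two_ne_zero
          rw [this] at hm; exact lt_irrefl _ hm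
        have h6 := hconb m hvm
        have e : b * m ^ 2 - 1 = - (b * (b⁻¹ - m ^ 2)) := by field_simp; ring
        rw [e, Valuation.map_neg, map_mul, hb1', one_mul, h] at h6
        exact absurd hm (not_lt.2 h6)
      have hδsq : ¬ IsSquare (v δ) := by
        rintro ⟨ρ, hρ⟩
        obtain ⟨r, rfl⟩ := hsurj ρ
        have hr0' : v r ≠ 0 := by intro h; rw [h] at hρ; simp at hρ; exact hδF hρ
        have hrF : r ≠ 0 := (v.ne_zero_iff).1 hr0'
        have h2r : v 2 < v r := by
          by_contra hle
          push Not at hle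
          rw [hρ, h4] at hlt4
          exact absurd (mul_le_mul' hle hle) (not_le.2 hlt4)
        have hr1 : v r < 1 := by
          by_contra hle
          push Not at hle
          rw [hρ] at hδ1
          exact absurd (one_le_mul_of_one_le_of_one_le hle hle) (not_le.2 hδ1)
        obtain ⟨m, hm1, hm⟩ := R2 hv2 (δ / r ^ 2) (by
          rw [map_div₀, map_pow, hρ]; apply le_of_eq; field_simp)
        have hs : v (r * m) < 1 := by
          rw [map_mul]
          calc v r * v m ≤ v r * 1 := by gcongr
            _ < 1 := by simpa using hr1
        have hp : v (1 + r * m) = 1 := by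
          rw [Valuation.map_add_eq_of_lt_left] <;> simp only [map_one]; exact hs
        have h6 := hconb _ hp
        have e : b * (1 + r * m) ^ 2 - 1 =
            2 * (r * m) - δ * (2 * (r * m)) - δ * (r * m) ^ 2 - r ^ 2 * (δ / r ^ 2 - m ^ 2) := by
          have : b = 1 - δ := by rw [hδ]; ring
          rw [this]; field_simp; ring
        rw [e] at h6
        have b1 : v (2 * (r * m)) < v δ := by
          rw [map_mul, map_mul, hρ]
          calc v 2 * (v r * v m) ≤ v 2 * (v r * 1) := by gcongr
            _ = v 2 * v r := by rw [mul_one]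
            _ < v r * v r := mul_lt_mul_of_pos_right h2r (zero_lt_iff.2 hr0')
        have b2 : v (δ * (2 * (r * m))) < v δ := by
          rw [map_mul]
          calc v δ * v (2 * (r * m)) < v δ * 1 :=
                mul_lt_mul_of_pos_left (b1.trans hδ1) (zero_lt_iff.2 hδ0)
            _ = v δ := mul_one _
        have b3 : v (δ * (r * m) ^ 2) < v δ := by
          rw [map_mul, map_pow]
          calc v δ * v (r * m) ^ 2 < v δ * 1 :=
                mul_lt_mul_of_pos_left (pow_lt_one₀ zero_le hs two_ne_zero) (zero_lt_iff.2 hδ0)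
            _ = v δ := mul_one _
        have b4 : v (r ^ 2 * (δ / r ^ 2 - m ^ 2)) < v δ := by
          rw [map_mul, map_pow]
          calc v r ^ 2 * v (δ / r ^ 2 - m ^ 2) < v r ^ 2 * 1 :=
                mul_lt_mul_of_pos_left hm (zero_lt_iff.2 (pow_ne_zero _ hr0'))
            _ = v δ := by rw [mul_one, hρ, sq]
        refine absurd h6 (not_le.2 ?_)
        exact v.map_sub_lt (v.map_sub_lt (v.map_sub_lt b1 b2) b3) b4
      have hc0 : (1 + 4 * t / δ : F) ≠ 0 := by
        have : v (4 * t / δ) < 1 := by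
          rw [map_div₀, map_mul, div_lt_one₀ (zero_lt_iff.2 hδ0)]
          calc v 4 * v t ≤ v 4 * 1 := by gcongr
            _ < v δ := by simpa using hlt4
        intro h
        have h7 : 4 * t / δ = -1 := by linear_combination h
        rw [h7] at this; simp at this
      obtain ⟨u, p, x, y, hp, hu, he⟩ := hallb _ hc0
      have h4t : v (δ + 4 * t) < 1 := by
        refine v.map_add_lt hδ1 ?_
        rw [map_mul]
        calc v 4 * v t ≤ v 4 * 1 := by gcongr
            _ < 1 := by rw [mul_one]; exact hlt4.trans hδ1
      obtain ⟨t1, ht1d⟩ : ∃ t1, t1 = t + (δ + 4 * t) * (u - 1) / 4 := ⟨_, rfl⟩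
      have hsm : v (t1 - t) < 1 := by
        rw [ht1d, add_sub_cancel_left, map_div₀, map_mul, div_lt_one₀ (zero_lt_iff.2 h40)]
        calc v (δ + 4 * t) * v (u - 1) ≤ 1 * v (u - 1) := by gcongr
          _ < v 4 := by simpa using hu
      have hirr := irr_of_close v ht hsm
      have ht11 : v t1 ≤ 1 := by
        have : t1 = t + (t1 - t) := by ring
        rw [this]; exact v.map_add_le ht1 hsm.le
      have h41 : v (4 * t1) < v δ := by
        rw [map_mul]
        calc v 4 * v t1 ≤ v 4 * 1 := by gcongr
          _ < v δ := by simpa using hlt4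
      have hB : v (δ + 4 * t1) = v δ := Valuation.map_add_eq_of_lt_left v h41
      have hB2 : δ + 4 * t1 = δ * (1 + 4 * t / δ) * u := by
        rw [ht1d]; field_simp; ring
      have hX : (x + b * y) ^ 2 = b * (x + y) ^ 2 + (δ + 4 * t1) * p ^ 2 := by
        have : b = 1 - δ := by rw [hδ]; ring
        rw [hB2]
        have he' := congrArg (fun z => δ * z) he
        rw [show δ * (1 + 4 * t / δ) * u * p ^ 2 = δ * ((1 + 4 * t / δ) * p ^ 2 * u) by ring, he']
        rw [this]; ring
      obtain ⟨p', hp', hpY⟩ : ∃ p', p' ^ 2 = p ^ 2 ∧ (x + y) - p' ≠ 0 := by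
        by_cases h : (x + y) - p = 0
        · refine ⟨-p, by ring, fun h' => ?_⟩
          have : 2 * p = 0 := by linear_combination h' - h
          rcases mul_eq_zero.1 this with h | h
          · exact h20 h
          · exact hp h
        · exact ⟨p, rfl, h⟩
      rw [← hp'] at hX
      have key : (b * (x + y) + (δ + 4 * t1) * p') ^ 2 - (1 + 4 * t1) * (x + b * y) ^ 2
          = - (b * (δ + 4 * t1) * ((x + y) - p') ^ 2) := by
        have : (1 + 4 * t1) = b + (δ + 4 * t1) := by rw [hδ]; ring
        rw [this, hX]; ring
      have hsqv : IsSquare (v ((b * (x + y) + (δ + 4 * t1) * p') ^ 2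
          - (1 + 4 * t1) * (x + b * y) ^ 2)) := by
        by_cases h : x + b * y = 0
        · rw [h]; simp only [ne_eq, OfNat.ofNat_ne_zero, not_false_eq_true, zero_pow, mul_zero,
            sub_zero, map_pow]
          exact IsSquare.sq _
        · exact (sub_sq_isSquare v hirr h2 _ _ h).2
      rw [key, Valuation.map_neg, map_mul, map_mul, hb1', hB, one_mul, mul_comm, map_pow] at hsqv
      exact hδsq (isSquare_of_mul (pow_ne_zero _ ((v.ne_zero_iff).2 hpY)) (IsSquare.sq _) hsqv)

end Local

end TwoConics

end

section

open IsDedekindDomain NumberField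
open scoped WithZero

namespace TwoConics

section Local2

variable {F : Type} [Field F] (v : Valuation F ℤᵐ⁰)

/-- local squares -/
def LS (x : F) : Prop := ∃ q : F, q ≠ 0 ∧ v (x * q ^ 2 - 1) < v 4

/-- norms from `F(√a)` -/
def NS (a x : F) : Prop := ∃ p r : F, x = p ^ 2 - a * r ^ 2

theorem val_four : v 4 = v 2 * v 2 := by rw [← map_mul]; norm_num

theorem val_four_ne (h2 : v 2 ≠ 0) : v 4 ≠ 0 := by rw [val_four]; exact mul_ne_zero h2 h2

theorem val_four_le (h2 : v 2 ≤ 1) : v 4 ≤ 1 := by rw [val_four]; exact mul_le_one' h2 h2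

theorem val_one_of_close {u : F} (h : v (u - 1) < 1) : v u = 1 := by
  have : u = 1 + (u - 1) := by ring
  rw [this, Valuation.map_add_eq_of_lt_left] <;> simpa using h

theorem exp_neg_one_lt {g : ℤᵐ⁰} (h : g < 1) : g ≤ WithZero.exp (-1 : ℤ) := by
  by_cases h0 : g = 0
  · rw [h0]; exact zero_le
  · rw [← WithZero.exp_log h0, WithZero.exp_le_exp]
    rw [← WithZero.exp_log h0, ← WithZero.exp_zero, WithZero.exp_lt_exp] at h
    omega

theorem deep_aux (h2 : v 2 ≠ 0) (h2' : v 2 ≤ 1) (x : F) (hx : LS v x) (n : ℕ) :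
    ∃ q : F, q ≠ 0 ∧ v (x * q ^ 2 - 1) ≤ v 4 * WithZero.exp (-(n + 1 : ℤ)) := by
  have h40 := val_four_ne v h2
  have h4F : (4 : F) ≠ 0 := (v.ne_zero_iff).1 h40
  induction n with
  | zero =>
    obtain ⟨q, hq, h⟩ := hx
    refine ⟨q, hq, ?_⟩
    have : v ((x * q ^ 2 - 1) / 4) < 1 := by
      rw [map_div₀, div_lt_one₀ (zero_lt_iff.2 h40)]; exact h
    have := exp_neg_one_lt this
    rw [map_div₀, div_le_iff₀ (zero_lt_iff.2 h40)] at this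
    simpa [mul_comm] using this
  | succ n ih =>
    obtain ⟨q, hq, h⟩ := ih
    obtain ⟨t, ht⟩ : ∃ t, t = (x * q ^ 2 - 1) / 4 := ⟨_, rfl⟩
    have htv : v t ≤ WithZero.exp (-(n + 1 : ℤ)) := by
      rw [ht, map_div₀, div_le_iff₀ (zero_lt_iff.2 h40), mul_comm _ (v 4)]; exact h
    have ht1 : v t < 1 := htv.trans_lt (by
      rw [← WithZero.exp_zero, WithZero.exp_lt_exp]; omega)
    have hxq : x * q ^ 2 = 1 + 4 * t := by rw [ht]; field_simp; ring
    have h12 : v (1 + 2 * t) = 1 := by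
      apply val_one_of_close
      rw [add_sub_cancel_left, map_mul]
      exact mul_lt_one_of_nonneg_of_lt_one_right h2' zero_le ht1
    have h120 : (1 + 2 * t) ≠ 0 := by intro h; rw [h] at h12; simp at h12
    refine ⟨q / (1 + 2 * t), div_ne_zero hq h120, ?_⟩
    have e : x * (q / (1 + 2 * t)) ^ 2 - 1 = - (4 * (t * t)) / (1 + 2 * t) ^ 2 := by
      rw [div_pow, ← mul_div_assoc, hxq, eq_div_iff (pow_ne_zero 2 h120), sub_mul,
        div_mul_cancel₀ _ (pow_ne_zero 2 h120)]; ring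
    rw [e, map_div₀, Valuation.map_neg, map_pow, h12, one_pow, div_one, map_mul, map_mul]
    gcongr
    calc v t * v t ≤ WithZero.exp (-(n + 1 : ℤ)) * WithZero.exp (-1) :=
          mul_le_mul' htv (exp_neg_one_lt ht1)
      _ = _ := by rw [← WithZero.exp_add]; congr 1

theorem deep (h2 : v 2 ≠ 0) (h2' : v 2 ≤ 1) (x : F) (hx : LS v x) (ε : ℤᵐ⁰) (hε : ε ≠ 0) :
    ∃ q : F, q ≠ 0 ∧ v (x * q ^ 2 - 1) < ε := by
  have h40 := val_four_ne v h2
  obtain ⟨q, hq, h⟩ := deep_aux v h2 h2' x hx (WithZero.log (v 4) - WithZero.log ε).toNat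
  refine ⟨q, hq, h.trans_lt ?_⟩
  obtain ⟨j, hj⟩ : ∃ j, j = WithZero.log (v 4) - WithZero.log ε := ⟨_, rfl⟩
  rw [← hj]
  have h1 : v 4 = WithZero.exp (WithZero.log (v 4)) := (WithZero.exp_log h40).symm
  have h2 : ε = WithZero.exp (WithZero.log ε) := (WithZero.exp_log hε).symm
  generalize WithZero.log (v 4) = i1 at *
  generalize WithZero.log ε = i2 at *
  rw [h1, h2, ← WithZero.exp_add, WithZero.exp_lt_exp]
  omega

theorem LS.ne_zero (h2 : v 2 ≤ 1) {x : F} (h : LS v x) : x ≠ 0 := by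
  rintro rfl
  obtain ⟨q, hq, h⟩ := h
  simp at h
  exact absurd (val_four_le v h2) (not_le.2 h)

theorem LS.mul (h2 : v 2 ≤ 1) {x y : F} (hx : LS v x) (hy : LS v y) : LS v (x * y) := by
  obtain ⟨q, hq, h⟩ := hx
  obtain ⟨r, hr, h'⟩ := hy
  refine ⟨q * r, mul_ne_zero hq hr, ?_⟩
  have e : x * y * (q * r) ^ 2 - 1 = (x * q ^ 2 - 1) * (y * r ^ 2) + (y * r ^ 2 - 1) := by ring
  rw [e]
  refine v.map_add_lt ?_ h'
  rw [map_mul, val_one_of_close v (h'.trans_le (val_four_le v h2)), mul_one]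
  exact h

theorem LS.inv (h2 : v 2 ≤ 1) {x : F} (hx : LS v x) : LS v x⁻¹ := by
  have hx0 := hx.ne_zero v h2
  obtain ⟨q, hq, h⟩ := hx
  refine ⟨q⁻¹, inv_ne_zero hq, ?_⟩
  have e : x⁻¹ * q⁻¹ ^ 2 - 1 = - (x * q ^ 2 - 1) / (x * q ^ 2) := by field_simp; ring
  rw [e, map_div₀, Valuation.map_neg, val_one_of_close v (h.trans_le (val_four_le v h2)), div_one]
  exact h

theorem LS.of_sq (h2 : v 2 ≠ 0) {x : F} (hx : x ≠ 0) : LS v (x ^ 2) := by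
  refine ⟨x⁻¹, inv_ne_zero hx, ?_⟩
  have : x ^ 2 * x⁻¹ ^ 2 - 1 = 0 := by field_simp; ring
  rw [this, map_zero]; exact zero_lt_iff.2 (val_four_ne v h2)

theorem NS.mul {a x y : F} (hx : NS a x) (hy : NS a y) : NS a (x * y) := by
  obtain ⟨p, r, rfl⟩ := hx
  obtain ⟨s, t, rfl⟩ := hy
  exact ⟨p * s + a * r * t, p * t + r * s, by ring⟩

theorem NS.of_sq (a x : F) : NS a (x ^ 2) := ⟨x, 0, by ring⟩

theorem NS.inv {a x : F} (hx : NS a x) : NS a x⁻¹ := by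
  by_cases h : x = 0
  · rw [h]; exact ⟨0, 0, by simp⟩
  · have : x⁻¹ = x * (x⁻¹) ^ 2 := by field_simp
    rw [this]; exact hx.mul (NS.of_sq _ _)

theorem loc_symm (h2 : v 2 ≠ 0) (h2' : v 2 ≤ 1) {a b n l : F} (hb : b ≠ 0)
    (ha : ¬ LS v a) (hn0 : n ≠ 0) (hn : NS b n) (hl : LS v l) (hnl : a = n * l) :
    ∃ m l', m ≠ 0 ∧ NS a m ∧ LS v l' ∧ b = m * l' := by
  have h40 := val_four_ne v h2
  have h4F : (4 : F) ≠ 0 := (v.ne_zero_iff).1 h40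
  have hnL : ¬ LS v n := fun h => ha (hnl ▸ h.mul v h2' hl)
  obtain ⟨p, r, hpr⟩ := hn
  have hr : r ≠ 0 := by
    rintro rfl
    apply hnL
    have : n = p ^ 2 := by rw [hpr]; ring
    have hp : p ≠ 0 := by rintro rfl; apply hn0; rw [this]; ring
    rw [this]; exact LS.of_sq v h2 hp
  obtain ⟨q, hq, hw⟩ := deep v h2 h2' l hl (v 4 * v 4) (mul_ne_zero h40 h40)
  obtain ⟨x, hx⟩ : ∃ x, x = p / r := ⟨_, rfl⟩
  obtain ⟨y, hy⟩ : ∃ y, y = 1 / r := ⟨_, rfl⟩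
  have hy0 : y ≠ 0 := by rw [hy]; exact one_div_ne_zero hr
  have hbxy : b = x ^ 2 - n * y ^ 2 := by rw [hx, hy, hpr]; field_simp; ring
  have hny : n * y ^ 2 ≠ 0 := mul_ne_zero hn0 (pow_ne_zero _ hy0)
  have hvny : 0 < v (n * y ^ 2) := zero_lt_iff.2 ((v.ne_zero_iff).2 hny)
  have claim : v 4 * v (n * y ^ 2) ≤ v b := by
    by_contra hlt
    push Not at hlt
    apply hnL
    have h5 : LS v (n⁻¹) := by
      refine ⟨x / y, div_ne_zero ?_ hy0, ?_⟩
      · intro hx0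
        rw [hbxy, hx0] at hlt
        have : v (0 ^ 2 - n * y ^ 2) = v (n * y ^ 2) := by
          rw [← Valuation.map_neg]; congr 1; ring
        rw [this] at hlt
        exact absurd (mul_le_of_le_one_left' (a := v (n * y ^ 2)) (val_four_le v h2'))
          (not_le.2 hlt)
      · have e : n⁻¹ * (x / y) ^ 2 - 1 = b / (n * y ^ 2) := by
          rw [hbxy]; field_simp
        rw [e, map_div₀, div_lt_iff₀ hvny]; exact hlt
    have := h5.inv v h2'
    rwa [inv_inv] at this
  obtain ⟨w, hwd⟩ : ∃ w, w = l * q ^ 2 := ⟨_, rfl⟩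
  rw [← hwd] at hw
  obtain ⟨m, hm⟩ : ∃ m, m = x ^ 2 - a * (q * y) ^ 2 := ⟨_, rfl⟩
  have hm' : m = b - n * (w - 1) * y ^ 2 := by rw [hm, hbxy, hwd, hnl]; ring
  have hvb : 0 < v b := zero_lt_iff.2 ((v.ne_zero_iff).2 hb)
  have hclose : v (m / b - 1) < v 4 := by
    have e : m / b - 1 = - ((n * y ^ 2) * (w - 1)) / b := by rw [hm']; field_simp; ring
    rw [e, map_div₀, Valuation.map_neg, map_mul, div_lt_iff₀ hvb]
    calc v (n * y ^ 2) * v (w - 1) < v (n * y ^ 2) * (v 4 * v 4) :=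
          mul_lt_mul_of_pos_left hw hvny
      _ = v 4 * (v 4 * v (n * y ^ 2)) := by rw [mul_comm, mul_assoc]
      _ ≤ v 4 * v b := by gcongr
  have hLS : LS v (m / b) := ⟨1, one_ne_zero, by simpa using hclose⟩
  have hm0 : m ≠ 0 := by
    rintro rfl
    have := hLS.ne_zero v h2'
    simp at this
  refine ⟨m, (m / b)⁻¹, hm0, ⟨x, q * y, hm⟩, hLS.inv v h2', ?_⟩
  field_simp

theorem loc_unram (h2 : v 2 = 1) {a b : F} (hb : v b = 1)
    (R3 : ∃ x y : F, v (x ^ 2 - a * y ^ 2 - b) < 1) :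
    ∃ m l', m ≠ 0 ∧ NS a m ∧ LS v l' ∧ b = m * l' := by
  have hb0 : b ≠ 0 := by rintro rfl; simp at hb
  obtain ⟨x, y, h⟩ := R3
  obtain ⟨m, hm⟩ : ∃ m, m = x ^ 2 - a * y ^ 2 := ⟨_, rfl⟩
  rw [← hm] at h
  have h4 : v 4 = 1 := by rw [val_four, h2, one_mul]
  have hclose : v (m / b - 1) < v 4 := by
    have e : m / b - 1 = (m - b) / b := by field_simp
    rw [e, map_div₀, hb, div_one, h4]; exact h
  have hLS : LS v (m / b) := ⟨1, one_ne_zero, by simpa using hclose⟩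
  have hm0 : m ≠ 0 := by
    rintro rfl
    have := hLS.ne_zero v h2.le
    simp at this
  refine ⟨m, (m / b)⁻¹, hm0, ⟨x, y, hm⟩, hLS.inv v h2.le, ?_⟩
  field_simp

end Local2

end TwoConics

end

section

open IsDedekindDomain NumberField
open scoped WithZero

namespace TwoConics

section NF
variable {k : Type} [Field k] [NumberField k] (p : HeightOneSpectrum (𝓞 k))

theorem val_int_le (x : 𝓞 k) : p.valuation k (x : k) ≤ 1 := p.valuation_le_one x

theorem val_int_lt_iff (x : 𝓞 k) : p.valuation k (x : k) < 1 ↔ x ∈ p.asIdeal :=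
  p.valuation_lt_one_iff_mem x

theorem coe_two : (((2 : 𝓞 k)) : k) = 2 := map_ofNat (algebraMap (𝓞 k) k) 2

theorem val_two_le : p.valuation k 2 ≤ 1 := by
  rw [← coe_two]; exact val_int_le p (2 : 𝓞 k)

theorem val_two_ne : p.valuation k 2 ≠ 0 := (Valuation.ne_zero_iff _).2 two_ne_zero

theorem approx {x : k} (h : p.valuation k x ≤ 1) : ∃ x0 : 𝓞 k, p.valuation k ((x0 : k) - x) < 1 := by
  simpa using p.exists_valuation_sub_lt_of_integer h 1

theorem mk_eq_iff (x y : 𝓞 k) : Ideal.Quotient.mk p.asIdeal x = Ideal.Quotient.mk p.asIdeal y ↔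
    p.valuation k ((x : k) - y) < 1 := by
  rw [Ideal.Quotient.eq, ← val_int_lt_iff]; push_cast; rfl

theorem nf_R1 : ∃ t : k, p.valuation k t ≤ 1 ∧
    ∀ z : k, p.valuation k z ≤ 1 → p.valuation k (z ^ 2 + z - t) = 1 := by
  let _ : Field (𝓞 k ⧸ p.asIdeal) := Ideal.Quotient.field _
  have hns : ¬ Function.Surjective (fun z : 𝓞 k ⧸ p.asIdeal => z ^ 2 + z) := by
    intro hs
    have hi := Finite.injective_iff_surjective.2 hs
    have : (0 : 𝓞 k ⧸ p.asIdeal) = -1 := hi (by simp)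
    simp at this
  unfold Function.Surjective at hns
  push Not at hns
  obtain ⟨t, ht⟩ := hns
  obtain ⟨t, rfl⟩ := Ideal.Quotient.mk_surjective t
  refine ⟨t, val_int_le p t, fun z hz => ?_⟩
  obtain ⟨z0, hz0⟩ := approx p hz
  have h1 : p.valuation k ((z0 : k) ^ 2 + z0 - t) = 1 := by
    have := ht (Ideal.Quotient.mk _ z0)
    rw [← map_pow, ← map_add, Ne, mk_eq_iff] at this
    push_cast at this
    refine le_antisymm ?_ (not_lt.1 this)
    have h9 := val_int_le p (z0 ^ 2 + z0 - t)
    push_cast at h9; exact h9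
  have e : z ^ 2 + z - t = ((z0 : k) ^ 2 + z0 - t) - (z0 - z) * (z0 + z + 1) := by ring
  rw [e, Valuation.map_sub_eq_of_lt_left, h1]
  rw [h1, map_mul]
  refine mul_lt_one_of_nonneg_of_lt_one_left zero_le hz0 ?_
  exact Valuation.map_add_le _ (Valuation.map_add_le _ (val_int_le p z0) hz) (by simp)

theorem nf_R2 (h2 : p.valuation k 2 < 1) (x : k) (hx : p.valuation k x ≤ 1) :
    ∃ m : k, p.valuation k m ≤ 1 ∧ p.valuation k (x - m ^ 2) < 1 := by
  let _ : Field (𝓞 k ⧸ p.asIdeal) := Ideal.Quotient.field _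
  have h20 : (2 : 𝓞 k ⧸ p.asIdeal) = 0 := by
    have : (2 : 𝓞 k) ∈ p.asIdeal := by rw [← val_int_lt_iff, coe_two]; exact h2
    rw [← Ideal.Quotient.eq_zero_iff_mem] at this; exact this
  have hs : Function.Surjective (fun z : 𝓞 k ⧸ p.asIdeal => z ^ 2) := by
    refine Finite.injective_iff_surjective.1 fun a b hab => ?_
    have : (a - b) ^ 2 = 0 := by
      have hab : a ^ 2 = b ^ 2 := hab
      linear_combination hab + (b ^ 2 - a * b) * h20
    exact sub_eq_zero.1 (pow_eq_zero_iff two_ne_zero |>.1 this)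
  obtain ⟨x0, hx0⟩ := approx p hx
  obtain ⟨m, hm⟩ := hs (Ideal.Quotient.mk _ x0)
  obtain ⟨m, rfl⟩ := Ideal.Quotient.mk_surjective m
  refine ⟨m, val_int_le p m, ?_⟩
  simp only [← map_pow] at hm
  rw [mk_eq_iff] at hm
  push_cast at hm
  have e : x - (m : k) ^ 2 = - ((m : k) ^ 2 - x0) - (x0 - x) := by ring
  rw [e]
  exact Valuation.map_sub_lt _ (by rwa [Valuation.map_neg]) hx0

theorem nf_R3 (h2 : p.valuation k 2 = 1) {a b : k} (ha : p.valuation k a = 1)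
    (hb : p.valuation k b = 1) :
    ∃ x y : k, p.valuation k (x ^ 2 - a * y ^ 2 - b) < 1 := by
  let _ : Field (𝓞 k ⧸ p.asIdeal) := Ideal.Quotient.field _
  have := Fintype.ofFinite (𝓞 k ⧸ p.asIdeal)
  obtain ⟨a0, ha0⟩ := approx p ha.le
  obtain ⟨b0, hb0⟩ := approx p hb.le
  have hodd : Fintype.card (𝓞 k ⧸ p.asIdeal) % 2 = 1 := by
    have h := FiniteField.even_card_iff_char_two (F := 𝓞 k ⧸ p.asIdeal)
    by_contra hne
    have hc := h.2 (by omega)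
    have : (2 : 𝓞 k ⧸ p.asIdeal) = 0 := by
      have := ringChar.Nat.cast_ringChar (R := 𝓞 k ⧸ p.asIdeal)
      rw [hc] at this; exact_mod_cast this
    have h3 : (2 : 𝓞 k) ∈ p.asIdeal := by
      rw [← Ideal.Quotient.eq_zero_iff_mem]; exact this
    rw [← val_int_lt_iff, coe_two, h2] at h3
    exact lt_irrefl _ h3
  have ha00 : Ideal.Quotient.mk p.asIdeal a0 ≠ 0 := by
    intro h
    rw [Ideal.Quotient.eq_zero_iff_mem, ← val_int_lt_iff] at h
    have : p.valuation k a < 1 := by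
      have e : a = a0 - (a0 - a) := by ring
      rw [e]; exact Valuation.map_sub_lt _ h ha0
    rw [ha] at this; exact lt_irrefl _ this
  obtain ⟨x, y, hxy⟩ := FiniteField.exists_root_sum_quadratic
    (f := (Polynomial.X ^ 2 - Polynomial.C (Ideal.Quotient.mk p.asIdeal b0)))
    (g := Polynomial.C (- Ideal.Quotient.mk p.asIdeal a0) * Polynomial.X ^ 2)
    (Polynomial.degree_X_pow_sub_C (by decide) _)
    (by rw [Polynomial.degree_C_mul_X_pow _ (neg_ne_zero.2 ha00)]; rfl) hodd
  obtain ⟨x, rfl⟩ := Ideal.Quotient.mk_surjective x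
  obtain ⟨y, rfl⟩ := Ideal.Quotient.mk_surjective y
  refine ⟨x, y, ?_⟩
  simp only [Polynomial.eval_sub, Polynomial.eval_pow, Polynomial.eval_X, Polynomial.eval_C,
    Polynomial.eval_mul] at hxy
  have h3 : Ideal.Quotient.mk p.asIdeal (x ^ 2 - a0 * y ^ 2) = Ideal.Quotient.mk p.asIdeal b0 := by
    simp only [map_sub, map_mul, map_pow]
    linear_combination hxy
  rw [mk_eq_iff] at h3
  push_cast at h3
  have e : (x : k) ^ 2 - a * y ^ 2 - b
      = ((x : k) ^ 2 - a0 * y ^ 2 - b0) + (a0 - a) * y ^ 2 + (b0 - b) := by ring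
  rw [e]
  refine Valuation.map_add_lt _ (Valuation.map_add_lt _ h3 ?_) hb0
  rw [map_mul, map_pow]
  exact mul_lt_one_of_nonneg_of_lt_one_left zero_le ha0 (pow_le_one' (val_int_le p y) 2)

/-- at odd primes, the product of two nonsquare units is a square -/
theorem odd_mul (h2 : p.valuation k 2 = 1) {a b : k} (ha : p.valuation k a = 1)
    (hb : p.valuation k b = 1) (hna : ¬ LS (p.valuation k) a) (hnb : ¬ LS (p.valuation k) b) :
    LS (p.valuation k) (a * b) := by
  let _ : Field (𝓞 k ⧸ p.asIdeal) := Ideal.Quotient.field _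
  have := Fintype.ofFinite (𝓞 k ⧸ p.asIdeal)
  have h4 : p.valuation k 4 = 1 := by rw [val_four, h2, one_mul]
  have key : ∀ c : k, p.valuation k c = 1 → ∀ c0 : 𝓞 k, p.valuation k ((c0 : k) - c) < 1 →
      IsSquare (Ideal.Quotient.mk p.asIdeal c0) → LS (p.valuation k) c := by
    intro c hc c0 hc0 hsq
    obtain ⟨m, hm⟩ := hsq
    obtain ⟨m, rfl⟩ := Ideal.Quotient.mk_surjective m
    rw [← map_mul, mk_eq_iff] at hm
    push_cast at hm
    have hcm : p.valuation k (c - (m : k) * m) < 1 := by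
      have e : c - (m : k) * m = ((c0 : k) - m * m) - (c0 - c) := by ring
      rw [e]; exact Valuation.map_sub_lt _ hm hc0
    have hvm : p.valuation k ((m : k) * m) = 1 := by
      have e : (m : k) * m = c - (c - m * m) := by ring
      rw [e, Valuation.map_sub_eq_of_lt_left, hc]
      rwa [hc]
    have hm0 : (m : k) ≠ 0 := by intro h; rw [h] at hvm; simp at hvm
    refine ⟨(m : k)⁻¹, inv_ne_zero hm0, ?_⟩
    have e : c * (m : k)⁻¹ ^ 2 - 1 = (c - m * m) / (m * m) := by field_simp
    rw [e, map_div₀, hvm, div_one, h4]; exact hcm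
  obtain ⟨a0, ha0⟩ := approx p ha.le
  obtain ⟨b0, hb0⟩ := approx p hb.le
  have hab : p.valuation k (((a0 * b0 : 𝓞 k) : k) - a * b) < 1 := by
    push_cast
    have e : (a0 : k) * b0 - a * b = (a0 - a) * b0 + a * (b0 - b) := by ring
    rw [e]
    refine Valuation.map_add_lt _ ?_ ?_
    · rw [map_mul]; exact mul_lt_one_of_nonneg_of_lt_one_left zero_le ha0 (val_int_le p b0)
    · rw [map_mul, ha, one_mul]; exact hb0
  refine key _ (by rw [map_mul, ha, hb, one_mul]) (a0 * b0) hab ?_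
  have hna0 : ¬ IsSquare (Ideal.Quotient.mk p.asIdeal a0) := fun h => hna (key a ha a0 ha0 h)
  have hnb0 : ¬ IsSquare (Ideal.Quotient.mk p.asIdeal b0) := fun h => hnb (key b hb b0 hb0 h)
  classical
  have ha' := quadraticChar_neg_one_iff_not_isSquare.2 hna0
  have hb' := quadraticChar_neg_one_iff_not_isSquare.2 hnb0
  rw [map_mul]
  rw [← quadraticChar_one_iff_isSquare]
  · rw [map_mul, ha', hb']; norm_num
  · refine mul_ne_zero ?_ ?_
    · intro h; apply hna0; rw [h]; exact IsSquare.zero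
    · intro h; apply hnb0; rw [h]; exact IsSquare.zero

end NF

end TwoConics

end

section

open IsDedekindDomain NumberField
open scoped WithZero

namespace TwoConics

section Q
variable {k : Type} [Field k]

/-- the group of square classes -/
def Qk (k : Type) [Field k] : Type := Additive (kˣ ⧸ (powMonoidHom 2 : kˣ →* kˣ).range)

noncomputable instance : AddCommGroup (Qk k) :=
  inferInstanceAs (AddCommGroup (Additive (kˣ ⧸ (powMonoidHom 2 : kˣ →* kˣ).range)))

theorem two_smul_Qk (x : Qk k) : 2 • x = 0 := by
  obtain ⟨y, rfl⟩ := QuotientGroup.mk_surjective (Additive.toMul x)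
  change Additive.ofMul ((y : kˣ ⧸ (powMonoidHom 2 : kˣ →* kˣ).range) ^ 2) = Additive.ofMul 1
  rw [← QuotientGroup.mk_pow]
  congr 1
  rw [QuotientGroup.eq_one_iff]
  exact ⟨y, rfl⟩

noncomputable instance : Module (ZMod 2) (Qk k) := AddCommGroup.zmodModule two_smul_Qk

/-- square class -/
def cls (x : kˣ) : Qk k := Additive.ofMul (QuotientGroup.mk x)

theorem cls_surj (q : Qk k) : ∃ x : kˣ, cls x = q := by
  obtain ⟨y, hy⟩ := QuotientGroup.mk_surjective (Additive.toMul q)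
  exact ⟨y, hy⟩

theorem cls_mul (x y : kˣ) : cls (x * y) = cls x + cls y := rfl

theorem cls_one : cls (1 : kˣ) = 0 := rfl

theorem cls_eq_zero {x : kˣ} : cls x = 0 ↔ ∃ y : kˣ, x = y ^ 2 := by
  change (QuotientGroup.mk x : kˣ ⧸ (powMonoidHom 2 : kˣ →* kˣ).range) = 1 ↔ _
  rw [QuotientGroup.eq_one_iff]
  constructor
  · rintro ⟨y, hy⟩; exact ⟨y, hy.symm⟩
  · rintro ⟨y, hy⟩; exact ⟨y, hy.symm⟩

theorem Qk_add_self (x : Qk k) : x + x = 0 := by rw [← two_smul ℕ x]; exact two_smul_Qk x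

theorem Qk_neg (x : Qk k) : - x = x := neg_eq_of_add_eq_zero_left (Qk_add_self x)

theorem cls_inv (x : kˣ) : cls x⁻¹ = cls x := by
  change - cls x = cls x
  exact Qk_neg _

theorem cls_sq (x : kˣ) : cls (x ^ 2) = 0 := cls_eq_zero.2 ⟨x, rfl⟩

theorem cls_eq {x y : kˣ} : cls x = cls y ↔ ∃ z : kˣ, x = y * z ^ 2 := by
  rw [← sub_eq_zero, sub_eq_add_neg, Qk_neg, ← cls_inv y, ← cls_mul, cls_eq_zero]
  constructor
  · rintro ⟨z, hz⟩; exact ⟨z, by rw [← hz, mul_comm x, mul_inv_cancel_left]⟩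
  · rintro ⟨z, hz⟩; exact ⟨z, by rw [hz, mul_comm, inv_mul_cancel_left]⟩

/-- image of a subgroup in the group of square classes -/
noncomputable def sub (H : Subgroup kˣ) : Submodule (ZMod 2) (Qk k) :=
  AddSubgroup.toZModSubmodule 2
    { carrier := {q | ∃ x ∈ H, cls x = q}
      add_mem' := by
        rintro _ _ ⟨x, hx, rfl⟩ ⟨y, hy, rfl⟩
        exact ⟨x * y, H.mul_mem hx hy, rfl⟩
      zero_mem' := ⟨1, H.one_mem, rfl⟩
      neg_mem' := by
        rintro _ ⟨x, hx, rfl⟩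
        exact ⟨x, hx, (Qk_neg _).symm⟩ }

theorem mem_sub {H : Subgroup kˣ} {q : Qk k} : q ∈ sub H ↔ ∃ x ∈ H, cls x = q := Iff.rfl

theorem cls_mem_sub {H : Subgroup kˣ} (hH : ∀ x : kˣ, x ^ 2 ∈ H) {x : kˣ} :
    cls x ∈ sub H ↔ x ∈ H := by
  rw [mem_sub]
  constructor
  · rintro ⟨y, hy, h⟩
    obtain ⟨z, rfl⟩ := cls_eq.1 h
    exact (Subgroup.mul_mem_cancel_right _ (hH z)).1 hy
  · intro h; exact ⟨x, h, rfl⟩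

theorem cls_mem_of_mem {H : Subgroup kˣ} {x : kˣ} (h : x ∈ H) : cls x ∈ sub H := ⟨x, h, rfl⟩

/-- norms from `k(√a)` -/
def NG (a : k) : Subgroup kˣ where
  carrier := {x | NS a (x : k)}
  mul_mem' := by intro x y hx hy; exact (NS.mul hx hy : NS a ((x : k) * y))
  one_mem' := ⟨1, 0, by simp⟩
  inv_mem' := by intro x hx; simpa using NS.inv hx

/-- norm classes -/
noncomputable def N (a : kˣ) : Submodule (ZMod 2) (Qk k) := sub (NG (a : k))

theorem mem_N {a x : kˣ} : cls x ∈ N a ↔ NS (a : k) (x : k) := by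
  unfold N
  rw [cls_mem_sub (fun x => ?_)]
  · rfl
  · exact (NS.of_sq (a : k) (x : k))

theorem N_of_isSquare {a : kˣ} (h : cls a = 0) (x : k) [NeZero (2 : k)] : NS (a : k) x := by
  obtain ⟨y, rfl⟩ := cls_eq_zero.1 h
  have h2 : (2 : k) ≠ 0 := NeZero.ne 2
  have hy : (y : k) ≠ 0 := y.ne_zero
  refine ⟨(x + 1) / 2, (x - 1) / (2 * y), ?_⟩
  push_cast
  field_simp; ring

end Q

section NFQ
variable {k : Type} [Field k] [NumberField k]

/-- noncomplex places -/
abbrev Pl (k : Type) [Field k] [NumberField k] : Type := HeightOneSpectrum (𝓞 k) ⊕ (k →+* ℝ)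

/-- local squares -/
def LG : Pl k → Subgroup kˣ
  | .inl p =>
    { carrier := {x | LS (p.valuation k) (x : k)}
      mul_mem' := by
        intro x y hx hy
        exact (LS.mul _ (val_two_le p) hx hy : LS (p.valuation k) ((x : k) * y))
      one_mem' := by simpa using LS.of_sq (p.valuation k) (val_two_ne p) (one_ne_zero)
      inv_mem' := by intro x hx; simpa using LS.inv _ (val_two_le p) hx }
  | .inr φ =>
    { carrier := {x | 0 < φ (x : k)}
      mul_mem' := by
        intro x y hx hy
        have : 0 < φ (x : k) * φ (y : k) := mul_pos hx hy
        simpa using this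
      one_mem' := by simp
      inv_mem' := by intro x hx; simpa using hx }

/-- classes of local squares -/
noncomputable def L (v : Pl k) : Submodule (ZMod 2) (Qk k) := sub (LG v)

theorem sq_mem_LG (v : Pl k) (x : kˣ) : x ^ 2 ∈ LG v := by
  cases v with
  | inl p => exact (LS.of_sq (p.valuation k) (val_two_ne p) x.ne_zero)
  | inr φ =>
    change 0 < φ ((x : k) ^ 2)
    rw [map_pow]
    have : φ (x : k) ≠ 0 := by simp
    positivity

theorem mem_L {v : Pl k} {x : kˣ} : cls x ∈ L v ↔ x ∈ LG v := cls_mem_sub (sq_mem_LG v)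

theorem mem_L_inl {p : HeightOneSpectrum (𝓞 k)} {x : kˣ} :
    cls x ∈ L (.inl p) ↔ LS (p.valuation k) (x : k) := mem_L

theorem mem_L_inr {φ : k →+* ℝ} {x : kˣ} : cls x ∈ L (.inr φ : Pl k) ↔ 0 < φ (x : k) := mem_L

theorem mem_NL_inl {p : HeightOneSpectrum (𝓞 k)} {a b : kˣ} :
    cls b ∈ N a ⊔ L (.inl p) ↔
      ∃ m l : k, m ≠ 0 ∧ NS (a : k) m ∧ LS (p.valuation k) l ∧ (b : k) = m * l := by
  rw [Submodule.mem_sup]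
  constructor
  · rintro ⟨x, hx, y, hy, h⟩
    obtain ⟨x, rfl⟩ := cls_surj x
    obtain ⟨y, rfl⟩ := cls_surj y
    rw [mem_N] at hx
    rw [mem_L_inl] at hy
    rw [← cls_mul] at h
    obtain ⟨z, hz⟩ := cls_eq.1 h.symm
    refine ⟨x * (z : k) ^ 2, y, mul_ne_zero x.ne_zero (pow_ne_zero _ z.ne_zero),
      hx.mul (NS.of_sq _ _), hy, ?_⟩
    rw [hz]; push_cast; ring
  · rintro ⟨m, l, hm, hN, hL, h⟩
    have hl := hL.ne_zero _ (val_two_le p)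
    refine ⟨cls (Units.mk0 m hm), mem_N.2 hN, cls (Units.mk0 l hl), mem_L_inl.2 hL, ?_⟩
    rw [← cls_mul]; congr 1
    ext; simp [h]

theorem N_le_L_real {φ : k →+* ℝ} {a : kˣ} (ha : cls a ∉ L (.inr φ : Pl k)) :
    N a ≤ L (.inr φ : Pl k) := by
  intro x hx
  obtain ⟨x, rfl⟩ := cls_surj x
  rw [mem_L_inr] at ha ⊢
  obtain ⟨p, r, h⟩ := mem_N.1 hx
  have h2 : 0 ≤ φ (x : k) := by
    rw [h, map_sub, map_mul, map_pow, map_pow]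
    nlinarith [sq_nonneg (φ p), sq_nonneg (φ r)]
  refine lt_of_le_of_ne h2 fun h => ?_
  have := (map_eq_zero φ).1 h.symm
  exact x.ne_zero this

/-- (L) -/
theorem NL_ne_top {v : Pl k} {a : kˣ} (ha : cls a ∉ L v) : N a ⊔ L v ≠ ⊤ := by
  intro htop
  cases v with
  | inl p =>
    apply ha
    rw [mem_L_inl]
    refine loc_nonnorm (p.valuation k) (p.valuation_surjective k) (val_two_ne p) (val_two_le p)
      (nf_R1 p) (nf_R2 p) a a.ne_zero fun c hc => ?_
    have : cls (Units.mk0 c hc) ∈ N a ⊔ L (.inl p) := by rw [htop]; trivial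
    obtain ⟨m, l, hm, ⟨x, y, hN⟩, hL, h⟩ := mem_NL_inl.1 this
    obtain ⟨q, hq, hq'⟩ := hL.inv _ (val_two_le p)
    have hl := hL.ne_zero _ (val_two_le p)
    refine ⟨l⁻¹ * q ^ 2, 1, x * q, y * q, one_ne_zero, hq', ?_⟩
    simp only [Units.val_mk0] at h
    rw [h, hN]; field_simp
  | inr φ =>
    rw [sup_eq_right.2 (N_le_L_real ha)] at htop
    have : cls (-1 : kˣ) ∈ L (.inr φ : Pl k) := by rw [htop]; trivial
    rw [mem_L_inr] at this
    simp at this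
    linarith

theorem NL_symm {v : Pl k} {a b : kˣ} (ha : cls a ∉ L v) (h : cls a ∈ N b ⊔ L v) :
    cls b ∈ N a ⊔ L v := by
  cases v with
  | inl p =>
    rw [mem_NL_inl] at h ⊢
    obtain ⟨n, l, hn, hN, hL, h⟩ := h
    exact loc_symm _ (val_two_ne p) (val_two_le p) b.ne_zero (fun h => ha (mem_L_inl.2 h)) hn hN hL h
  | inr φ =>
    by_cases hb : cls b ∈ L (.inr φ : Pl k)
    · exact Submodule.mem_sup_right hb
    · rw [sup_eq_right.2 (N_le_L_real hb)] at h
      exact absurd h ha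

theorem NL_unram {p : HeightOneSpectrum (𝓞 k)} (h2 : p.valuation k 2 = 1) {a b : kˣ}
    (ha : p.valuation k a = 1) (hb : p.valuation k b = 1) : cls b ∈ N a ⊔ L (.inl p) := by
  rw [mem_NL_inl]
  exact loc_unram _ h2 hb (nf_R3 p h2 ha hb)

theorem neg_mem_N (a : kˣ) : cls (-a) ∈ N a := mem_N.2 ⟨0, 1, by push_cast; ring⟩

/-- `S`-units -/
def EG (S : Set (HeightOneSpectrum (𝓞 k))) : Subgroup kˣ where
  carrier := {x | ∀ p ∉ S, p.valuation k (x : k) = 1}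
  mul_mem' := by
    intro x y hx hy p hp
    simp [hx p hp, hy p hp]
  one_mem' := by intro p hp; simp
  inv_mem' := by intro x hx p hp; simp [hx p hp]

/-- classes of `S`-units -/
noncomputable def V (S : Set (HeightOneSpectrum (𝓞 k))) : Submodule (ZMod 2) (Qk k) := sub (EG S)

theorem mem_EG {S : Set (HeightOneSpectrum (𝓞 k))} {x : kˣ} :
    x ∈ EG S ↔ ∀ p ∉ S, p.valuation k (x : k) = 1 := Iff.rfl

theorem V_mono {S T : Set (HeightOneSpectrum (𝓞 k))} (h : S ⊆ T) : V S ≤ V T := by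
  rintro _ ⟨x, hx, rfl⟩
  exact ⟨x, fun p hp => hx p (fun h' => hp (h h')), rfl⟩

end NFQ

end TwoConics

end

section

open IsDedekindDomain NumberField
open scoped WithZero

namespace TwoConics

section WA
variable {k : Type} [Field k] [NumberField k]

/-- absolute value attached to a place -/
noncomputable def AV : Pl k → AbsoluteValue k ℝ
  | .inl p => HeightOneSpectrum.adicAbv k p
  | .inr φ => (InfinitePlace.mk ((algebraMap ℝ ℂ).comp φ)).1

theorem AV_inl_lt (p : HeightOneSpectrum (𝓞 k)) (x y : k) :
    AV (.inl p) x < AV (.inl p) y ↔ p.valuation k x < p.valuation k y := by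
  change HeightOneSpectrum.adicAbv k p x < HeightOneSpectrum.adicAbv k p y ↔ _
  rw [HeightOneSpectrum.adicAbv_def, HeightOneSpectrum.adicAbv_def, NNReal.coe_lt_coe]
  exact (WithZeroMulInt.toNNReal_strictMono (HeightOneSpectrum.one_lt_absNorm_nnreal p)).lt_iff_lt

theorem AV_inr (φ : k →+* ℝ) (x : k) : AV (.inr φ : Pl k) x = |φ x| := by
  change (InfinitePlace.mk ((algebraMap ℝ ℂ).comp φ)) x = _
  rw [InfinitePlace.apply]
  simp

theorem AV_nontrivial (v : Pl k) : (AV v).IsNontrivial := by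
  cases v with
  | inl p =>
    obtain ⟨π, hπ⟩ := p.valuation_exists_uniformizer k
    have hπ0 : π ≠ 0 := by rintro rfl; simp at hπ; exact WithZero.exp_ne_zero hπ.symm
    refine ⟨π, hπ0, ne_of_lt ?_⟩
    rw [← map_one (AV (.inl p)), AV_inl_lt, hπ, map_one, ← WithZero.exp_zero, WithZero.exp_lt_exp]
    omega
  | inr φ => exact InfinitePlace.isNontrivial _

theorem AV_mixed (p : HeightOneSpectrum (𝓞 k)) (φ : k →+* ℝ) :
    ¬ (AV (.inl p)).IsEquiv (AV (.inr φ)) := by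
  intro h
  have h1 : ¬ AV (.inl p) 1 < AV (.inl p) (2 : k) := by
    rw [AV_inl_lt, map_one]
    exact not_lt.2 (val_two_le p)
  apply h1
  rw [h.lt_iff_lt, AV_inr, AV_inr, map_one, map_ofNat]
  norm_num

theorem AV_inj {v w : Pl k} (h : (AV v).IsEquiv (AV w)) : v = w := by
  cases v with
  | inl p =>
    cases w with
    | inl q =>
      congr 1
      apply HeightOneSpectrum.eq_of_valuation_isEquiv_valuation (K := k)
      rw [Valuation.isEquiv_iff_val_lt_one]
      intro x
      have h3 := h.lt_iff_lt (x := x) (y := 1)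
      rw [AV_inl_lt, AV_inl_lt, map_one, map_one] at h3
      exact h3
    | inr φ => exact absurd h (AV_mixed p φ)
  | inr φ =>
    cases w with
    | inl q => exact absurd h.symm (AV_mixed q φ)
    | inr ψ =>
      congr 1
      have := InfinitePlace.eq_iff_isEquiv.2 h
      rw [InfinitePlace.mk_eq_iff] at this
      ext x
      rcases this with h | h
      · have := RingHom.congr_fun h x
        simpa using this
      · have := RingHom.congr_fun h x
        simpa using this

/-- weak approximation -/
theorem weak_approx (S : Finset (Pl k)) (x : Pl k → kˣ) :
    ∃ y : kˣ, ∀ v ∈ S, cls y + cls (x v) ∈ L v := by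
  classical
  rcases S.eq_empty_or_nonempty with rfl | hne
  · exact ⟨1, by simp⟩
  have hd := AbsoluteValue.denseRange_algebraMap_pi (F := k) (ι := S) (v := fun v => AV v.1)
    (fun v => AV_nontrivial v.1) (fun v w hvw h => hvw (Subtype.ext (AV_inj h)))
  obtain ⟨r, hr0, hr⟩ : ∃ r : ℝ, 0 < r ∧ ∀ v ∈ S, r ≤ AV v (4 * (x v : k)) ∧ r ≤ AV v (x v : k) := by
    refine ⟨S.inf' hne (fun v => min (AV v (4 * (x v : k))) (AV v (x v : k))), ?_, ?_⟩
    · rw [Finset.lt_inf'_iff]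
      intro v hv
      refine lt_min ((AV v).pos (mul_ne_zero (by norm_num) (x v).ne_zero)) ((AV v).pos (x v).ne_zero)
    · intro v hv
      have := Finset.inf'_le (fun v => min (AV v (4 * (x v : k))) (AV v (x v : k))) hv
      exact ⟨this.trans (min_le_left _ _), this.trans (min_le_right _ _)⟩
  rw [Metric.denseRange_iff] at hd
  obtain ⟨y, hy⟩ := hd (fun v => WithAbs.toAbs _ (x v.1 : k)) r hr0
  have hy' : ∀ v ∈ S, AV v (x v - y) < r := by
    intro v hv
    have h1 := (dist_pi_lt_iff hr0).1 hy ⟨v, hv⟩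
    rw [dist_eq_norm, WithAbs.norm_eq_apply_ofAbs] at h1
    exact h1
  have hy0 : y ≠ 0 := by
    rintro rfl
    obtain ⟨v, hv⟩ := hne
    have := hy' v hv
    rw [sub_zero] at this
    exact absurd (hr v hv).2 (not_le.2 this)
  refine ⟨Units.mk0 y hy0, fun v hv => ?_⟩
  rw [← cls_mul]
  have h1 := hy' v hv
  cases v with
  | inl p =>
    rw [mem_L_inl]
    have h2 := h1.trans_le (hr _ hv).1
    rw [AV_inl_lt] at h2
    obtain ⟨X, hX⟩ : ∃ X, X = (x (.inl p) : k) := ⟨_, rfl⟩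
    have hX0 : X ≠ 0 := by rw [hX]; exact Units.ne_zero _
    rw [← hX] at h2
    refine ⟨X⁻¹, inv_ne_zero hX0, ?_⟩
    push_cast
    rw [Units.val_mk0, ← hX]
    have e : y * X * X⁻¹ ^ 2 - 1 = - (X - y) / X := by field_simp; ring
    rw [e, map_div₀, Valuation.map_neg, div_lt_iff₀ (zero_lt_iff.2 ((Valuation.ne_zero_iff _).2 hX0)),
      ← map_mul]
    exact h2
  | inr φ =>
    rw [mem_L_inr]
    have h2 := h1.trans_le (hr _ hv).2
    rw [AV_inr, AV_inr] at h2
    push_cast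
    rw [Units.val_mk0, map_mul]
    rw [map_sub] at h2
    obtain ⟨X, hX⟩ : ∃ X, X = φ (x (.inr φ) : k) := ⟨_, rfl⟩
    rw [← hX] at h2 ⊢
    have := sq_lt_sq.2 h2
    nlinarith [sq_nonneg (φ y)]

end WA

end TwoConics

end

section

open IsDedekindDomain NumberField
open scoped WithZero

namespace TwoConics

section Generic

theorem rank_nullity {M N : Type} [AddCommGroup M] [AddCommGroup N] [Module.Finite ℤ M]
    (f : M →ₗ[ℤ] N) :
    Module.finrank ℤ f.range + Module.finrank ℤ f.ker = Module.finrank ℤ M := by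
  rw [← f.quotKerEquivRange.finrank_eq]
  exact Submodule.finrank_quotient_add_finrank _

theorem index_two_mul (M : Type) [AddCommGroup M] [Module.Finite ℤ M] :
    (nsmulAddMonoidHom (α := M) 2).range.index =
      2 ^ (Module.finrank ℤ M) * Nat.card (nsmulAddMonoidHom (α := M) 2).ker := by
  have : AddGroup.FG M := AddGroup.fg_iff_addMonoid_fg.2 (Module.Finite.iff_addGroup_fg.1 ‹_› |> AddGroup.fg_iff_addMonoid_fg.1)
  obtain ⟨n, ι, hι, p, hp, e, ⟨f⟩⟩ := AddCommGroup.equiv_free_prod_directSum_zmod M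
  let T := DirectSum ι fun i => ZMod (p i ^ e i)
  have : ∀ i, NeZero (p i ^ e i) := fun i => ⟨pow_ne_zero _ (hp i).ne_zero⟩
  have hT : Finite T := Finite.of_equiv _ (DFinsupp.equivFunOnFintype (β := fun i => ZMod (p i ^ e i))).symm
  have h1 : (nsmulAddMonoidHom (α := M) 2).range.index =
      (nsmulAddMonoidHom (α := (Fin n →₀ ℤ) × T) 2).range.index := by
    rw [← AddSubgroup.index_map_equiv _ f]
    congr 1
    ext x
    constructor
    · rintro ⟨_, ⟨y, rfl⟩, rfl⟩; exact ⟨f y, by simp⟩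
    · rintro ⟨y, rfl⟩; exact ⟨_, ⟨f.symm y, rfl⟩, by simp⟩
  have h2 : (nsmulAddMonoidHom (α := (Fin n →₀ ℤ) × T) 2).range =
     (nsmulAddMonoidHom (α := (Fin n →₀ ℤ)) 2).range.prod (nsmulAddMonoidHom (α := T) 2).range := by
    ext ⟨x, y⟩
    constructor
    · rintro ⟨⟨a, b⟩, h⟩
      exact ⟨⟨a, congrArg Prod.fst h⟩, ⟨b, congrArg Prod.snd h⟩⟩
    · rintro ⟨⟨a, h⟩, ⟨b, h'⟩⟩
      exact ⟨⟨a, b⟩, Prod.ext h h'⟩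
  have h3 : Module.finrank ℤ M = n := by
    rw [f.toIntLinearEquiv.finrank_eq]
    change Module.finrank ℤ ((Fin n →₀ ℤ) × T) = n
    have hfin : Module.Finite ℤ T := Module.Finite.of_finite
    have h0 : Module.finrank ℤ T = 0 := by
      rw [Module.finrank_eq_zero_iff_isTorsion]
      intro x
      refine ⟨⟨(Nat.card T : ℤ), ?_⟩, ?_⟩
      · rw [mem_nonZeroDivisors_iff_ne_zero]
        exact_mod_cast Nat.card_pos.ne'
      · change (Nat.card T : ℤ) • x = 0
        rw [natCast_zsmul]
        exact card_nsmul_eq_zero'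
    have h := rank_nullity (LinearMap.fst ℤ (Fin n →₀ ℤ) T)
    rw [LinearMap.range_eq_top.2 LinearMap.fst_surjective, finrank_top, LinearMap.ker_fst,
      LinearMap.finrank_range_of_inj LinearMap.inr_injective, h0] at h
    simpa using h.symm
  have h4 : Nat.card (nsmulAddMonoidHom (α := M) 2).ker = Nat.card (nsmulAddMonoidHom (α := T) 2).ker := by
    refine Nat.card_congr ⟨fun x => ⟨(f x).2, ?_⟩, fun y => ⟨f.symm (0, y), ?_⟩, ?_, ?_⟩
    · have := x.2
      rw [AddMonoidHom.mem_ker] at this ⊢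
      have h := congrArg f this
      simp only [nsmulAddMonoidHom_apply, map_nsmul, map_zero] at h
      exact congrArg Prod.snd h
    · have := y.2
      rw [AddMonoidHom.mem_ker] at this ⊢
      simp only [nsmulAddMonoidHom_apply] at this ⊢
      rw [← map_nsmul, Prod.smul_mk, this]; simp
    · intro x
      have := x.2
      rw [AddMonoidHom.mem_ker] at this
      have h := congrArg f this
      simp only [nsmulAddMonoidHom_apply, map_nsmul, map_zero] at h
      have h0 : (f x).1 = 0 := by
        have := congrArg Prod.fst h
        simpa using this
      ext
      simp only
      rw [AddEquiv.symm_apply_eq]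
      exact Prod.ext h0.symm rfl
    · intro y
      ext; simp
  rw [h1, h2, AddSubgroup.index_prod, AddSubgroup.index_range_nsmul, h3, h4]
  rw [AddSubgroup.index_range]
  simp

end Generic

end TwoConics

end

section

open IsDedekindDomain NumberField
open scoped WithZero

namespace TwoConics

section SU

theorem index_sq {F : Type} [Field F] [NeZero (2 : F)] (H : Subgroup Fˣ) (h1 : -1 ∈ H)
    [Module.Finite ℤ (Additive H)] :
    (nsmulAddMonoidHom (α := Additive H) 2).range.index =
      2 ^ (Module.finrank ℤ (Additive H) + 1) := by
  rw [index_two_mul, pow_succ]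
  congr 1
  rw [Nat.card_eq_two_iff]
  let m : Additive H := Additive.ofMul (⟨-1, h1⟩ : H)
  have hm : m ∈ (nsmulAddMonoidHom (α := Additive H) 2).ker := by
    rw [AddMonoidHom.mem_ker]
    change Additive.ofMul ((⟨-1, h1⟩ : H) ^ 2) = Additive.ofMul 1
    congr 1; ext; simp
  have h2 : (2 : F) ≠ 0 := NeZero.ne 2
  refine ⟨0, ⟨m, hm⟩, ?_, ?_⟩
  · intro h
    have h' : (1 : H) = ⟨-1, h1⟩ := congrArg Subtype.val h
    have h'' : (1 : F) = -1 := congrArg (fun x : H => ((x : Fˣ) : F)) h'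
    apply h2; linear_combination h''
  · ext ⟨x, hx⟩
    simp only [Set.mem_insert_iff, Set.mem_singleton_iff, Set.mem_univ, iff_true]
    rw [AddMonoidHom.mem_ker] at hx
    have hx' : (x.toMul) ^ 2 = 1 := hx
    have hx'' : (((x.toMul : H) : Fˣ) : F) ^ 2 = 1 := by
      have := congrArg (fun x : H => ((x : Fˣ) : F)) hx'
      simpa using this
    rcases eq_or_eq_neg_of_sq_eq_sq _ 1 (hx''.trans (one_pow 2).symm) with h | h
    · left
      apply Subtype.ext
      change x.toMul = 1
      ext; simpa using h
    · right
      apply Subtype.ext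
      change x.toMul = ⟨-1, h1⟩
      ext; simpa using h

theorem card_sub {k : Type} [Field k] [NeZero (2 : k)] (H : Subgroup kˣ) (h1 : -1 ∈ H)
    (hs : ∀ x : kˣ, x ^ 2 ∈ H → x ∈ H) [Module.Finite ℤ (Additive H)] :
    Nat.card (sub H) = 2 ^ (Module.finrank ℤ (Additive H) + 1) := by
  let c : Additive H →+ Qk k :=
    { toFun := fun x => cls (x.toMul : kˣ)
      map_zero' := rfl
      map_add' := fun _ _ => rfl }
  have hr : c.ker = (nsmulAddMonoidHom (α := Additive H) 2).range := by
    ext x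
    rw [AddMonoidHom.mem_ker]
    change cls (x.toMul : kˣ) = 0 ↔ _
    rw [cls_eq_zero]
    constructor
    · rintro ⟨y, hy⟩
      refine ⟨Additive.ofMul ⟨y, hs y (hy ▸ x.toMul.2)⟩, ?_⟩
      change _ = x.toMul
      apply Subtype.ext
      exact hy.symm
    · rintro ⟨y, rfl⟩
      exact ⟨y.toMul, rfl⟩
  rw [← index_sq H h1, ← hr, AddSubgroup.index_ker]
  refine Nat.card_congr (Equiv.setCongr ?_)
  ext q
  constructor
  · rintro ⟨x, hx, rfl⟩; exact ⟨Additive.ofMul ⟨x, hx⟩, rfl⟩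
  · rintro ⟨x, rfl⟩; exact ⟨_, x.toMul.2, rfl⟩

variable {k : Type} [Field k] [NumberField k]

theorem exists_gen (p : HeightOneSpectrum (𝓞 k)) : ∃ h : ℕ, 0 < h ∧ ∃ x : kˣ,
    p.valuation k (x : k) = WithZero.exp (-(h : ℤ)) ∧ ∀ q ≠ p, q.valuation k (x : k) = 1 := by
  have hp0 : p.asIdeal ∈ nonZeroDivisors (Ideal (𝓞 k)) := mem_nonZeroDivisors_of_ne_zero p.ne_bot
  have h1 : ClassGroup.mk0 ((⟨p.asIdeal, hp0⟩ : nonZeroDivisors (Ideal (𝓞 k))) ^ Fintype.card (ClassGroup (𝓞 k))) = 1 := by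
    rw [map_pow, pow_card_eq_one]
  set h := Fintype.card (ClassGroup (𝓞 k)) with hh
  have hpos : 0 < h := Fintype.card_pos
  refine ⟨h, hpos, ?_⟩
  rw [ClassGroup.mk0_eq_one_iff] at h1
  obtain ⟨⟨x, hx⟩⟩ := h1
  have hx : p.asIdeal ^ h = Ideal.span {x} := by simpa using hx
  have hx0 : x ≠ 0 := by
    rintro rfl
    rw [Ideal.span_singleton_eq_bot.2 rfl] at hx
    exact p.ne_bot (pow_eq_zero_iff hpos.ne' |>.1 hx)
  refine ⟨Units.mk0 (x : k) (by simpa using hx0), ?_, ?_⟩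
  · rw [Units.val_mk0, HeightOneSpectrum.valuation_of_algebraMap,
      HeightOneSpectrum.intValuation_eq_exp_neg_multiplicity _ hx0, ← hx]
    congr 3
    exact multiplicity_pow_self p.ne_bot p.irreducible.not_isUnit h
  · intro q hq
    rw [Units.val_mk0]
    refine le_antisymm (val_int_le q x) (not_lt.1 fun hlt => hq ?_)
    rw [val_int_lt_iff, ← Ideal.span_singleton_le_iff_mem, ← hx] at hlt
    have := q.isPrime.le_of_pow_le hlt
    exact (HeightOneSpectrum.ext (p.isMaximal.eq_of_le q.isPrime.ne_top this)).symm

noncomputable def logv (p : HeightOneSpectrum (𝓞 k)) (x : kˣ) : ℤ :=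
  WithZero.log (p.valuation k (x : k))

theorem exp_logv (p : HeightOneSpectrum (𝓞 k)) (x : kˣ) :
    WithZero.exp (logv p x) = p.valuation k (x : k) :=
  WithZero.exp_log ((Valuation.ne_zero_iff _).2 x.ne_zero)

theorem logv_mul (p : HeightOneSpectrum (𝓞 k)) (x y : kˣ) :
    logv p (x * y) = logv p x + logv p y := by
  unfold logv
  rw [Units.val_mul, map_mul, WithZero.log_mul ((Valuation.ne_zero_iff _).2 x.ne_zero)
    ((Valuation.ne_zero_iff _).2 y.ne_zero)]

theorem logv_eq_zero {p : HeightOneSpectrum (𝓞 k)} {x : kˣ} :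
    logv p x = 0 ↔ p.valuation k (x : k) = 1 := by
  rw [← exp_logv, ← WithZero.exp_zero, WithZero.exp_inj]

theorem logv_one (p : HeightOneSpectrum (𝓞 k)) : logv p 1 = 0 := logv_eq_zero.2 (by simp)

noncomputable def logMap (S : Finset (HeightOneSpectrum (𝓞 k))) :
    Additive (EG (S : Set (HeightOneSpectrum (𝓞 k)))) →ₗ[ℤ] (S → ℤ) :=
  AddMonoidHom.toIntLinearMap
    { toFun := fun x p => logv p.1 (x.toMul : kˣ)
      map_zero' := by ext p; exact logv_one _
      map_add' := by intro x y; ext p; exact logv_mul _ _ _ }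

theorem val_unit (p : HeightOneSpectrum (𝓞 k)) (u : (𝓞 k)ˣ) : p.valuation k ((u : 𝓞 k) : k) = 1 := by
  refine le_antisymm (val_int_le p _) ?_
  have h := val_int_le p (u⁻¹ : (𝓞 k)ˣ)
  have : p.valuation k ((u : 𝓞 k) : k) * p.valuation k (((u⁻¹ : (𝓞 k)ˣ) : 𝓞 k) : k) = 1 := by
    rw [← map_mul, ← map_mul]; simp
  rw [← this]
  exact mul_le_of_le_one_right zero_le h

noncomputable def unitMap (S : Finset (HeightOneSpectrum (𝓞 k))) :
    Additive (𝓞 k)ˣ →ₗ[ℤ] Additive (EG (S : Set (HeightOneSpectrum (𝓞 k)))) :=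
  AddMonoidHom.toIntLinearMap
    { toFun := fun u => Additive.ofMul ⟨Units.map (algebraMap (𝓞 k) k) u.toMul,
        fun p _ => val_unit p u.toMul⟩
      map_zero' := by
        change Additive.ofMul _ = Additive.ofMul 1
        congr 1
      map_add' := by
        intro x y
        rw [← ofMul_mul]; congr 1 }

theorem unitMap_inj (S : Finset (HeightOneSpectrum (𝓞 k))) : Function.Injective (unitMap S) := by
  intro x y h
  have h1 := congrArg (fun x : Additive (EG (S : Set (HeightOneSpectrum (𝓞 k)))) => ((x.toMul : kˣ) : k)) h
  have h2 : algebraMap (𝓞 k) k (x.toMul : 𝓞 k) = algebraMap (𝓞 k) k (y.toMul : 𝓞 k) := h1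
  have h3 := RingOfIntegers.coe_injective h2
  exact Additive.toMul.injective (Units.ext h3)

theorem unitMap_range (S : Finset (HeightOneSpectrum (𝓞 k))) : (unitMap S).range = (logMap S).ker := by
  ext x
  rw [LinearMap.mem_ker]
  constructor
  · rintro ⟨u, rfl⟩
    ext p
    exact logv_eq_zero.2 (val_unit p.1 u.toMul)
  · intro hx
    have hv : ∀ p : HeightOneSpectrum (𝓞 k), p.valuation k ((x.toMul : kˣ) : k) = 1 := by
      intro p
      by_cases hp : p ∈ S
      · exact logv_eq_zero.1 (congrFun hx ⟨p, hp⟩)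
      · exact x.toMul.2 p (by simpa using hp)
    obtain ⟨y, hy⟩ := HeightOneSpectrum.mem_integers_of_valuation_le_one k ((x.toMul : kˣ) : k) (fun p => (hv p).le)
    obtain ⟨z, hz⟩ := HeightOneSpectrum.mem_integers_of_valuation_le_one k (((x.toMul : kˣ)⁻¹ : kˣ) : k)
      (fun p => by rw [Units.val_inv_eq_inv_val, map_inv₀, hv p, inv_one])
    have hyz : y * z = 1 := by
      apply RingOfIntegers.coe_injective
      rw [map_mul, hy, hz]; simp
    refine ⟨Additive.ofMul (Units.mkOfMulEqOne y z hyz), ?_⟩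
    apply Additive.toMul.injective
    apply Subtype.ext
    apply Units.ext
    exact hy

instance finite_EG (S : Finset (HeightOneSpectrum (𝓞 k))) :
    Module.Finite ℤ (Additive (EG (S : Set (HeightOneSpectrum (𝓞 k))))) := by
  constructor
  refine Submodule.fg_of_fg_map_of_fg_inf_ker (logMap S) ?_ ?_
  · exact IsNoetherian.noetherian _
  · rw [top_inf_eq, ← unitMap_range, LinearMap.range_eq_map]
    exact Submodule.FG.map _ Module.Finite.fg_top

theorem finrank_EG (S : Finset (HeightOneSpectrum (𝓞 k))) :
    Module.finrank ℤ (Additive (EG (S : Set (HeightOneSpectrum (𝓞 k))))) + 1 =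
      S.card + Fintype.card (InfinitePlace k) := by
  classical
  rw [← rank_nullity (logMap S), ← unitMap_range, LinearMap.finrank_range_of_inj (unitMap_inj S),
    NumberField.Units.finrank_eq]
  have h1 : 0 < Fintype.card (InfinitePlace k) := Fintype.card_pos
  have h2 : Module.finrank ℤ (logMap S).range = S.card := by
    have h := Submodule.finrank_quotient_add_finrank (logMap S).range
    have h0 : Module.finrank ℤ ((S → ℤ) ⧸ (logMap S).range) = 0 := by
      rw [Module.finrank_eq_zero_iff_isTorsion]
      have key : ∀ p : S, ∃ n : ℤ, n ≠ 0 ∧ Pi.single p n ∈ (logMap S).range := by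
        intro p
        obtain ⟨h, hpos, x, hx, hq⟩ := exists_gen p.1
        refine ⟨-h, by simp; lia, Additive.ofMul ⟨x, fun q hq' => hq q ?_⟩, ?_⟩
        · rintro rfl; exact hq' p.2
        · ext q
          change logv q.1 x = _
          by_cases hqp : q = p
          · subst hqp
            rw [Pi.single_eq_same]
            unfold logv; rw [hx, WithZero.log_exp]
          · rw [Pi.single_eq_of_ne hqp, logv_eq_zero]
            exact hq _ (fun h => hqp (Subtype.ext h))
      choose n hn0 hn using key
      intro x
      obtain ⟨x, rfl⟩ := Submodule.mkQ_surjective _ x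
      refine ⟨⟨∏ p, n p, mem_nonZeroDivisors_of_ne_zero (Finset.prod_ne_zero_iff.2 fun p _ => hn0 p)⟩, ?_⟩
      change (∏ p, n p) • ((logMap S).range.mkQ x) = 0
      rw [← map_smul, Submodule.mkQ_apply, Submodule.Quotient.mk_eq_zero]
      have : (∏ p, n p) • x = ∑ p, (x p * ∏ q ∈ Finset.univ.erase p, n q) • Pi.single (M := fun _ => ℤ) p (n p) := by
        ext q
        rw [Finset.sum_apply, Finset.sum_eq_single q]
        · simp only [Pi.smul_apply, Pi.single_eq_same, smul_eq_mul]
          rw [← Finset.prod_erase_mul _ _ (Finset.mem_univ q)]; ring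
        · intro b _ hb; simp [Pi.single_eq_of_ne hb.symm]
        · simp
      rw [this]
      exact Submodule.sum_mem _ fun p _ => Submodule.smul_mem _ _ (hn p)
    rw [h0, zero_add] at h
    rw [h]; simp
  rw [h2, NumberField.Units.rank]
  lia

theorem neg_one_mem_EG (S : Set (HeightOneSpectrum (𝓞 k))) : -1 ∈ EG S := by
  intro p _
  simp

theorem sq_mem_EG {S : Set (HeightOneSpectrum (𝓞 k))} {x : kˣ} (h : x ^ 2 ∈ EG S) : x ∈ EG S := by
  intro p hp
  have := h p hp
  rw [Units.val_pow_eq_pow_val, map_pow] at this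
  exact (pow_eq_one_iff_of_nonneg zero_le two_ne_zero).1 this

theorem card_V (S : Finset (HeightOneSpectrum (𝓞 k))) :
    Nat.card (V (S : Set (HeightOneSpectrum (𝓞 k)))) = 2 ^ (S.card + Fintype.card (InfinitePlace k)) := by
  rw [← finrank_EG]
  exact card_sub _ (neg_one_mem_EG _) (fun x hx => sq_mem_EG hx)

instance finite_V (S : Finset (HeightOneSpectrum (𝓞 k))) :
    Finite (V (S : Set (HeightOneSpectrum (𝓞 k)))) :=
  Nat.finite_of_card_ne_zero (by rw [card_V]; positivity)

theorem finrank_V (S : Finset (HeightOneSpectrum (𝓞 k))) :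
    Module.finrank (ZMod 2) (V (S : Set (HeightOneSpectrum (𝓞 k)))) = S.card + Fintype.card (InfinitePlace k) := by
  have h := card_V S
  rw [Module.natCard_eq_pow_finrank (K := ZMod 2), Nat.card_zmod] at h
  exact Nat.pow_right_injective le_rfl h

end SU

end TwoConics

end

section

open IsDedekindDomain NumberField
open scoped WithZero

namespace TwoConics

section Good

variable {k : Type} [Field k] [NumberField k]

theorem finite_bad (x : kˣ) : {p : HeightOneSpectrum (𝓞 k) | p.valuation k (x : k) ≠ 1}.Finite := by
  refine ((HeightOneSpectrum.Support.finite (𝓞 k) (x : k)).union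
    (HeightOneSpectrum.Support.finite (𝓞 k) ((x⁻¹ : kˣ) : k))).subset ?_
  intro p hp
  rcases lt_or_gt_of_ne hp with h | h
  · right
    change 1 < p.valuation k ((x⁻¹ : kˣ) : k)
    rw [Units.val_inv_eq_inv_val, map_inv₀]
    exact (one_lt_inv₀ (zero_lt_iff.2 ((Valuation.ne_zero_iff _).2 x.ne_zero))).2 h
  · left; exact h

noncomputable def bad (x : kˣ) : Finset (HeightOneSpectrum (𝓞 k)) := (finite_bad x).toFinset

theorem val_of_not_bad {x : kˣ} {p : HeightOneSpectrum (𝓞 k)} (h : p ∉ bad x) : p.valuation k (x : k) = 1 := by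
  by_contra hne
  exact h ((finite_bad x).mem_toFinset.2 hne)

theorem logv_of_not_bad {x : kˣ} {p : HeightOneSpectrum (𝓞 k)} (h : p ∉ bad x) : logv p x = 0 :=
  logv_eq_zero.2 (val_of_not_bad h)

/-- good sets of primes -/
def Good (S : Finset (HeightOneSpectrum (𝓞 k))) : Prop :=
  (∀ p ∉ S, p.valuation k 2 = 1) ∧
  ∀ p ∉ S, ∃ π : kˣ, p.valuation k (π : k) = WithZero.exp (-1) ∧
    ∀ q ∉ S, q ≠ p → q.valuation k (π : k) = 1

theorem Good.mono {S T : Finset (HeightOneSpectrum (𝓞 k))} (hS : Good S) (h : S ⊆ T) : Good T := by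
  refine ⟨fun p hp => hS.1 p (fun h' => hp (h h')), fun p hp => ?_⟩
  obtain ⟨π, h1, h2⟩ := hS.2 p (fun h' => hp (h h'))
  exact ⟨π, h1, fun q hq hqp => h2 q (fun h' => hq (h h')) hqp⟩

theorem exists_good : ∃ S : Finset (HeightOneSpectrum (𝓞 k)), Good S := by
  classical
  have hsurj := ClassGroup.mk0_surjective (R := 𝓞 k)
  choose I hI using hsurj
  have hfin : ∀ c, {p : HeightOneSpectrum (𝓞 k) | p.asIdeal ∣ (I c : Ideal (𝓞 k))}.Finite := fun c =>
    Ideal.finite_factors (nonZeroDivisors.ne_zero (I c).2)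
  refine ⟨Finset.univ.biUnion (fun c => (hfin c).toFinset) ∪ bad (Units.mk0 (2 : k) two_ne_zero), ?_, ?_⟩
  · intro p hp
    exact val_of_not_bad (fun h => hp (Finset.mem_union_right _ h))
  · intro p hp
    have hpI : ∀ q, q ∉ Finset.univ.biUnion (fun c => (hfin c).toFinset) ∪ bad (Units.mk0 (2 : k) two_ne_zero) →
        ∀ c, ¬ q.asIdeal ∣ (I c : Ideal (𝓞 k)) := by
      intro q hq c hc
      apply hq
      apply Finset.mem_union_left
      rw [Finset.mem_biUnion]
      exact ⟨c, Finset.mem_univ _, (hfin c).mem_toFinset.2 hc⟩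
    have hp0 : p.asIdeal ∈ nonZeroDivisors (Ideal (𝓞 k)) := mem_nonZeroDivisors_of_ne_zero p.ne_bot
    let P : nonZeroDivisors (Ideal (𝓞 k)) := ⟨p.asIdeal, hp0⟩
    set c := (ClassGroup.mk0 P)⁻¹ with hc
    have h1 : ClassGroup.mk0 (P * I c) = 1 := by rw [map_mul, hI, hc, mul_inv_cancel]
    rw [ClassGroup.mk0_eq_one_iff] at h1
    obtain ⟨⟨x, hx⟩⟩ := h1
    have hx : p.asIdeal * (I c : Ideal (𝓞 k)) = Ideal.span {x} := by simpa using hx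
    have hx0 : x ≠ 0 := by
      rintro rfl
      rw [Ideal.span_singleton_eq_bot.2 rfl] at hx
      rcases mul_eq_zero.1 hx with h | h
      · exact p.ne_bot h
      · exact nonZeroDivisors.ne_zero (I c).2 h
    refine ⟨Units.mk0 (x : k) (by simpa using hx0), ?_, ?_⟩
    · rw [Units.val_mk0, HeightOneSpectrum.valuation_of_algebraMap,
        HeightOneSpectrum.intValuation_eq_exp_neg_multiplicity _ hx0, ← hx]
      congr 1
      rw [neg_inj]
      norm_cast
      apply multiplicity_eq_of_dvd_of_not_dvd
      · rw [pow_one]; exact dvd_mul_right _ _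
      · rw [pow_succ, pow_one]
        intro h
        exact hpI p hp c ((mul_dvd_mul_iff_left p.ne_bot).1 h)
    · intro q hq hqp
      rw [Units.val_mk0]
      refine le_antisymm (val_int_le q x) (not_lt.1 fun hlt => ?_)
      rw [val_int_lt_iff, ← Ideal.span_singleton_le_iff_mem, ← hx] at hlt
      rcases q.isPrime.mul_le.1 hlt with h | h
      · exact hqp (HeightOneSpectrum.ext (p.isMaximal.eq_of_le q.isPrime.ne_top h)).symm
      · exact hpI q hq c (Ideal.dvd_iff_le.2 h)

theorem exists_good_ge (S0 : Finset (HeightOneSpectrum (𝓞 k))) :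
    ∃ S : Finset (HeightOneSpectrum (𝓞 k)), S0 ⊆ S ∧ Good S := by
  classical
  obtain ⟨S, hS⟩ := exists_good (k := k)
  exact ⟨S0 ∪ S, Finset.subset_union_left, hS.mono Finset.subset_union_right⟩

theorem logv_inv (p : HeightOneSpectrum (𝓞 k)) (x : kˣ) : logv p x⁻¹ = - logv p x := by
  have := logv_mul p x x⁻¹
  rw [mul_inv_cancel, logv_one] at this
  lia

noncomputable def logvHom (p : HeightOneSpectrum (𝓞 k)) : kˣ →* Multiplicative ℤ where
  toFun x := Multiplicative.ofAdd (logv p x)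
  map_one' := by rw [logv_one]; rfl
  map_mul' x y := by rw [logv_mul]; rfl

theorem logv_zpow (p : HeightOneSpectrum (𝓞 k)) (x : kˣ) (n : ℤ) : logv p (x ^ n) = n * logv p x := by
  have : logvHom p (x ^ n) = (logvHom p x) ^ n := map_zpow _ _ _
  have h := congrArg Multiplicative.toAdd this
  rw [toAdd_zpow] at h
  exact h

theorem logv_pow (p : HeightOneSpectrum (𝓞 k)) (x : kˣ) (n : ℕ) : logv p (x ^ n) = n * logv p x := by
  exact_mod_cast logv_zpow p x n

theorem logv_prod {ι : Type} (p : HeightOneSpectrum (𝓞 k)) (B : Finset ι) (f : ι → kˣ) :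
    logv p (∏ i ∈ B, f i) = ∑ i ∈ B, logv p (f i) := by
  have : logvHom p (∏ i ∈ B, f i) = ∏ i ∈ B, logvHom p (f i) := map_prod _ _ _
  have h := congrArg Multiplicative.toAdd this
  rw [toAdd_prod] at h
  exact h

/-- scaling to prescribed valuations outside `S` -/
theorem Good.exists_val {S : Finset (HeightOneSpectrum (𝓞 k))} (hS : Good S)
    (B : Finset (HeightOneSpectrum (𝓞 k))) (n : HeightOneSpectrum (𝓞 k) → ℤ) (hn : ∀ p ∉ S, p ∉ B → n p = 0) :
    ∃ c : kˣ, ∀ p ∉ S, logv p c = n p := by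
  classical
  have : ∀ p, ∃ π : kˣ, p ∉ S → p.valuation k (π : k) = WithZero.exp (-1) ∧
    ∀ q ∉ S, q ≠ p → q.valuation k (π : k) = 1 := by
    intro p
    by_cases hp : p ∈ S
    · exact ⟨1, fun h => absurd hp h⟩
    · obtain ⟨π, h⟩ := hS.2 p hp
      exact ⟨π, fun _ => h⟩
  choose π hπ using this
  refine ⟨∏ p ∈ B \ S, (π p) ^ (- n p), fun p hp => ?_⟩
  rw [logv_prod]
  have h1 : logv p (π p) = -1 := by
    unfold logv; rw [(hπ p hp).1, WithZero.log_exp]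
  by_cases hB : p ∈ B
  · rw [Finset.sum_eq_single p]
    · rw [logv_zpow, h1]; ring
    · intro q hq hqp
      rw [logv_zpow, logv_eq_zero.2 ((hπ q (Finset.mem_sdiff.1 hq).2).2 p hp hqp.symm), mul_zero]
    · intro h
      exact absurd (Finset.mem_sdiff.2 ⟨hB, hp⟩) h
  · rw [hn p hp hB]
    apply Finset.sum_eq_zero
    intro q hq
    have hqp : q ≠ p := by rintro rfl; exact hB (Finset.mem_sdiff.1 hq).1
    rw [logv_zpow, logv_eq_zero.2 ((hπ q (Finset.mem_sdiff.1 hq).2).2 p hp hqp.symm), mul_zero]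

theorem Good.exists_sq {S : Finset (HeightOneSpectrum (𝓞 k))} (hS : Good S) {x : kˣ}
    (h : ∀ p ∉ S, Even (logv p x)) : ∃ c : kˣ, ∃ u ∈ EG (S : Set (HeightOneSpectrum (𝓞 k))), x = c ^ 2 * u := by
  obtain ⟨c, hc⟩ := hS.exists_val (bad x) (fun p => logv p x / 2) (fun p hp hb => by
    simp [logv_of_not_bad hb])
  refine ⟨c, (c ^ 2)⁻¹ * x, fun p hp => ?_, by rw [mul_inv_cancel_left]⟩
  rw [← logv_eq_zero, logv_mul, logv_inv, logv_pow, hc p hp]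
  have := h p hp
  push_cast; grind

theorem Good.mem_V {S : Finset (HeightOneSpectrum (𝓞 k))} (hS : Good S) {x : kˣ}
    (h : ∀ p ∉ S, Even (logv p x)) : cls x ∈ V (S : Set (HeightOneSpectrum (𝓞 k))) := by
  obtain ⟨c, u, hu, rfl⟩ := hS.exists_sq h
  rw [cls_mul, cls_sq, zero_add]
  exact cls_mem_of_mem hu

end Good

end TwoConics

end

section

open IsDedekindDomain NumberField
open scoped WithZero

namespace TwoConics

section Ext

variable {k : Type} [Field k] [NumberField k] {K : Type} [Field K] [NumberField K] [Algebra k K]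

/-- the prime below -/
noncomputable def below (k : Type) [Field k] [NumberField k] {K : Type} [Field K] [NumberField K]
    [Algebra k K] (w : HeightOneSpectrum (𝓞 K)) : HeightOneSpectrum (𝓞 k) := w.under (𝓞 k)

theorem mem_below (w : HeightOneSpectrum (𝓞 K)) (x : 𝓞 k) :
    x ∈ (below k w).asIdeal ↔ algebraMap (𝓞 k) (𝓞 K) x ∈ w.asIdeal := Iff.rfl

theorem val_below (w : HeightOneSpectrum (𝓞 K)) : ∃ e : ℕ, e ≠ 0 ∧ ∀ x : k,
    w.valuation K (algebraMap k K x) = ((below k w).valuation k x) ^ e := by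
  have : w.asIdeal.LiesOver (below k w).asIdeal := ⟨rfl⟩
  refine ⟨(below k w).asIdeal.ramificationIdx' w.asIdeal, ?_, ?_⟩
  · exact Ideal.IsDedekindDomain.ramificationIdx'_ne_zero_of_liesOver w.asIdeal (below k w).ne_bot
  · intro x
    exact (HeightOneSpectrum.valuation_liesOver K (below k w) w x).symm

theorem val_below_eq_one (w : HeightOneSpectrum (𝓞 K)) (x : k) :
    w.valuation K (algebraMap k K x) = 1 ↔ (below k w).valuation k x = 1 := by
  obtain ⟨e, he, h⟩ := val_below (k := k) w
  rw [h, pow_eq_one_iff_of_nonneg zero_le he]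

theorem val_below_lt_one (w : HeightOneSpectrum (𝓞 K)) (x : k) :
    w.valuation K (algebraMap k K x) < 1 ↔ (below k w).valuation k x < 1 := by
  obtain ⟨e, he, h⟩ := val_below (k := k) w
  rw [h, pow_lt_one_iff_of_nonneg zero_le he]

theorem val_below_le_one (w : HeightOneSpectrum (𝓞 K)) (x : k) :
    w.valuation K (algebraMap k K x) ≤ 1 ↔ (below k w).valuation k x ≤ 1 := by
  obtain ⟨e, he, h⟩ := val_below (k := k) w
  rw [h, pow_le_one_iff_of_nonneg zero_le he]

theorem val_below_lt (w : HeightOneSpectrum (𝓞 K)) (x y : k) :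
    w.valuation K (algebraMap k K x) < w.valuation K (algebraMap k K y) ↔
      (below k w).valuation k x < (below k w).valuation k y := by
  obtain ⟨e, he, h⟩ := val_below (k := k) w
  rw [h, h, pow_lt_pow_iff_left₀ zero_le zero_le he]

theorem exists_above (K : Type) [Field K] [NumberField K] [Algebra k K] (p : HeightOneSpectrum (𝓞 k)) :
    ∃ w : HeightOneSpectrum (𝓞 K), below k w = p := by
  obtain ⟨P, hP, h⟩ := p.asIdeal.exists_ideal_over_prime_of_isIntegral_of_isDomain (S := 𝓞 K) (by
    rw [(RingHom.injective_iff_ker_eq_bot _).1 (FaithfulSMul.algebraMap_injective (𝓞 k) (𝓞 K))]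
    exact bot_le)
  refine ⟨⟨P, hP, ?_⟩, HeightOneSpectrum.ext h⟩
  rintro rfl
  apply p.ne_bot
  rw [← h]
  exact Ideal.comap_bot_of_injective _ (FaithfulSMul.algebraMap_injective (𝓞 k) (𝓞 K))

theorem LS_above (w : HeightOneSpectrum (𝓞 K)) {x : k} (h : LS ((below k w).valuation k) x) :
    LS (w.valuation K) (algebraMap k K x) := by
  obtain ⟨q, hq, h⟩ := h
  refine ⟨algebraMap k K q, by simpa using hq, ?_⟩
  have := (val_below_lt w (x * q ^ 2 - 1) 4).2 h
  rw [map_ofNat] at this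
  simpa using this

theorem finite_above (K : Type) [Field K] [NumberField K] [Algebra k K] (p : HeightOneSpectrum (𝓞 k)) :
    {w : HeightOneSpectrum (𝓞 K) | below k w = p}.Finite := by
  obtain ⟨h, hpos, x, hx, -⟩ := exists_gen p
  refine (finite_bad (Units.map (algebraMap k K : k →* K) x)).subset ?_
  intro w hw
  change w.valuation K (algebraMap k K (x : k)) ≠ 1
  rw [Ne, val_below_eq_one, hw, hx, ← WithZero.exp_zero, WithZero.exp_inj]
  lia

/-- primes over `S` -/
noncomputable def above (K : Type) [Field K] [NumberField K] [Algebra k K]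
    (S : Finset (HeightOneSpectrum (𝓞 k))) : Finset (HeightOneSpectrum (𝓞 K)) := by
  classical
  exact S.biUnion fun p => (finite_above K p).toFinset

theorem mem_above {S : Finset (HeightOneSpectrum (𝓞 k))} {w : HeightOneSpectrum (𝓞 K)} :
    w ∈ above K S ↔ below k w ∈ S := by
  classical
  unfold above
  rw [Finset.mem_biUnion]
  constructor
  · rintro ⟨p, hp, h⟩
    rw [Set.Finite.mem_toFinset] at h
    have h : below k w = p := h
    exact h ▸ hp
  · intro h
    exact ⟨_, h, by rw [Set.Finite.mem_toFinset]; rfl⟩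

/-- conjugate prime -/
noncomputable def conjP (σ : K ≃ₐ[k] K) (w : HeightOneSpectrum (𝓞 K)) : HeightOneSpectrum (𝓞 K) :=
  w.comap (RingOfIntegers.mapRingEquiv σ.toRingEquiv : 𝓞 K →+* 𝓞 K)
    (RingOfIntegers.mapRingEquiv σ.toRingEquiv).surjective

theorem mem_conjP (σ : K ≃ₐ[k] K) (w : HeightOneSpectrum (𝓞 K)) (x : 𝓞 K) :
    x ∈ (conjP σ w).asIdeal ↔ RingOfIntegers.mapRingEquiv σ.toRingEquiv x ∈ w.asIdeal := Iff.rfl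

theorem int_conjP (σ : K ≃ₐ[k] K) (w : HeightOneSpectrum (𝓞 K)) (x : 𝓞 K) :
    (conjP σ w).intValuation x = w.intValuation (RingOfIntegers.mapRingEquiv σ.toRingEquiv x) := by
  set e := RingOfIntegers.mapRingEquiv σ.toRingEquiv with he
  have key : ∀ n : ℕ, (conjP σ w).intValuation x ≤ WithZero.exp (-(n : ℤ)) ↔
      w.intValuation (e x) ≤ WithZero.exp (-(n : ℤ)) := by
    intro n
    rw [HeightOneSpectrum.intValuation_le_pow_iff_mem, HeightOneSpectrum.intValuation_le_pow_iff_mem]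
    have : (conjP σ w).asIdeal = w.asIdeal.map e.symm := by
      rw [Ideal.map_symm]; rfl
    rw [this, ← Ideal.map_pow, Ideal.map_symm, Ideal.mem_comap]
  by_cases hx : x = 0
  · simp [hx]
  have hx' : e x ≠ 0 := by simpa using hx
  have h1 := HeightOneSpectrum.intValuation_eq_exp_neg_multiplicity (conjP σ w) hx
  have h2 := HeightOneSpectrum.intValuation_eq_exp_neg_multiplicity w hx'
  apply le_antisymm
  · rw [h2]; exact (key _).2 h2.le
  · rw [h1]; exact (key _).1 h1.le

theorem val_conjP (σ : K ≃ₐ[k] K) (w : HeightOneSpectrum (𝓞 K)) (x : K) :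
    (conjP σ w).valuation K x = w.valuation K (σ x) := by
  obtain ⟨x, y, hy, rfl⟩ := IsFractionRing.div_surjective (A := 𝓞 K) x
  have h : ∀ x : 𝓞 K, (conjP σ w).valuation K (algebraMap (𝓞 K) K x) =
      w.valuation K (σ (algebraMap (𝓞 K) K x)) := by
    intro x
    rw [HeightOneSpectrum.valuation_of_algebraMap, int_conjP, ← HeightOneSpectrum.valuation_of_algebraMap (K := K)]
    rfl
  rw [map_div₀, h, h, map_div₀, map_div₀]

theorem below_conjP (σ : K ≃ₐ[k] K) (w : HeightOneSpectrum (𝓞 K)) : below k (conjP σ w) = below k w := by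
  apply HeightOneSpectrum.ext
  ext x
  rw [mem_below, mem_below, mem_conjP]
  have : RingOfIntegers.mapRingEquiv σ.toRingEquiv (algebraMap (𝓞 k) (𝓞 K) x) = algebraMap (𝓞 k) (𝓞 K) x := by
    apply RingOfIntegers.coe_injective
    change σ (algebraMap k K (x : k)) = algebraMap k K (x : k)
    exact σ.commutes _
  rw [this]

end Ext

section Quad

/-- quadratic extension data -/
structure IsQuad {k K : Type} [Field k] [Field K] [Algebra k K] (a : kˣ) (β : Kˣ) (σ : K ≃ₐ[k] K) : Prop where
  nsq : cls a ≠ 0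
  sq : (β : K) ^ 2 = algebraMap k K a
  conj : σ β = -β
  span : ∀ z : K, ∃ x y : k, z = algebraMap k K x + algebraMap k K y * β
  rank : Module.finrank k K = 2
  lift : ∀ (φ : k →+* ℝ) (r : ℝ), r ^ 2 = φ a → ∃ ψ : K →+* ℝ, ψ.comp (algebraMap k K) = φ ∧ ψ β = r

theorem exists_quad {k : Type} [Field k] [NumberField k] {a : kˣ} (ha : cls a ≠ 0) :
    ∃ (K : Type) (_ : Field K) (_ : NumberField K) (_ : Algebra k K) (β : Kˣ) (σ : K ≃ₐ[k] K), IsQuad a β σ := by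
  have hirr : Irreducible (Polynomial.X ^ 2 - Polynomial.C (a : k)) := by
    apply X_pow_sub_C_irreducible_of_prime Nat.prime_two
    intro b hb
    have hb0 : b ≠ 0 := by
      rintro rfl; apply a.ne_zero; rw [← hb]; simp
    exact ha (cls_eq_zero.2 ⟨Units.mk0 b hb0, Units.ext hb.symm⟩)
  have : Fact (Irreducible (Polynomial.X ^ 2 - Polynomial.C (a : k))) := ⟨hirr⟩
  let f := (Polynomial.X ^ 2 - Polynomial.C (a : k))
  have hmonic : f.Monic := Polynomial.monic_X_pow_sub_C _ two_ne_zero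
  have hdeg : f.natDegree = 2 := Polynomial.natDegree_X_pow_sub_C
  let pb := AdjoinRoot.powerBasis' hmonic
  have hfin : Module.Finite k (AdjoinRoot f) := pb.finite
  have hcz : CharZero (AdjoinRoot f) := charZero_of_injective_algebraMap (algebraMap k (AdjoinRoot f)).injective
  have hfd : FiniteDimensional ℚ (AdjoinRoot f) := Module.Finite.trans k _
  let r : AdjoinRoot f := AdjoinRoot.root f
  have hr : r ^ 2 = algebraMap k _ (a : k) := by
    have := AdjoinRoot.eval₂_root f
    simp only [f, Polynomial.eval₂_sub, Polynomial.eval₂_pow, Polynomial.eval₂_X, Polynomial.eval₂_C] at this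
    exact sub_eq_zero.1 this
  have hr0 : r ≠ 0 := by
    intro h
    rw [h] at hr
    have : algebraMap k (AdjoinRoot f) (a : k) = 0 := by rw [← hr]; simp
    exact a.ne_zero (by simpa using this)
  have hroot : Polynomial.eval₂ (algebraMap k (AdjoinRoot f)) (-r) f = 0 := by
    simp only [f, Polynomial.eval₂_sub, Polynomial.eval₂_pow, Polynomial.eval₂_X, Polynomial.eval₂_C, neg_sq, hr, sub_self]
  let τ : AdjoinRoot f →ₐ[k] AdjoinRoot f := AdjoinRoot.liftAlgHom f (Algebra.ofId k _) (-r) hroot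
  have hτ : τ r = -r := AdjoinRoot.liftAlgHom_root _ _ _ _
  have hττ : ∀ x, τ (τ x) = x := by
    have : τ.comp τ = AlgHom.id k _ := by
      apply AdjoinRoot.algHom_ext
      change τ (τ r) = r
      rw [hτ, map_neg, hτ, neg_neg]
    intro x
    exact DFunLike.congr_fun this x
  let σ : AdjoinRoot f ≃ₐ[k] AdjoinRoot f := AlgEquiv.ofAlgHom τ τ (AlgHom.ext hττ) (AlgHom.ext hττ)
  refine ⟨AdjoinRoot f, inferInstance, ⟨⟩, inferInstance, Units.mk0 r hr0, σ, ha, hr, hτ, ?_, ?_, ?_⟩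
  · intro z
    obtain ⟨g, rfl⟩ := AdjoinRoot.mk_surjective z
    refine ⟨(g %ₘ f).coeff 0, (g %ₘ f).coeff 1, ?_⟩
    have h1 : AdjoinRoot.mk f g = AdjoinRoot.mk f (g %ₘ f) := by
      rw [AdjoinRoot.mk_eq_mk]
      rw [Polynomial.modByMonic_eq_sub_mul_div]
      simp
    have h2 : (g %ₘ f).degree ≤ 1 := by
      have := Polynomial.degree_modByMonic_lt g hmonic
      rw [Polynomial.degree_eq_natDegree hmonic.ne_zero, hdeg] at this
      rw [Polynomial.degree_le_iff_coeff_zero]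
      intro m hm
      apply Polynomial.coeff_eq_zero_of_degree_lt
      refine lt_of_lt_of_le this ?_
      have : 1 < m := by exact_mod_cast hm
      exact_mod_cast this
    rw [h1]
    conv_lhs => rw [Polynomial.eq_X_add_C_of_degree_le_one h2]
    simp only [map_add, map_mul, AdjoinRoot.mk_X, AdjoinRoot.mk_C]
    rw [add_comm]
    rfl
  · rw [pb.finrank]; exact hdeg
  · intro φ s hs
    have hs' : Polynomial.eval₂ φ s f = 0 := by
      simp only [f, Polynomial.eval₂_sub, Polynomial.eval₂_pow, Polynomial.eval₂_X, Polynomial.eval₂_C, hs, sub_self]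
    refine ⟨AdjoinRoot.lift φ s hs', ?_, ?_⟩
    · ext x; exact AdjoinRoot.lift_of hs'
    · exact AdjoinRoot.lift_root hs'

end Quad

end TwoConics

end

section

open IsDedekindDomain NumberField
open scoped WithZero

namespace TwoConics

section A

variable {k : Type} [Field k] {K : Type} [Field K] [Algebra k K]
  {a : kˣ} {β : Kˣ} {σ : K ≃ₐ[k] K}

theorem IsQuad.conj_apply (hq : IsQuad a β σ) (x y : k) :
    σ (algebraMap k K x + algebraMap k K y * β) = algebraMap k K x - algebraMap k K y * β := by
  rw [map_add, map_mul, σ.commutes, σ.commutes, hq.conj]; ring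

theorem IsQuad.conj_conj (hq : IsQuad a β σ) (z : K) : σ (σ z) = z := by
  obtain ⟨x, y, rfl⟩ := hq.span z
  have : σ (algebraMap k K x + algebraMap k K y * β) = algebraMap k K x + algebraMap k K (-y) * β := by
    rw [hq.conj_apply, map_neg]; ring
  rw [this, hq.conj_apply, map_neg]; ring

theorem IsQuad.norm_eq (hq : IsQuad a β σ) (x y : k) :
    (algebraMap k K x + algebraMap k K y * β) * σ (algebraMap k K x + algebraMap k K y * β) =
      algebraMap k K (x ^ 2 - a * y ^ 2) := by
  rw [hq.conj_apply]
  simp only [map_sub, map_pow, map_mul]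
  rw [← hq.sq]; ring

theorem IsQuad.exists_norm (hq : IsQuad a β σ) (z : Kˣ) :
    ∃ m : kˣ, (z : K) * σ z = algebraMap k K (m : k) ∧ NS (a : k) (m : k) := by
  obtain ⟨x, y, hz⟩ := hq.span z
  have h := hq.norm_eq x y
  rw [← hz] at h
  have h0 : x ^ 2 - a * y ^ 2 ≠ 0 := by
    intro h0
    rw [h0, map_zero, mul_eq_zero] at h
    rcases h with h | h
    · exact z.ne_zero h
    · exact z.ne_zero ((map_eq_zero σ).1 h)
  exact ⟨Units.mk0 _ h0, h, x, y, rfl⟩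

/-- norm -/
noncomputable def IsQuad.nrm (hq : IsQuad a β σ) (z : Kˣ) : kˣ := (hq.exists_norm z).choose

theorem IsQuad.nrm_spec (hq : IsQuad a β σ) (z : Kˣ) :
    (z : K) * σ z = algebraMap k K (hq.nrm z : k) := (hq.exists_norm z).choose_spec.1

theorem IsQuad.nrm_NS (hq : IsQuad a β σ) (z : Kˣ) : NS (a : k) (hq.nrm z : k) :=
  (hq.exists_norm z).choose_spec.2

theorem IsQuad.nrm_mul (hq : IsQuad a β σ) (z w : Kˣ) : hq.nrm (z * w) = hq.nrm z * hq.nrm w := by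
  apply Units.ext
  apply (algebraMap k K).injective
  rw [← hq.nrm_spec, Units.val_mul, Units.val_mul, map_mul, map_mul, ← hq.nrm_spec, ← hq.nrm_spec]
  ring

theorem IsQuad.nrm_one (hq : IsQuad a β σ) : hq.nrm 1 = 1 := by
  apply Units.ext
  apply (algebraMap k K).injective
  rw [← hq.nrm_spec]; simp

theorem IsQuad.fixed (hq : IsQuad a β σ) (h2 : (2 : K) ≠ 0) {z : K} (h : σ z = z) :
    ∃ x : k, z = algebraMap k K x := by
  obtain ⟨x, y, rfl⟩ := hq.span z
  rw [hq.conj_apply] at h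
  have : 2 * (algebraMap k K y * β) = 0 := by linear_combination -h
  rcases mul_eq_zero.1 this with h' | h'
  · exact absurd h' h2
  · exact ⟨x, by rw [h', add_zero]⟩

variable [NumberField k] [NumberField K]

/-- valuations of a norm of an element with equal conjugate valuations are even -/
theorem IsQuad.even_norm (hq : IsQuad a β σ) (p : HeightOneSpectrum (𝓞 k)) (h2 : p.valuation k 2 = 1)
    (hp : p.valuation k (a : k) = 1) (z : Kˣ)
    (hz : ∀ w : HeightOneSpectrum (𝓞 K), below k w = p → w.valuation K (σ z) = w.valuation K z) :
    Even (logv p (hq.nrm z)) := by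
  obtain ⟨w, hw⟩ := exists_above K p
  obtain ⟨x, y, hxy⟩ := hq.span z
  have hxy0 : x ≠ 0 ∨ y ≠ 0 := by
    by_contra h
    push Not at h
    apply z.ne_zero
    rw [hxy, h.1, h.2]; simp
  -- scale
  have key : ∃ c : kˣ, p.valuation k (x * c) ≤ 1 ∧ p.valuation k (y * c) ≤ 1 ∧
      (p.valuation k (x * c) = 1 ∨ p.valuation k (y * c) = 1) := by
    have aux : ∀ x y : k, x ≠ 0 → p.valuation k y ≤ p.valuation k x → ∃ c : kˣ, p.valuation k (x * c) = 1 ∧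
        p.valuation k (y * c) ≤ 1 := by
      intro x y hx hle
      refine ⟨(Units.mk0 x hx)⁻¹, by simp [hx], ?_⟩
      rw [Units.val_inv_eq_inv_val, Units.val_mk0, map_mul, map_inv₀]
      rw [← div_eq_mul_inv]
      exact div_le_one_of_le₀ hle zero_le
    rcases le_total (p.valuation k y) (p.valuation k x) with h | h
    · have hx : x ≠ 0 := by
        rintro rfl
        rw [map_zero, le_zero_iff, map_eq_zero] at h
        tauto
      obtain ⟨c, h1, h2⟩ := aux x y hx h
      exact ⟨c, h1.le, h2, Or.inl h1⟩
    · have hy : y ≠ 0 := by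
        rintro rfl
        rw [map_zero, le_zero_iff, map_eq_zero] at h
        tauto
      obtain ⟨c, h1, h2⟩ := aux y x hy h
      exact ⟨c, h2, h1.le, Or.inr h1⟩
  obtain ⟨c, hx1, hy1, h1⟩ := key
  set X := x * c with hX
  set Y := y * c with hY
  have hN : (hq.nrm z : k) * c ^ 2 = X ^ 2 - a * Y ^ 2 := by
    apply (algebraMap k K).injective
    rw [← hq.norm_eq, map_mul, ← hq.nrm_spec, hxy, hq.conj_apply, hq.conj_apply, hX, hY]
    simp only [map_mul, map_pow]; ring
  have hNle : p.valuation k (X ^ 2 - a * Y ^ 2) ≤ 1 := by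
    apply (p.valuation k).map_sub_le
    · rw [map_pow]; exact pow_le_one₀ zero_le hx1
    · rw [map_mul, map_pow, hp, one_mul]; exact pow_le_one₀ zero_le hy1
  have hN1 : p.valuation k (X ^ 2 - a * Y ^ 2) = 1 := by
    refine le_antisymm hNle (not_lt.1 fun hlt => ?_)
    set Z : K := algebraMap k K X + algebraMap k K Y * β with hZ
    have hZz : Z = z * algebraMap k K (c : k) := by
      rw [hZ, hxy, hX, hY]; simp only [map_mul]; ring
    have hσZ : w.valuation K (σ Z) = w.valuation K Z := by
      rw [hZz, map_mul, map_mul, map_mul, hz w hw, σ.commutes]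
    have hlt' : w.valuation K Z < 1 := by
      have := (val_below_lt_one w (X ^ 2 - a * Y ^ 2)).2 (by rw [hw]; exact hlt)
      rw [← hq.norm_eq, map_mul, hσZ] at this
      by_contra hcon
      exact absurd this (not_lt.2 (one_le_mul_of_one_le_of_one_le (not_lt.1 hcon) (not_lt.1 hcon)))
    have hσlt : w.valuation K (σ Z) < 1 := hσZ ▸ hlt'
    have hw2 : w.valuation K 2 = 1 := by
      have := (val_below_eq_one w (2 : k)).2 (by rw [hw]; exact h2)
      rwa [map_ofNat] at this
    have hwβ : w.valuation K (β : K) = 1 := by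
      have := (val_below_eq_one w (a : k)).2 (by rw [hw]; exact hp)
      rw [← hq.sq, map_pow] at this
      exact (pow_eq_one_iff_of_nonneg zero_le two_ne_zero).1 this
    rw [hZ, hq.conj_apply] at hσlt
    rcases h1 with h1 | h1
    · have h3 := (w.valuation K).map_add_lt hlt' hσlt
      rw [hZ] at h3
      have h4 : algebraMap k K X + algebraMap k K Y * ↑β + (algebraMap k K X - algebraMap k K Y * ↑β)
        = 2 * algebraMap k K X := by ring
      rw [h4, map_mul, hw2, one_mul, val_below_lt_one, hw, h1] at h3
      exact lt_irrefl _ h3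
    · have h3 := (w.valuation K).map_sub_lt hlt' hσlt
      rw [hZ] at h3
      have h4 : algebraMap k K X + algebraMap k K Y * ↑β - (algebraMap k K X - algebraMap k K Y * ↑β)
        = 2 * (algebraMap k K Y * β) := by ring
      rw [h4, map_mul, hw2, one_mul, map_mul, hwβ, mul_one, val_below_lt_one, hw, h1] at h3
      exact lt_irrefl _ h3
  have : logv p (hq.nrm z * c ^ 2) = 0 := by
    rw [logv_eq_zero, Units.val_mul, Units.val_pow_eq_pow_val, hN, hN1]
  rw [logv_mul, logv_pow] at this
  refine ⟨- logv p c, ?_⟩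
  push_cast at this
  lia

/-- `z ↦ z / σ z` on `Kˣ` -/
noncomputable def gmap (σ : K ≃ₐ[k] K) : Kˣ →* Kˣ where
  toFun z := z / Units.map (σ : K →* K) z
  map_one' := by simp
  map_mul' x y := by rw [map_mul, mul_div_mul_comm]

theorem gmap_val (σ : K ≃ₐ[k] K) (z : Kˣ) : ((gmap σ z : Kˣ) : K) = z / σ z := by
  simp [gmap]

/-- Hilbert 90 for `S`-units -/
theorem IsQuad.H90 (hq : IsQuad a β σ) {S : Finset (HeightOneSpectrum (𝓞 k))} (hS : Good S)
    (ha : a ∈ EG (S : Set (HeightOneSpectrum (𝓞 k)))) {y : Kˣ}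
    (hy : y ∈ EG (above K S : Set (HeightOneSpectrum (𝓞 K)))) (hy1 : hq.nrm y = 1) :
    ∃ z ∈ EG (above K S : Set (HeightOneSpectrum (𝓞 K))), gmap σ z = y := by
  have hyσ : (y : K) * σ y = 1 := by rw [hq.nrm_spec, hy1]; simp
  have h1 : ∃ z : Kˣ, (z : K) = y * σ z := by
    by_cases h : (1 : K) + y = 0
    · refine ⟨β, ?_⟩
      rw [hq.conj]; linear_combination (β : K) * h
    · refine ⟨Units.mk0 _ h, ?_⟩
      rw [Units.val_mk0, map_add, map_one]
      linear_combination -hyσ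
  obtain ⟨z, hz⟩ := h1
  have heven : ∀ p ∉ S, Even (logv p (hq.nrm z)) := by
    intro p hp
    apply hq.even_norm p (hS.1 p hp) (ha p hp)
    intro w hw
    have : w.valuation K (y : K) = 1 := hy w (by rw [Finset.mem_coe, mem_above, hw]; exact hp)
    conv_rhs => rw [hz]
    rw [map_mul, this, one_mul]
  obtain ⟨c, u, hu, hcu⟩ := hS.exists_sq heven
  have hc0 : algebraMap k K (c : k) ≠ 0 := by simp
  refine ⟨z / Units.map (algebraMap k K : k →* K) c, ?_, ?_⟩
  · intro w hw
    have hw' : below k w ∉ S := by rwa [Finset.mem_coe, mem_above] at hw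
    have hyw : w.valuation K (y : K) = 1 := hy w hw
    have huw : w.valuation K (algebraMap k K (u : k)) = 1 := (val_below_eq_one w _).2 (hu _ hw')
    have h3 : w.valuation K (σ z) = w.valuation K z := by
      conv_rhs => rw [hz]
      rw [map_mul, hyw, one_mul]
    have h4 := hq.nrm_spec z
    rw [hcu, Units.val_mul, Units.val_pow_eq_pow_val, map_mul, map_pow] at h4
    have h5 : ((z : K) / algebraMap k K (c : k)) * (σ z / algebraMap k K (c : k)) = algebraMap k K (u : k) := by
      field_simp; rw [h4]
    have h6 : w.valuation K ((z : K) / algebraMap k K (c : k)) ^ 2 = 1 := by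
      rw [← huw, ← h5, map_mul, map_div₀, map_div₀ _ (σ z), h3, pow_two]
    have h7 := (pow_eq_one_iff_of_nonneg zero_le two_ne_zero).1 h6
    simpa using h7
  · apply Units.ext
    rw [gmap_val]
    have hsz : σ z ≠ 0 := by simp
    simp only [Units.val_div_eq_div_val, Units.coe_map, MonoidHom.coe_coe, map_div₀]
    rw [σ.commutes]
    field_simp
    rw [mul_comm]; exact hz

/-- the group of `u/σ u` -/
noncomputable def Um (σ : K ≃ₐ[k] K) (S : Finset (HeightOneSpectrum (𝓞 k))) : Subgroup Kˣ :=
  (EG (above K S : Set (HeightOneSpectrum (𝓞 K)))).map (gmap σ)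

noncomputable def Gm (σ : K ≃ₐ[k] K) (S : Finset (HeightOneSpectrum (𝓞 k))) :
    Additive (EG (above K S : Set (HeightOneSpectrum (𝓞 K)))) →ₗ[ℤ] Additive (Um σ S) :=
  AddMonoidHom.toIntLinearMap
    { toFun := fun u => Additive.ofMul ⟨gmap σ (u.toMul : Kˣ), ⟨_, u.toMul.2, rfl⟩⟩
      map_zero' := by
        change Additive.ofMul _ = Additive.ofMul 1
        congr 1; apply Subtype.ext; exact map_one (gmap σ)
      map_add' := by
        intro x y
        rw [← ofMul_mul]; congr 1; apply Subtype.ext; exact map_mul (gmap σ) _ _ }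

theorem Gm_surj (σ : K ≃ₐ[k] K) (S : Finset (HeightOneSpectrum (𝓞 k))) :
    Function.Surjective (Gm σ S) := by
  intro y
  obtain ⟨u, hu, h⟩ := y.toMul.2
  exact ⟨Additive.ofMul ⟨u, hu⟩, Additive.toMul.injective (Subtype.ext h)⟩

instance (σ : K ≃ₐ[k] K) (S : Finset (HeightOneSpectrum (𝓞 k))) : Module.Finite ℤ (Additive (Um σ S)) :=
  Module.Finite.of_surjective (Gm σ S) (Gm_surj σ S)

noncomputable def incl (K : Type) [Field K] [NumberField K] [Algebra k K] (S : Finset (HeightOneSpectrum (𝓞 k))) :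
    Additive (EG (S : Set (HeightOneSpectrum (𝓞 k)))) →ₗ[ℤ]
      Additive (EG (above K S : Set (HeightOneSpectrum (𝓞 K)))) :=
  AddMonoidHom.toIntLinearMap
    { toFun := fun u => Additive.ofMul ⟨Units.map (algebraMap k K : k →* K) (u.toMul : kˣ), by
        intro w hw
        rw [Finset.mem_coe, mem_above] at hw
        exact (val_below_eq_one w _).2 (u.toMul.2 _ hw)⟩
      map_zero' := by
        change Additive.ofMul _ = Additive.ofMul 1
        congr 1; apply Subtype.ext; exact map_one (Units.map (algebraMap k K : k →* K))
      map_add' := by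
        intro x y
        rw [← ofMul_mul]; congr 1; apply Subtype.ext
        exact map_mul (Units.map (algebraMap k K : k →* K)) _ _ }

theorem incl_inj (K : Type) [Field K] [NumberField K] [Algebra k K] (S : Finset (HeightOneSpectrum (𝓞 k))) :
    Function.Injective (incl K S) := by
  intro x y h
  have h1 : algebraMap k K ((x.toMul : kˣ) : k) = algebraMap k K ((y.toMul : kˣ) : k) :=
    congrArg (fun x : Additive (EG (above K S : Set (HeightOneSpectrum (𝓞 K)))) => ((x.toMul : Kˣ) : K)) h
  exact Additive.toMul.injective (Subtype.ext (Units.ext ((algebraMap k K).injective h1)))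

theorem IsQuad.incl_range (hq : IsQuad a β σ) (S : Finset (HeightOneSpectrum (𝓞 k))) :
    (incl K S).range = (Gm σ S).ker := by
  ext u
  rw [LinearMap.mem_ker]
  constructor
  · rintro ⟨x, rfl⟩
    apply Additive.toMul.injective
    apply Subtype.ext
    apply Units.ext
    change ((gmap σ (Units.map (algebraMap k K : k →* K) (x.toMul : kˣ)) : Kˣ) : K) = 1
    rw [gmap_val]
    simp
  · intro h
    have h1 : ((gmap σ (u.toMul : Kˣ) : Kˣ) : K) = 1 :=
      congrArg (fun x : Additive (Um σ S) => ((x.toMul : Kˣ) : K)) h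
    rw [gmap_val, div_eq_one_iff_eq (by simp)] at h1
    obtain ⟨x, hx⟩ := hq.fixed two_ne_zero h1.symm
    have hx0 : x ≠ 0 := by
      rintro rfl
      rw [map_zero] at hx
      exact (u.toMul : Kˣ).ne_zero hx
    refine ⟨Additive.ofMul ⟨Units.mk0 x hx0, ?_⟩, ?_⟩
    · intro p hp
      obtain ⟨w, hw⟩ := exists_above K p
      have := u.toMul.2 w (by rw [Finset.mem_coe, mem_above, hw]; exact hp)
      rw [hx, val_below_eq_one, hw] at this
      exact this
    · apply Additive.toMul.injective
      apply Subtype.ext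
      apply Units.ext
      exact hx.symm

theorem IsQuad.finrank_Um (hq : IsQuad a β σ) (S : Finset (HeightOneSpectrum (𝓞 k))) :
    Module.finrank ℤ (Additive (Um σ S)) + (S.card + Fintype.card (InfinitePlace k)) =
      (above K S).card + Fintype.card (InfinitePlace K) := by
  rw [← finrank_EG, ← finrank_EG, ← rank_nullity (Gm σ S), ← hq.incl_range,
    LinearMap.finrank_range_of_inj (incl_inj K S), LinearMap.range_eq_top.2 (Gm_surj σ S), finrank_top]
  ring

theorem IsQuad.beta_mem (hq : IsQuad a β σ) {S : Finset (HeightOneSpectrum (𝓞 k))}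
    (ha : a ∈ EG (S : Set (HeightOneSpectrum (𝓞 k)))) :
    β ∈ EG (above K S : Set (HeightOneSpectrum (𝓞 K))) := by
  apply sq_mem_EG
  intro w hw
  rw [Finset.mem_coe, mem_above] at hw
  rw [Units.val_pow_eq_pow_val, hq.sq, val_below_eq_one]
  exact ha _ hw

theorem IsQuad.neg_one_mem_Um (hq : IsQuad a β σ) {S : Finset (HeightOneSpectrum (𝓞 k))}
    (ha : a ∈ EG (S : Set (HeightOneSpectrum (𝓞 k)))) : -1 ∈ Um σ S := by
  refine ⟨β, hq.beta_mem ha, ?_⟩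
  apply Units.ext
  rw [gmap_val, hq.conj]
  field_simp
  simp

/-- norm map to square classes -/
noncomputable def IsQuad.Phi (hq : IsQuad a β σ) (S : Finset (HeightOneSpectrum (𝓞 k))) :
    Additive (EG (above K S : Set (HeightOneSpectrum (𝓞 K)))) →+ Qk k where
  toFun u := cls (hq.nrm (u.toMul : Kˣ))
  map_zero' := by
    change cls (hq.nrm 1) = 0
    rw [hq.nrm_one, cls_one]
  map_add' x y := by
    change cls (hq.nrm ((x.toMul : Kˣ) * (y.toMul : Kˣ))) = _
    rw [hq.nrm_mul, cls_mul]

theorem IsQuad.nrm_mem (hq : IsQuad a β σ) {S : Finset (HeightOneSpectrum (𝓞 k))} {u : Kˣ}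
    (hu : u ∈ EG (above K S : Set (HeightOneSpectrum (𝓞 K)))) :
    hq.nrm u ∈ EG (S : Set (HeightOneSpectrum (𝓞 k))) := by
  intro p hp
  obtain ⟨w, hw⟩ := exists_above K p
  have h1 := hu w (by rw [Finset.mem_coe, mem_above, hw]; exact hp)
  have h2 := hu (conjP σ w) (by rw [Finset.mem_coe, mem_above, below_conjP, hw]; exact hp)
  rw [val_conjP] at h2
  have h3 : w.valuation K (algebraMap k K (hq.nrm u : k)) = 1 := by
    rw [← hq.nrm_spec, map_mul, h1, h2, one_mul]
  rwa [val_below_eq_one, hw] at h3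

theorem IsQuad.finrank_ge (hq : IsQuad a β σ) {S : Finset (HeightOneSpectrum (𝓞 k))} (hS : Good S)
    (ha : a ∈ EG (S : Set (HeightOneSpectrum (𝓞 k)))) :
    Module.finrank ℤ (Additive (Um σ S)) + 1 ≤
      Module.finrank (ZMod 2) (N a ⊓ V (S : Set (HeightOneSpectrum (𝓞 k))) : Submodule (ZMod 2) (Qk k)) := by
  have h1 := index_sq (Um σ S) (hq.neg_one_mem_Um ha)
  rw [← AddSubgroup.index_comap_of_surjective _ (f := (Gm σ S).toAddMonoidHom) (Gm_surj σ S)] at h1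
  have hle : (hq.Phi S).ker ≤ (nsmulAddMonoidHom (α := Additive (Um σ S)) 2).range.comap (Gm σ S).toAddMonoidHom := by
    intro u hu
    rw [AddMonoidHom.mem_ker] at hu
    obtain ⟨e, he⟩ := cls_eq_zero.1 (hu : cls (hq.nrm (u.toMul : Kˣ)) = 0)
    have heS : e ∈ EG (S : Set (HeightOneSpectrum (𝓞 k))) := sq_mem_EG (he ▸ hq.nrm_mem u.toMul.2)
    set E : Kˣ := Units.map (algebraMap k K : k →* K) e with hE
    have hEm : E ∈ EG (above K S : Set (HeightOneSpectrum (𝓞 K))) := by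
      intro w hw
      rw [Finset.mem_coe, mem_above] at hw
      exact (val_below_eq_one w _).2 (heS _ hw)
    have hy1 : hq.nrm ((u.toMul : Kˣ) * E⁻¹) = 1 := by
      have h5 : hq.nrm E = e ^ 2 := by
        apply Units.ext
        apply (algebraMap k K).injective
        rw [← hq.nrm_spec, hE]
        simp [_root_.sq]
      have h6 : hq.nrm E * hq.nrm E⁻¹ = 1 := by rw [← hq.nrm_mul, mul_inv_cancel, hq.nrm_one]
      rw [hq.nrm_mul, he, ← h5, h6]
    obtain ⟨z, hz, hzy⟩ := hq.H90 hS ha (mul_mem u.toMul.2 (inv_mem hEm)) hy1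
    refine ⟨Additive.ofMul ⟨gmap σ z, ⟨z, hz, rfl⟩⟩, ?_⟩
    apply Additive.toMul.injective
    apply Subtype.ext
    change (gmap σ z) ^ 2 = gmap σ (u.toMul : Kˣ)
    apply Units.ext
    rw [hzy, gmap_val]
    have h7 := hq.nrm_spec (u.toMul : Kˣ)
    rw [he] at h7
    have hE0 : algebraMap k K (e : k) ≠ 0 := by simp
    have hs0 : σ ((u.toMul : Kˣ) : K) ≠ 0 := by simp
    simp only [hE, Units.val_pow_eq_pow_val, Units.val_mul, Units.val_inv_eq_inv_val, Units.coe_map, MonoidHom.coe_coe, map_pow] at h7 ⊢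
    field_simp
    rw [← h7]
  have h2 := AddSubgroup.index_dvd_of_le hle
  rw [h1, AddSubgroup.index_ker] at h2
  have hsub : ((hq.Phi S).range : Set (Qk k)) ⊆
      ((N a ⊓ V (S : Set (HeightOneSpectrum (𝓞 k))) : Submodule (ZMod 2) (Qk k)) : Set (Qk k)) := by
    rintro _ ⟨u, rfl⟩
    exact ⟨mem_N.2 (hq.nrm_NS _), cls_mem_of_mem (hq.nrm_mem u.toMul.2)⟩
  have hfin : Finite (N a ⊓ V (S : Set (HeightOneSpectrum (𝓞 k))) : Submodule (ZMod 2) (Qk k)) :=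
    Finite.of_injective (Submodule.inclusion (inf_le_right : N a ⊓ V _ ≤ V _)) (Submodule.inclusion_injective _)
  have hfin' : Finite (hq.Phi S).range := Set.Finite.subset hfin hsub
  have h3 : 2 ^ (Module.finrank ℤ (Additive (Um σ S)) + 1) ≤ Nat.card (hq.Phi S).range :=
    Nat.le_of_dvd Nat.card_pos h2
  have h4 : Nat.card (hq.Phi S).range ≤
      Nat.card (N a ⊓ V (S : Set (HeightOneSpectrum (𝓞 k))) : Submodule (ZMod 2) (Qk k)) :=
    Nat.card_mono hfin hsub
  rw [Module.natCard_eq_pow_finrank (K := ZMod 2) (V := (N a ⊓ V (S : Set (HeightOneSpectrum (𝓞 k))) : Submodule (ZMod 2) (Qk k))), Nat.card_zmod] at h4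
  exact (Nat.pow_le_pow_iff_right (by norm_num)).1 (h3.trans h4)

end A

end TwoConics

end

section

open IsDedekindDomain NumberField
open scoped WithZero

namespace TwoConics

section Count

variable {k : Type} [Field k] [NumberField k]

theorem card_real : Fintype.card (k →+* ℝ) = InfinitePlace.nrRealPlaces k := by
  classical
  rw [← InfinitePlace.card_real_embeddings]
  refine Fintype.card_congr ⟨fun φ => ⟨Complex.ofRealHom.comp φ, ?_⟩, fun ψ => ψ.2.embedding, ?_, ?_⟩
  · ext x; simp
  · intro φ
    ext x
    have := ComplexEmbedding.IsReal.coe_embedding_apply (φ := Complex.ofRealHom.comp φ) (by ext x; simp) x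
    exact Complex.ofReal_injective this
  · intro ψ
    apply Subtype.ext
    ext x
    exact ComplexEmbedding.IsReal.coe_embedding_apply ψ.2 x

/-- places of `S` and real places -/
noncomputable def iS (S : Finset (HeightOneSpectrum (𝓞 k))) : Finset (Pl k) :=
  S.disjSum (Finset.univ : Finset (k →+* ℝ))

theorem mem_iS_inl {S : Finset (HeightOneSpectrum (𝓞 k))} {p} : (.inl p : Pl k) ∈ iS S ↔ p ∈ S := by
  simp [iS]

theorem mem_iS_inr {S : Finset (HeightOneSpectrum (𝓞 k))} (φ : k →+* ℝ) : (.inr φ : Pl k) ∈ iS S := by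
  simp [iS]

open Classical in
/-- places where `a` is not a square -/
noncomputable def nsq (S : Finset (HeightOneSpectrum (𝓞 k))) (a : Qk k) : Finset (Pl k) :=
  (iS S).filter (fun v => a ∉ L v)

open Classical in
theorem card_nsq (S : Finset (HeightOneSpectrum (𝓞 k))) (a : Qk k) :
    (nsq S a).card = (S.filter (fun p => a ∉ L (.inl p : Pl k))).card +
      ((Finset.univ : Finset (k →+* ℝ)).filter (fun φ => a ∉ L (.inr φ : Pl k))).card := by
  rw [nsq, iS]
  rw [← Finset.card_disjSum]
  congr 1
  ext v
  cases v <;> simp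

variable {K : Type} [Field K] [NumberField K] [Algebra k K]
  {a : kˣ} {β : Kˣ} {σ : K ≃ₐ[k] K}

theorem IsQuad.split (hq : IsQuad a β σ) {p : HeightOneSpectrum (𝓞 k)} (h : LS (p.valuation k) (a : k))
    (w : HeightOneSpectrum (𝓞 K)) (hw : below k w = p) : conjP σ w ≠ w := by
  obtain ⟨q, hq0, hlt⟩ := h
  intro heq
  set γ : K := algebraMap k K q * β with hγ
  have hσγ : σ γ = -γ := by rw [hγ, map_mul, σ.commutes, hq.conj]; ring
  have hγ2 : γ ^ 2 = algebraMap k K (a * q ^ 2) := by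
    rw [hγ, mul_pow, hq.sq]; simp only [map_mul, map_pow]; ring
  set Θ : K := (1 + γ) / 2 with hΘ
  have hσΘ : σ Θ = (1 - γ) / 2 := by
    rw [hΘ, map_div₀, map_add, map_one, hσγ, map_ofNat]; ring
  have hsame : w.valuation K (σ Θ) = w.valuation K Θ := by
    rw [← val_conjP, heq]
  have hprod : Θ * σ Θ = algebraMap k K (-(a * q ^ 2 - 1) / 4) := by
    rw [hσΘ, hΘ, map_div₀, map_neg, map_sub, ← hγ2, map_one, map_ofNat]; ring
  have hlt' : p.valuation k (-(a * q ^ 2 - 1) / 4) < 1 := by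
    rw [map_div₀, Valuation.map_neg]
    exact (div_lt_one₀ (zero_lt_iff.2 ((Valuation.ne_zero_iff _).2 (by norm_num : (4:k) ≠ 0)))).2 hlt
  have h1 : w.valuation K Θ < 1 := by
    have := (val_below_lt_one w (-(a * q ^ 2 - 1) / 4)).2 (by rw [hw]; exact hlt')
    rw [← hprod, map_mul, hsame] at this
    by_contra hcon
    exact absurd this (not_lt.2 (one_le_mul_of_one_le_of_one_le (not_lt.1 hcon) (not_lt.1 hcon)))
  have h2 := (w.valuation K).map_add_lt h1 (hsame ▸ h1)
  rw [hσΘ, hΘ] at h2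
  have : (1 + γ) / 2 + (1 - γ) / 2 = 1 := by ring
  rw [this, map_one] at h2
  exact lt_irrefl _ h2

open Classical in
theorem IsQuad.card_above (hq : IsQuad a β σ) (S : Finset (HeightOneSpectrum (𝓞 k))) :
    2 * S.card ≤ (above K S).card + (S.filter (fun p => cls a ∉ L (.inl p : Pl k))).card := by
  classical
  have h1 : (above K S).card = ∑ p ∈ S, (finite_above K p).toFinset.card := by
    unfold above
    rw [Finset.card_biUnion]
    intro p hp q hpq hne
    change Disjoint _ _
    rw [Finset.disjoint_left]
    intro w hw hw'
    rw [Set.Finite.mem_toFinset] at hw hw'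
    exact hne (hw.symm.trans hw')
  rw [h1, Finset.card_filter, ← Finset.sum_add_distrib, mul_comm, ← smul_eq_mul, ← Finset.sum_const]
  apply Finset.sum_le_sum
  intro p hp
  obtain ⟨w, hw⟩ := exists_above K p
  have hwm : w ∈ (finite_above K p).toFinset := by rw [Set.Finite.mem_toFinset]; exact hw
  by_cases h : cls a ∉ L (.inl p : Pl k)
  · rw [if_pos h]
    have : 0 < (finite_above K p).toFinset.card := Finset.card_pos.2 ⟨w, hwm⟩
    lia
  · rw [if_neg h]
    rw [not_not, mem_L_inl] at h
    have hne := hq.split h w hw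
    have : 1 < (finite_above K p).toFinset.card := by
      rw [Finset.one_lt_card]
      refine ⟨conjP σ w, ?_, w, hwm, hne⟩
      rw [Set.Finite.mem_toFinset]
      exact (below_conjP σ w).trans hw
    lia

open Classical in
theorem IsQuad.card_inf (hq : IsQuad a β σ) :
    2 * Fintype.card (InfinitePlace k) ≤ Fintype.card (InfinitePlace K) +
      ((Finset.univ : Finset (k →+* ℝ)).filter (fun φ => cls a ∉ L (.inr φ : Pl k))).card := by
  classical
  have h1 := InfinitePlace.card_add_two_mul_card_eq_rank k
  have h2 := InfinitePlace.card_add_two_mul_card_eq_rank K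
  have h3 : Module.finrank ℚ K = 2 * Module.finrank ℚ k := by
    rw [← Module.finrank_mul_finrank ℚ k K, hq.rank]; ring
  have h4 := InfinitePlace.card_eq_nrRealPlaces_add_nrComplexPlaces k
  have h5 := InfinitePlace.card_eq_nrRealPlaces_add_nrComplexPlaces K
  have h6 := card_real (k := k)
  have h7 := card_real (k := K)
  have h8 := Finset.card_filter_add_card_filter_not (s := (Finset.univ : Finset (k →+* ℝ))) (fun φ => cls a ∉ L (.inr φ : Pl k))
  rw [Finset.card_univ] at h8
  have h9 : 2 * ((Finset.univ : Finset (k →+* ℝ)).filter (fun φ => ¬ cls a ∉ L (.inr φ : Pl k))).card ≤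
      Fintype.card (K →+* ℝ) := by
    have hex : ∀ x : {φ : k →+* ℝ // ¬ cls a ∉ L (.inr φ : Pl k)} × Bool, ∃ ψ : K →+* ℝ,
        ψ.comp (algebraMap k K) = x.1.1 ∧ (0 < ψ β ↔ x.2 = true) := by
      rintro ⟨⟨φ, hφ⟩, b⟩
      rw [not_not, mem_L_inr] at hφ
      cases b with
      | true =>
        obtain ⟨ψ, h, h'⟩ := hq.lift φ (Real.sqrt (φ a)) (Real.sq_sqrt hφ.le)
        exact ⟨ψ, h, by simp [h', hφ]⟩
      | false =>
        obtain ⟨ψ, h, h'⟩ := hq.lift φ (-Real.sqrt (φ a)) (by rw [neg_sq]; exact Real.sq_sqrt hφ.le)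
        refine ⟨ψ, h, ?_⟩
        have := Real.sqrt_nonneg (φ a)
        simp [h', this]
    choose F hF1 hF2 using hex
    have hinj : Function.Injective F := by
      rintro ⟨⟨φ, hφ⟩, b⟩ ⟨⟨φ', hφ'⟩, b'⟩ h
      have e1 := hF1 ⟨⟨φ, hφ⟩, b⟩
      have e2 := hF2 ⟨⟨φ, hφ⟩, b⟩
      rw [h, hF1] at e1
      rw [h, hF2] at e2
      simp only at e1 e2
      subst e1
      have : b = b' := by cases b <;> cases b' <;> simp_all
      rw [this]
    have := Fintype.card_le_of_injective F hinj
    rw [Fintype.card_prod, Fintype.card_bool, Fintype.card_subtype] at this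
    lia
  lia

theorem boundA {S : Finset (HeightOneSpectrum (𝓞 k))} (hS : Good S) {a : kˣ} (ha : a ∈ EG (S : Set _))
    (ha0 : cls a ≠ 0) :
    S.card + Fintype.card (InfinitePlace k) + 1 ≤
      Module.finrank (ZMod 2) (N a ⊓ V (S : Set _) : Submodule (ZMod 2) (Qk k)) + (nsq S (cls a)).card := by
  classical
  obtain ⟨K, _, _, _, β, σ, hq⟩ := exists_quad ha0
  have h1 := hq.finrank_ge hS ha
  have h2 := hq.finrank_Um (S := S)
  have h3 := hq.card_above S
  have h4 := hq.card_inf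
  have h5 := card_nsq S (cls a)
  lia

end Count

end TwoConics

end

section

open IsDedekindDomain NumberField
open scoped WithZero

namespace TwoConics

section C

variable {k : Type} [Field k] [NumberField k]

theorem weak_approxQ (S : Finset (Pl k)) (x : Pl k → Qk k) :
    ∃ y : Qk k, ∀ v ∈ S, y + x v ∈ L v := by
  choose f hf using fun v => cls_surj (x v)
  obtain ⟨y, hy⟩ := weak_approx S f
  exact ⟨cls y, fun v hv => by rw [← hf]; exact hy v hv⟩

theorem exists_functional {v : Pl k} {a : kˣ} (ha : cls a ∉ L v) :
    ∃ f : Qk k →ₗ[ZMod 2] ZMod 2, f ≠ 0 ∧ N a ≤ LinearMap.ker f ∧ L v ≤ LinearMap.ker f := by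
  obtain ⟨f, h1, h2⟩ := Submodule.exists_le_ker_of_lt_top _ (lt_top_iff_ne_top.2 (NL_ne_top ha))
  exact ⟨f, h1, le_sup_left.trans h2, le_sup_right.trans h2⟩

theorem exists_F {a : kˣ} (T : Finset (Pl k)) (hT : ∀ v ∈ T, cls a ∉ L v) :
    ∃ F : Qk k →ₗ[ZMod 2] (T → ZMod 2), Function.Surjective F ∧ N a ≤ LinearMap.ker F ∧
      ∀ v : T, ∀ x ∈ L (v : Pl k), F x v = 0 := by
  classical
  choose f hf0 hfN hfL using fun v : T => exists_functional (hT v.1 v.2)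
  refine ⟨LinearMap.pi f, ?_, ?_, ?_⟩
  · intro t
    have h1 : ∀ v : T, ∃ x, f v x = t v := fun v => LinearMap.surjective (hf0 v) (t v)
    choose x hx using h1
    obtain ⟨y, hy⟩ := weak_approxQ T (fun v => if h : v ∈ T then x ⟨v, h⟩ else 0)
    refine ⟨y, ?_⟩
    ext v
    have := hy v.1 v.2
    rw [dif_pos v.2] at this
    have h2 := hfL v this
    rw [LinearMap.mem_ker, map_add, hx] at h2
    rw [LinearMap.pi_apply]
    rw [eq_neg_of_add_eq_zero_left h2, ZMod.neg_eq_self_mod_two]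
  · intro x hx
    rw [LinearMap.mem_ker]
    ext v
    exact hfN v hx
  · intro v x hx
    exact hfL v hx

theorem mem_EG_bad {x : kˣ} {S : Finset (HeightOneSpectrum (𝓞 k))} (h : bad x ⊆ S) :
    x ∈ EG (S : Set (HeightOneSpectrum (𝓞 k))) :=
  fun _ hp => val_of_not_bad (fun h' => hp (h h'))

theorem mem_nsq {S : Finset (HeightOneSpectrum (𝓞 k))} {a : Qk k} {v : Pl k} :
    v ∈ nsq S a ↔ v ∈ iS S ∧ a ∉ L v := by
  classical
  simp [nsq]

theorem exists_nonsq {d : kˣ} (hd : cls d ≠ 0) (S0 : Finset (HeightOneSpectrum (𝓞 k))) :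
    ∃ p ∉ S0, cls d ∉ L (.inl p : Pl k) := by
  classical
  by_contra! hcon
  obtain ⟨S, hS0, hS⟩ := exists_good_ge (S0 ∪ bad d)
  obtain ⟨F, hFs, hFN, -⟩ := exists_F (a := d) (nsq S (cls d)) (fun v hv => (mem_nsq.1 hv).2)
  have h1 : ∀ t, ∃ x : kˣ, F (cls x) = t := fun t => by
    obtain ⟨q, hq⟩ := hFs t
    obtain ⟨x, rfl⟩ := cls_surj q
    exact ⟨x, hq⟩
  choose x hx using h1
  let T := S ∪ Finset.univ.biUnion (fun t => bad (x t))
  have hST : S ⊆ T := Finset.subset_union_left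
  have hn : nsq T (cls d) = nsq S (cls d) := by
    ext v
    rw [mem_nsq, mem_nsq]
    cases v with
    | inl p =>
      rw [mem_iS_inl, mem_iS_inl]
      constructor
      · rintro ⟨-, h⟩
        refine ⟨?_, h⟩
        by_contra hp
        exact h (hcon p (fun h' => hp (hS0 (Finset.mem_union_left _ h'))))
      · rintro ⟨h1, h⟩; exact ⟨hST h1, h⟩
    | inr φ => simp [mem_iS_inr]
  have hA := boundA (hS.mono hST) (a := d) (mem_EG_bad ((Finset.subset_union_right.trans hS0).trans hST)) hd
  rw [hn] at hA
  let G := F.domRestrict (V (T : Set (HeightOneSpectrum (𝓞 k))))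
  have hG : Function.Surjective G := by
    intro t
    refine ⟨⟨cls (x t), cls_mem_of_mem (mem_EG_bad ?_)⟩, hx t⟩
    exact (Finset.subset_biUnion_of_mem (fun t => bad (x t)) (Finset.mem_univ t)).trans Finset.subset_union_right
  have h2 := LinearMap.finrank_range_add_finrank_ker G
  rw [LinearMap.range_eq_top.2 hG, finrank_top, Module.finrank_pi, finrank_V, Fintype.card_coe] at h2
  have h3 : Module.finrank (ZMod 2) (N d ⊓ V (T : Set _) : Submodule (ZMod 2) (Qk k)) ≤
      Module.finrank (ZMod 2) (LinearMap.ker G) := by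
    let i : (N d ⊓ V (T : Set _) : Submodule (ZMod 2) (Qk k)) →ₗ[ZMod 2] LinearMap.ker G :=
      { toFun := fun x => ⟨⟨x.1, x.2.2⟩, hFN x.2.1⟩
        map_add' := fun _ _ => rfl
        map_smul' := fun _ _ => rfl }
    refine LinearMap.finrank_le_finrank_of_injective (f := i) ?_
    intro x y h
    have := congrArg (fun z => z.1.1) h
    exact Subtype.ext this
  lia

end C

end TwoConics

end

section

open IsDedekindDomain NumberField
open scoped WithZero

namespace TwoConics

section Res

variable {k : Type} [Field k] {K : Type} [Field K] [Algebra k K]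

/-- units of the extension -/
def um (K : Type) [Field K] [Algebra k K] : kˣ →* Kˣ := Units.map (algebraMap k K : k →* K)

theorem um_coe (x : kˣ) : ((um K x : Kˣ) : K) = algebraMap k K x := rfl

theorem exists_res : ∃ f : Qk k →ₗ[ZMod 2] Qk K, ∀ x : kˣ, f (cls x) = cls (um K x) := by
  let g : (kˣ ⧸ (powMonoidHom 2 : kˣ →* kˣ).range) →* (Kˣ ⧸ (powMonoidHom 2 : Kˣ →* Kˣ).range) :=
    QuotientGroup.map _ _ (um K) (by
      rintro _ ⟨x, rfl⟩
      exact ⟨um K x, by simp⟩)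
  let f : Qk k →+ Qk K := MonoidHom.toAdditive g
  exact ⟨f.toZModLinearMap 2, fun x => rfl⟩

/-- restriction map on square classes -/
noncomputable def res (k : Type) [Field k] (K : Type) [Field K] [Algebra k K] : Qk k →ₗ[ZMod 2] Qk K :=
  exists_res.choose

theorem res_cls (x : kˣ) : res k K (cls x) = cls (um K x) := exists_res.choose_spec x

theorem res_N {a : kˣ} {x : Qk k} (h : x ∈ N a) : res k K x ∈ N (um K a) := by
  obtain ⟨x, rfl⟩ := cls_surj x
  rw [res_cls, mem_N]
  obtain ⟨p, r, h⟩ := mem_N.1 h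
  refine ⟨algebraMap k K p, algebraMap k K r, ?_⟩
  rw [um_coe, um_coe, h]; simp only [map_sub, map_mul, map_pow]

theorem IsQuad.res_base {a : kˣ} {β : Kˣ} {σ : K ≃ₐ[k] K} (hq : IsQuad a β σ) : res k K (cls a) = 0 := by
  rw [res_cls, cls_eq_zero]
  refine ⟨β, Units.ext ?_⟩
  rw [um_coe, Units.val_pow_eq_pow_val, hq.sq]

theorem IsQuad.res_ker [CharZero k] {a : kˣ} {β : Kˣ} {σ : K ≃ₐ[k] K} (hq : IsQuad a β σ) {x : Qk k}
    (h : res k K x = 0) : x = 0 ∨ x = cls a := by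
  obtain ⟨x, rfl⟩ := cls_surj x
  have hcz : CharZero K := charZero_of_injective_algebraMap (algebraMap k K).injective
  rw [res_cls, cls_eq_zero] at h
  obtain ⟨z, hz⟩ := h
  have hz : algebraMap k K x = (z : K) ^ 2 := by
    rw [← um_coe, hz, Units.val_pow_eq_pow_val]
  obtain ⟨r, s, hrs⟩ := hq.span z
  have h1 := hq.conj_apply r s
  rw [← hrs] at h1
  have h2 : (σ z) ^ 2 = (z : K) ^ 2 := by rw [← map_pow, ← hz, σ.commutes]
  have hβ : (β : K) ≠ 0 := β.ne_zero
  have hinj := (algebraMap k K).injective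
  rcases sq_eq_sq_iff_eq_or_eq_neg.1 h2 with h3 | h3
  · left
    have hs : s = 0 := by
      rw [h1, hrs] at h3
      have : 2 * (algebraMap k K s * β) = 0 := by linear_combination -h3
      simpa [hβ] using this
    have hx : (x : k) = r ^ 2 := by
      apply hinj; rw [hz, hrs, hs]; simp
    have hr : r ≠ 0 := by rintro rfl; exact x.ne_zero (by simp [hx])
    exact cls_eq_zero.2 ⟨Units.mk0 r hr, Units.ext (by simpa using hx)⟩
  · right
    have hr : r = 0 := by
      rw [h1, hrs] at h3
      have : 2 * (algebraMap k K r) = 0 := by linear_combination h3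
      simpa using this
    have hx : (x : k) = a * s ^ 2 := by
      apply hinj; rw [hz, hrs, hr]
      simp only [map_zero, zero_add, mul_pow, hq.sq, map_mul, map_pow]; ring
    have hs : s ≠ 0 := by rintro rfl; exact x.ne_zero (by simp [hx])
    exact cls_eq.2 ⟨Units.mk0 s hs, Units.ext (by simpa using hx)⟩

variable [NumberField k] [NumberField K]

/-- restriction of places -/
noncomputable def belowPl (k : Type) [Field k] [NumberField k] {K : Type} [Field K] [NumberField K] [Algebra k K] :
    Pl K → Pl k
  | .inl w => .inl (below k w)
  | .inr ψ => .inr (ψ.comp (algebraMap k K))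

theorem res_L {w : Pl K} {x : Qk k} (h : x ∈ L (belowPl k w)) : res k K x ∈ L w := by
  obtain ⟨x, rfl⟩ := cls_surj x
  rw [res_cls]
  cases w with
  | inl w => exact mem_L_inl.2 (LS_above w (mem_L_inl.1 h))
  | inr ψ =>
    rw [belowPl, mem_L_inr] at h
    rw [mem_L_inr]
    exact h

theorem res_NL {w : Pl K} {a : kˣ} {x : Qk k} (h : x ∈ N a ⊔ L (belowPl k w)) :
    res k K x ∈ N (um K a) ⊔ L w := by
  obtain ⟨y, hy, z, hz, rfl⟩ := Submodule.mem_sup.1 h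
  rw [map_add]
  exact Submodule.add_mem_sup (res_N hy) (res_L hz)

end Res

theorem odd_mul_Q {k : Type} [Field k] [NumberField k] {p : HeightOneSpectrum (𝓞 k)} (h2 : p.valuation k 2 = 1)
    {a b : kˣ} (ha : p.valuation k a = 1) (hb : p.valuation k b = 1) (hna : cls a ∉ L (.inl p : Pl k))
    (hnb : cls b ∉ L (.inl p : Pl k)) : cls a + cls b ∈ L (.inl p : Pl k) := by
  rw [mem_L_inl] at hna hnb
  rw [← cls_mul, mem_L_inl]
  exact odd_mul p h2 ha hb hna hnb

theorem exists_sep (l : List ℕ) : ∀ {k : Type} [Field k] [NumberField k] (f : ℕ → kˣ) (v : kˣ)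
    (_ : cls v ∉ Submodule.span (ZMod 2) {x | ∃ i ∈ l, x = cls (f i)}) (S : Finset (HeightOneSpectrum (𝓞 k))),
    ∃ p ∉ S, cls v ∉ L (.inl p : Pl k) ∧ ∀ i ∈ l, cls (f i) ∈ L (.inl p : Pl k) := by
  induction l with
  | nil =>
    intro k _ _ f v hv S
    have : cls v ≠ 0 := by
      intro h; rw [h] at hv; exact hv (Submodule.zero_mem _)
    obtain ⟨p, hp, h⟩ := exists_nonsq this S
    exact ⟨p, hp, h, by simp⟩
  | cons a l ih =>
    intro k _ _ f v hv S
    classical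
    by_cases ha : cls (f a) = 0
    · obtain ⟨p, hp, h1, h2⟩ := ih f v (fun h => hv (Submodule.span_mono (by
        rintro x ⟨i, hi, rfl⟩; exact ⟨i, List.mem_cons_of_mem _ hi, rfl⟩) h)) S
      refine ⟨p, hp, h1, fun i hi => ?_⟩
      rcases List.mem_cons.1 hi with rfl | hi
      · rw [ha]; exact Submodule.zero_mem _
      · exact h2 i hi
    · obtain ⟨K, _, _, _, β, σ, hq⟩ := exists_quad ha
      have hv' : cls (um K v) ∉ Submodule.span (ZMod 2) {x | ∃ i ∈ l, x = cls (um K (f i))} := by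
        intro h
        have e : {x | ∃ i ∈ l, x = cls (um K (f i))} = Set.image (res k K) {x | ∃ i ∈ l, x = cls (f i)} := by
          ext x
          constructor
          · rintro ⟨i, hi, rfl⟩; exact ⟨_, ⟨i, hi, rfl⟩, res_cls _⟩
          · rintro ⟨_, ⟨i, hi, rfl⟩, rfl⟩; exact ⟨i, hi, res_cls _⟩
        rw [e, Submodule.span_image] at h
        obtain ⟨u, hu, h⟩ := h
        have hu' : u ∈ Submodule.span (ZMod 2) {x | ∃ i ∈ a :: l, x = cls (f i)} :=
          Submodule.span_mono (by
            rintro x ⟨i, hi, rfl⟩; exact ⟨i, List.mem_cons_of_mem _ hi, rfl⟩) hu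
        have ha' : cls (f a) ∈ Submodule.span (ZMod 2) {x | ∃ i ∈ a :: l, x = cls (f i)} :=
          Submodule.subset_span ⟨a, by simp, rfl⟩
        rw [← res_cls] at h
        have h0 : res k K (u - cls v) = 0 := by rw [map_sub, h, sub_self]
        rcases hq.res_ker h0 with h1 | h1
        · rw [sub_eq_zero.1 h1] at hu'
          exact hv hu'
        · have : cls v = u - cls (f a) := by rw [← h1]; abel
          exact hv (this ▸ Submodule.sub_mem _ hu' ha')
      let B := S ∪ bad v ∪ bad (Units.mk0 (2 : k) two_ne_zero) ∪ (a :: l).toFinset.biUnion (fun i => bad (f i))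
      obtain ⟨w, hw, h1, h2⟩ := ih (fun i => um K (f i)) (um K v) hv' (above K B)
      have hp : below k w ∉ B := fun h => hw (mem_above.2 h)
      have hp2 : (below k w).valuation k 2 = 1 := val_of_not_bad (x := Units.mk0 (2 : k) two_ne_zero)
        (fun h => hp (by simp only [B, Finset.mem_union]; tauto))
      have hpv : (below k w).valuation k v = 1 := val_of_not_bad
        (fun h => hp (by simp only [B, Finset.mem_union]; tauto))
      have hpf : ∀ i ∈ a :: l, (below k w).valuation k (f i) = 1 := fun i hi => val_of_not_bad
        (fun h => hp (by
          simp only [B, Finset.mem_union]; right; rw [Finset.mem_biUnion]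
          exact ⟨i, List.mem_toFinset.2 hi, h⟩))
      have hnv : cls v ∉ L (.inl (below k w) : Pl k) := by
        intro h
        have := res_L (w := (.inl w : Pl K)) h
        rw [res_cls] at this
        exact h1 this
      refine ⟨below k w, fun h => hp (by simp only [B, Finset.mem_union]; tauto), hnv, ?_⟩
      intro i hi
      by_contra hni
      have h3 := odd_mul_Q hp2 (hpf i hi) hpv hni hnv
      have h4 := res_L (w := (.inl w : Pl K)) h3
      have h5 : res k K (cls (f i)) ∈ L (.inl w : Pl K) := by
        rcases List.mem_cons.1 hi with rfl | hi
        · rw [hq.res_base]; exact Submodule.zero_mem _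
        · rw [res_cls]; exact h2 i hi
      rw [map_add, Submodule.add_mem_iff_right _ h5, res_cls] at h4
      exact h1 h4

end TwoConics

end

section

open IsDedekindDomain NumberField
open scoped WithZero

namespace TwoConics

section Idx

variable {k : Type} [Field k] [NumberField k] (p : HeightOneSpectrum (𝓞 k))

theorem val_int_pow (x : 𝓞 k) (n : ℕ) :
    p.valuation k (x : k) ≤ WithZero.exp (-(n : ℤ)) ↔ x ∈ p.asIdeal ^ n := by
  rw [HeightOneSpectrum.valuation_of_algebraMap, HeightOneSpectrum.intValuation_le_pow_iff_mem]

theorem mk_pow_eq_iff (n : ℕ) (x y : 𝓞 k) :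
    Ideal.Quotient.mk (p.asIdeal ^ n) x = Ideal.Quotient.mk (p.asIdeal ^ n) y ↔
    p.valuation k ((x : k) - y) ≤ WithZero.exp (-(n : ℤ)) := by
  rw [Ideal.Quotient.eq, ← val_int_pow]; push_cast; rfl

theorem card_quot (n : ℕ) : Nat.card (𝓞 k ⧸ p.asIdeal ^ n) = (Ideal.absNorm p.asIdeal) ^ n := by
  rw [← map_pow, Ideal.absNorm_apply, Submodule.cardQuot_apply]

theorem finite_quot (n : ℕ) : Finite (𝓞 k ⧸ p.asIdeal ^ n) := by
  apply Nat.finite_of_card_ne_zero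
  rw [card_quot]
  apply pow_ne_zero
  rw [Ideal.absNorm_ne_zero_iff]
  infer_instance

theorem exists_e : ∃ e : ℕ, p.valuation k 2 = WithZero.exp (-(e : ℤ)) := by
  have h := exp_logv p (Units.mk0 (2 : k) two_ne_zero)
  have h2 := val_two_le p
  simp only [Units.val_mk0] at h
  rw [← h, ← WithZero.exp_zero, WithZero.exp_le_exp] at h2
  refine ⟨(-logv p (Units.mk0 (2 : k) two_ne_zero)).toNat, ?_⟩
  rw [← h]
  congr 1
  lia

theorem card_sq_one {e M : ℕ} (he : p.valuation k 2 = WithZero.exp (-(e : ℤ))) (hM : e ≤ M) :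
    Nat.card {x : 𝓞 k ⧸ p.asIdeal ^ M // x ^ 2 = 1} ≤ 2 * Ideal.absNorm p.asIdeal ^ e := by
  classical
  have hfin := finite_quot p M
  let φ := Ideal.Quotient.factor (Ideal.pow_le_pow_right (I := p.asIdeal) (Nat.sub_le M e))
  have hφ : Function.Surjective φ := Ideal.Quotient.factor_surjective _
  have hcard : Nat.card φ.toAddMonoidHom.ker = Ideal.absNorm p.asIdeal ^ e := by
    have h1 := AddSubgroup.card_mul_index φ.toAddMonoidHom.ker
    have hr : φ.toAddMonoidHom.range = ⊤ := AddMonoidHom.range_eq_top.2 hφ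
    rw [AddSubgroup.index_ker, hr, AddSubgroup.card_top, card_quot, card_quot] at h1
    have h0 : 0 < Ideal.absNorm p.asIdeal ^ (M - e) := by
      apply pow_pos
      rw [Nat.pos_iff_ne_zero, Ideal.absNorm_ne_zero_iff]
      have := finite_quot p 1
      rwa [pow_one] at this
    have : Ideal.absNorm p.asIdeal ^ M = Ideal.absNorm p.asIdeal ^ e * Ideal.absNorm p.asIdeal ^ (M - e) := by
      rw [← pow_add]; congr 1; lia
    rw [this] at h1
    exact Nat.eq_of_mul_eq_mul_right h0 h1
  have key : ∀ x : 𝓞 k ⧸ p.asIdeal ^ M, x ^ 2 = 1 → φ x = 1 ∨ φ x = -1 := by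
    intro x hx
    obtain ⟨x, rfl⟩ := Ideal.Quotient.mk_surjective x
    rw [← map_pow, ← map_one (Ideal.Quotient.mk _), mk_pow_eq_iff] at hx
    have hx' : p.valuation k ((x : k) - 1) * p.valuation k ((x : k) + 1) ≤ WithZero.exp (-(M : ℤ)) := by
      rw [← map_mul]
      convert hx using 2
      push_cast; ring
    have e1 : WithZero.exp (-((M - e : ℕ) : ℤ)) * WithZero.exp (-(e : ℤ)) = WithZero.exp (-(M : ℤ)) := by
      rw [← WithZero.exp_add]; congr 1; lia
    have hpos : (0 : ℤᵐ⁰) < WithZero.exp (-(e : ℤ)) := WithZero.exp_pos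
    have h2 : p.valuation k 2 ≤ max (p.valuation k ((x : k) + 1)) (p.valuation k ((x : k) - 1)) := by
      have := (p.valuation k).map_sub ((x : k) + 1) ((x : k) - 1)
      have e : (x : k) + 1 - (x - 1) = 2 := by ring
      rwa [e] at this
    rw [he] at h2
    have h3 : p.valuation k ((x : k) - 1) ≤ WithZero.exp (-((M - e : ℕ) : ℤ)) ∨
        p.valuation k ((x : k) + 1) ≤ WithZero.exp (-((M - e : ℕ) : ℤ)) := by
      rw [← e1] at hx'
      rcases le_max_iff.1 h2 with h | h
      · left
        have : p.valuation k ((x : k) - 1) * WithZero.exp (-(e : ℤ)) ≤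
          WithZero.exp (-((M - e : ℕ) : ℤ)) * WithZero.exp (-(e : ℤ)) := le_trans (mul_le_mul_right h _) hx'
        exact le_of_mul_le_mul_right this hpos
      · right
        rw [mul_comm (p.valuation k _)] at hx'
        have : p.valuation k ((x : k) + 1) * WithZero.exp (-(e : ℤ)) ≤
          WithZero.exp (-((M - e : ℕ) : ℤ)) * WithZero.exp (-(e : ℤ)) := le_trans (mul_le_mul_right h _) hx'
        exact le_of_mul_le_mul_right this hpos
    have e2 : φ (Ideal.Quotient.mk _ x) = Ideal.Quotient.mk (p.asIdeal ^ (M - e)) x := rfl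
    rw [e2]
    rcases h3 with h | h
    · left
      rw [← map_one (Ideal.Quotient.mk _), mk_pow_eq_iff]
      convert h using 2
      push_cast; ring
    · right
      rw [← map_one (Ideal.Quotient.mk _), ← map_neg, mk_pow_eq_iff]
      convert h using 2
      push_cast; ring
  have hB : Nat.card (Bool × φ.toAddMonoidHom.ker) = 2 * Ideal.absNorm p.asIdeal ^ e := by
    rw [Nat.card_prod, hcard]; simp
  rw [← hB]
  have hex : ∀ x : {x : 𝓞 k ⧸ p.asIdeal ^ M // x ^ 2 = 1}, ∃ y : Bool × φ.toAddMonoidHom.ker,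
      x.1 = (if y.1 then 1 else -1) + y.2.1 := by
    rintro ⟨x, hx⟩
    rcases key x hx with h | h
    · refine ⟨(true, ⟨x - 1, ?_⟩), by simp⟩
      change φ (x - 1) = 0
      rw [map_sub, h, map_one, sub_self]
    · refine ⟨(false, ⟨x + 1, ?_⟩), by simp⟩
      change φ (x + 1) = 0
      rw [map_add, h, map_one, neg_add_cancel]
  choose f hf using hex
  refine Nat.card_le_card_of_injective f fun x y h => Subtype.ext ?_
  rw [hf x, hf y, h]

theorem card_unit_sq {e M : ℕ} (he : p.valuation k 2 = WithZero.exp (-(e : ℤ))) (hM : e ≤ M) :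
    Nat.card ((𝓞 k ⧸ p.asIdeal ^ M)ˣ ⧸ (powMonoidHom 2 : (𝓞 k ⧸ p.asIdeal ^ M)ˣ →* _).range) ≤
      2 * Ideal.absNorm p.asIdeal ^ e := by
  have hfin := finite_quot p M
  refine le_trans ?_ (card_sq_one p he hM)
  set s : (𝓞 k ⧸ p.asIdeal ^ M)ˣ →* (𝓞 k ⧸ p.asIdeal ^ M)ˣ := powMonoidHom 2 with hs
  have h1 := Subgroup.card_mul_index s.ker
  have h2 := Subgroup.card_mul_index s.range
  rw [Subgroup.index_ker, mul_comm, ← h2] at h1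
  have h3 : Nat.card s.ker = s.range.index := Nat.eq_of_mul_eq_mul_left Nat.card_pos h1
  rw [← Subgroup.index, ← h3]
  refine Nat.card_le_card_of_injective (fun x => ⟨(x.1 : 𝓞 k ⧸ p.asIdeal ^ M), ?_⟩) ?_
  · have := x.2
    rw [MonoidHom.mem_ker] at this
    have this : (x : (𝓞 k ⧸ p.asIdeal ^ M)ˣ) ^ 2 = 1 := this
    have := congrArg (fun x : (𝓞 k ⧸ p.asIdeal ^ M)ˣ => (x : 𝓞 k ⧸ p.asIdeal ^ M)) this
    simpa using this
  · intro x y h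
    exact Subtype.ext (Units.ext (congrArg Subtype.val h))

theorem index_L {e : ℕ} (he : p.valuation k 2 = WithZero.exp (-(e : ℤ))) :
    Finite (Qk k ⧸ L (.inl p : Pl k)) ∧
    Nat.card (Qk k ⧸ L (.inl p : Pl k)) ≤ 4 * Ideal.absNorm p.asIdeal ^ e := by
  classical
  obtain ⟨M, hM⟩ : ∃ M, M = 2 * e + 1 := ⟨_, rfl⟩
  have hfin := finite_quot p M
  have hM1 : WithZero.exp (-(M : ℤ)) < (1 : ℤᵐ⁰) := by
    rw [← WithZero.exp_zero, WithZero.exp_lt_exp]; lia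
  have hM4 : WithZero.exp (-(M : ℤ)) < p.valuation k 4 := by
    rw [val_four, he, ← WithZero.exp_add, WithZero.exp_lt_exp]; lia
  obtain ⟨π, hπ⟩ := p.valuation_exists_uniformizer k
  have hπ0 : π ≠ 0 := by rintro rfl; rw [map_zero] at hπ; exact WithZero.exp_ne_zero hπ.symm
  obtain ⟨ϖ, rfl⟩ : ∃ ϖ : kˣ, (ϖ : k) = π := ⟨Units.mk0 π hπ0, rfl⟩
  have hlog : logv p ϖ = -1 := by
    rw [← WithZero.exp_inj, exp_logv, hπ]
  have hlift : ∀ g : (𝓞 k ⧸ p.asIdeal ^ M)ˣ, ∃ m : kˣ, p.valuation k (m : k) = 1 ∧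
      ∃ m0 : 𝓞 k, (m : k) = m0 ∧ Ideal.Quotient.mk (p.asIdeal ^ M) m0 = g := by
    intro g
    obtain ⟨m0, hm0⟩ := Ideal.Quotient.mk_surjective (g : 𝓞 k ⧸ p.asIdeal ^ M)
    obtain ⟨n0, hn0⟩ := Ideal.Quotient.mk_surjective ((g⁻¹ : (𝓞 k ⧸ p.asIdeal ^ M)ˣ) : 𝓞 k ⧸ p.asIdeal ^ M)
    have h1 : Ideal.Quotient.mk (p.asIdeal ^ M) (m0 * n0) = Ideal.Quotient.mk (p.asIdeal ^ M) 1 := by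
      rw [map_mul, hm0, hn0, map_one, Units.mul_inv]
    rw [mk_pow_eq_iff] at h1
    have h2 : p.valuation k ((m0 : k) * n0) = 1 := by
      apply val_one_of_close
      have := lt_of_le_of_lt h1 hM1
      push_cast at this
      exact this
    have h3 : p.valuation k (m0 : k) = 1 := by
      refine le_antisymm (val_int_le p m0) ?_
      rw [← h2, map_mul]
      exact mul_le_of_le_one_right' (val_int_le p n0)
    have h4 : (m0 : k) ≠ 0 := by intro h; rw [h, map_zero] at h3; exact zero_ne_one h3
    exact ⟨Units.mk0 _ h4, h3, m0, rfl, hm0⟩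
  choose m hm1 m0 hm hm0 using hlift
  let G := (𝓞 k ⧸ p.asIdeal ^ M)ˣ ⧸ (powMonoidHom 2 : (𝓞 k ⧸ p.asIdeal ^ M)ˣ →* _).range
  let Φ : G × Bool → Qk k ⧸ L (.inl p : Pl k) := fun c =>
    Submodule.Quotient.mk (cls (m c.1.out) + if c.2 then cls ϖ else 0)
  have hunit : ∀ x : kˣ, p.valuation k (x : k) = 1 →
      ∃ c : G, cls (m c.out) - cls x ∈ L (.inl p : Pl k) := by
    intro x hx
    have hxi : p.valuation k ((x : k)⁻¹) = 1 := by rw [map_inv₀, hx, inv_one]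
    obtain ⟨x0, hx0⟩ := p.exists_valuation_sub_lt_of_integer hx.le (Units.mk0 (WithZero.exp (-(M : ℤ))) WithZero.exp_ne_zero)
    obtain ⟨y0, hy0⟩ := p.exists_valuation_sub_lt_of_integer hxi.le (Units.mk0 (WithZero.exp (-(M : ℤ))) WithZero.exp_ne_zero)
    rw [Units.val_mk0] at hx0 hy0
    have hxy : Ideal.Quotient.mk (p.asIdeal ^ M) (x0 * y0) = Ideal.Quotient.mk (p.asIdeal ^ M) 1 := by
      rw [mk_pow_eq_iff]
      have e1 : ((x0 * y0 : 𝓞 k) : k) - ((1 : 𝓞 k) : k) = (x0 - x) * y0 + x * (y0 - (x : k)⁻¹) := by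
        have := x.ne_zero
        push_cast; field_simp; ring
      rw [e1]
      refine (p.valuation k).map_add_le ?_ ?_
      · rw [map_mul]
        exact (mul_le_of_le_one_right' (val_int_le p y0)).trans hx0.le
      · rw [map_mul, hx, one_mul]; exact hy0.le
    rw [map_mul, map_one] at hxy
    let g : (𝓞 k ⧸ p.asIdeal ^ M)ˣ := ⟨Ideal.Quotient.mk _ x0, Ideal.Quotient.mk _ y0, hxy, by rw [mul_comm, hxy]⟩
    refine ⟨QuotientGroup.mk g, ?_⟩
    obtain ⟨⟨_, ⟨h, rfl⟩⟩, hh⟩ := QuotientGroup.mk_out_eq_mul (powMonoidHom 2 : (𝓞 k ⧸ p.asIdeal ^ M)ˣ →* _).range g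
    set o := Quotient.out (QuotientGroup.mk g : G) with ho
    have hh' : o = g * h ^ 2 := hh
    rw [sub_eq_add_neg, Qk_neg, ← cls_mul, mem_L_inl]
    refine ⟨((x : k) * m h)⁻¹, by simp, ?_⟩
    have hx' := x.ne_zero
    have hmh := (m h).ne_zero
    have e2 : ((m o * x : kˣ) : k) * ((x : k) * m h)⁻¹ ^ 2 - 1 = ((m o : k) - x * (m h : k) ^ 2) / (x * (m h : k) ^ 2) := by
      push_cast; field_simp
    rw [e2, map_div₀, map_mul, map_pow, hx, hm1, one_pow, one_mul, div_one]
    refine lt_of_le_of_lt ?_ hM4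
    have e3 : (m o : k) - x * (m h : k) ^ 2 = ((m0 o : k) - x0 * (m0 h : k) ^ 2) + (x0 - x) * (m h : k) ^ 2 := by
      rw [hm, hm]; ring
    rw [e3]
    refine (p.valuation k).map_add_le ?_ ?_
    · have : Ideal.Quotient.mk (p.asIdeal ^ M) (m0 o) = Ideal.Quotient.mk (p.asIdeal ^ M) (x0 * (m0 h) ^ 2) := by
        rw [map_mul, map_pow, hm0, hm0, hh']
        push_cast
        rfl
      rw [mk_pow_eq_iff] at this
      push_cast at this
      exact this
    · rw [map_mul, map_pow, hm1, one_pow, mul_one]; exact hx0.le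
  have hsurj : Function.Surjective Φ := by
    intro q
    obtain ⟨q, rfl⟩ := Submodule.Quotient.mk_surjective _ q
    obtain ⟨x, rfl⟩ := cls_surj q
    have hv : ∀ y : kˣ, logv p y = 0 → ∀ b : Bool, cls y = cls x + (if b then cls ϖ else 0) →
        ∃ c, Φ c = Submodule.Quotient.mk (cls x) := by
      intro y hy b hb
      obtain ⟨c, hc⟩ := hunit y (logv_eq_zero.1 hy)
      refine ⟨(c, b), ?_⟩
      rw [Submodule.Quotient.eq]
      convert hc using 1
      rw [hb]
      simp only
      have : (if b = true then cls ϖ else 0) = - (if b = true then cls ϖ else 0) := (Qk_neg _).symm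
      rw [sub_add_eq_sub_sub_swap, sub_eq_add_neg (cls (m c.out)), ← this]
    rcases Int.even_or_odd' (logv p x) with ⟨n, hn | hn⟩
    · refine hv (x * (ϖ ^ n) ^ 2) ?_ false ?_
      · rw [logv_mul, logv_pow, logv_zpow, hlog, hn]; push_cast; ring
      · rw [cls_mul, cls_sq]; simp
    · refine hv (x * ((ϖ ^ n) ^ 2 * ϖ)) ?_ true ?_
      · rw [logv_mul, logv_mul, logv_pow, logv_zpow, hlog, hn]; push_cast; ring
      · rw [cls_mul, cls_mul, cls_sq]; simp
  refine ⟨Finite.of_surjective Φ hsurj, ?_⟩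
  have h1 := Nat.card_le_card_of_surjective Φ hsurj
  have h2 := card_unit_sq p he (M := M) (by lia)
  rw [Nat.card_prod] at h1
  simp only [Nat.card_eq_fintype_card, Fintype.card_bool] at h1
  refine h1.trans ?_
  have h2 : Nat.card G ≤ 2 * Ideal.absNorm p.asIdeal ^ e := h2
  lia

theorem index_L_real (φ : k →+* ℝ) :
    Finite (Qk k ⧸ L (.inr φ : Pl k)) ∧ Nat.card (Qk k ⧸ L (.inr φ : Pl k)) ≤ 2 := by
  let Φ : Bool → Qk k ⧸ L (.inr φ : Pl k) := fun b =>
    Submodule.Quotient.mk (if b then cls (-1) else 0)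
  have hsurj : Function.Surjective Φ := by
    intro q
    obtain ⟨q, rfl⟩ := Submodule.Quotient.mk_surjective _ q
    obtain ⟨x, rfl⟩ := cls_surj q
    have hx : φ x ≠ 0 := by simp
    rcases lt_or_gt_of_ne hx with h | h
    · refine ⟨true, ?_⟩
      rw [Submodule.Quotient.eq, sub_eq_add_neg, Qk_neg]
      simp only [if_true]
      rw [← cls_mul, mem_L_inr]
      simpa using h
    · refine ⟨false, ?_⟩
      rw [Submodule.Quotient.eq, sub_eq_add_neg, Qk_neg]
      simp only [Bool.false_eq_true, if_false, zero_add]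
      rw [mem_L_inr]
      exact h
  refine ⟨Finite.of_surjective Φ hsurj, ?_⟩
  simpa using Nat.card_le_card_of_surjective Φ hsurj

theorem prod_norm_le (S : Finset (HeightOneSpectrum (𝓞 k))) (e : HeightOneSpectrum (𝓞 k) → ℕ)
    (he : ∀ p, p.valuation k 2 = WithZero.exp (-(e p : ℤ))) :
    ∏ p ∈ S, Ideal.absNorm p.asIdeal ^ e p ≤ 2 ^ Module.finrank ℚ k := by
  have h1 : ∏ p ∈ S, p.asIdeal ^ e p ∣ Ideal.span {(2 : 𝓞 k)} := by
    apply Finset.prod_dvd_of_coprime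
    · intro p hp q hq hpq
      apply IsCoprime.pow
      rw [Ideal.isCoprime_iff_sup_eq]
      apply Ideal.IsMaximal.coprime_of_ne p.isMaximal q.isMaximal
      intro h
      exact hpq (HeightOneSpectrum.ext h)
    · intro p hp
      rw [Ideal.dvd_iff_le, Ideal.span_singleton_le_iff_mem, ← val_int_pow, coe_two, he]
  have h2 := map_dvd Ideal.absNorm h1
  rw [map_prod] at h2
  simp only [map_pow] at h2
  have h3 : Ideal.absNorm (Ideal.span {(2 : 𝓞 k)}) = 2 ^ Module.finrank ℚ k := by
    have := Ideal.absNorm_span_natCast (S := 𝓞 k) 2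
    rw [RingOfIntegers.rank] at this
    exact_mod_cast this
  rw [h3] at h2
  exact Nat.le_of_dvd (by positivity) h2

/-- classes that are local squares at `S` and at the real places -/
noncomputable def LL (S : Finset (HeightOneSpectrum (𝓞 k))) : Submodule (ZMod 2) (Qk k) := ⨅ v ∈ iS S, L v

theorem mem_LL {S : Finset (HeightOneSpectrum (𝓞 k))} {x : Qk k} : x ∈ LL S ↔ ∀ v ∈ iS S, x ∈ L v := by
  simp [LL, Submodule.mem_iInf]

theorem index_LL (S : Finset (HeightOneSpectrum (𝓞 k))) : Finite (Qk k ⧸ LL S) ∧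
    Module.finrank (ZMod 2) (Qk k ⧸ LL S) ≤ 2 * (S.card + Fintype.card (InfinitePlace k)) := by
  classical
  have hfin : ∀ v : Pl k, Finite (Qk k ⧸ L v) := by
    intro v
    cases v with
    | inl p =>
      obtain ⟨e, he⟩ := exists_e p
      exact (index_L p he).1
    | inr φ => exact (index_L_real φ).1
  let f : Qk k →ₗ[ZMod 2] (∀ v : iS S, Qk k ⧸ L v.1) := LinearMap.pi fun v => (L v.1).mkQ
  have hker : LinearMap.ker f = LL S := by
    ext x
    rw [LinearMap.mem_ker, mem_LL]
    constructor
    · intro h v hv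
      have := congrFun h ⟨v, hv⟩
      simpa [f] using this
    · intro h
      ext v
      simpa [f] using h v.1 v.2
  let g := (LL S).liftQ f hker.ge
  have hg : Function.Injective g := by
    rw [← LinearMap.ker_eq_bot]
    exact Submodule.ker_liftQ_eq_bot _ _ _ hker.le
  have hF : Finite (Qk k ⧸ LL S) := Finite.of_injective g hg
  refine ⟨hF, ?_⟩
  have h1 := Nat.card_le_card_of_injective g hg
  choose e he using fun p : HeightOneSpectrum (𝓞 k) => exists_e p
  have h2 : Nat.card (∀ v : iS S, Qk k ⧸ L v.1) ≤
      (4 ^ S.card * 2 ^ Module.finrank ℚ k) * 2 ^ Fintype.card (k →+* ℝ) := by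
    rw [Nat.card_pi, Finset.prod_coe_sort (iS S) (fun v => Nat.card (Qk k ⧸ L v)), iS, Finset.prod_disjSum]
    apply Nat.mul_le_mul
    · refine (Finset.prod_le_prod' fun p hp => (index_L p (he p)).2).trans ?_
      rw [Finset.prod_mul_distrib, Finset.prod_const]
      exact Nat.mul_le_mul_left _ (prod_norm_le S e he)
    · refine (Finset.prod_le_prod' fun φ hp => (index_L_real φ).2).trans ?_
      rw [Finset.prod_const, Finset.card_univ]
  rw [Module.natCard_eq_pow_finrank (K := ZMod 2), Nat.card_zmod] at h1
  have h3 := h1.trans h2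
  have h4 : (4 : ℕ) ^ S.card = 2 ^ (2 * S.card) := by rw [pow_mul]; norm_num
  rw [h4, ← pow_add, ← pow_add, Nat.pow_le_pow_iff_right (by norm_num)] at h3
  have h5 := InfinitePlace.card_add_two_mul_card_eq_rank k
  have h6 := InfinitePlace.card_eq_nrRealPlaces_add_nrComplexPlaces k
  have h7 := card_real (k := k)
  lia

end Idx

end TwoConics

end

section

open IsDedekindDomain NumberField
open scoped WithZero

namespace TwoConics

section Hasse

variable {k : Type} [Field k] [NumberField k]

theorem exists_sep_set (B : Finset (Qk k)) (v : Qk k) (hv : v ∉ Submodule.span (ZMod 2) (B : Set (Qk k)))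
    (S : Finset (HeightOneSpectrum (𝓞 k))) :
    ∃ p ∉ S, v ∉ L (.inl p : Pl k) ∧ ∀ x ∈ B, x ∈ L (.inl p : Pl k) := by
  classical
  choose r hr using fun q : Qk k => cls_surj q
  let f : ℕ → kˣ := fun i => r (B.toList.getD i 0)
  have hf : ∀ x ∈ B, ∃ i ∈ List.range B.toList.length, cls (f i) = x := by
    intro x hx
    obtain ⟨i, hi, h⟩ := List.getElem_of_mem (Finset.mem_toList.2 hx)
    refine ⟨i, List.mem_range.2 hi, ?_⟩
    simp only [f]
    rw [hr, List.getD_eq_getElem _ _ hi, h]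
  have hset : {x | ∃ i ∈ List.range B.toList.length, x = cls (f i)} = (B : Set (Qk k)) := by
    ext x
    constructor
    · rintro ⟨i, hi, rfl⟩
      rw [List.mem_range] at hi
      simp only [f]
      rw [hr, List.getD_eq_getElem _ _ hi]
      exact Finset.mem_toList.1 (List.getElem_mem hi)
    · intro hx
      obtain ⟨i, hi, h⟩ := hf x hx
      exact ⟨i, hi, h.symm⟩
  obtain ⟨p, hp, h1, h2⟩ := exists_sep (List.range B.toList.length) f (r v) (by rw [hset, hr]; exact hv) S
  rw [hr] at h1
  refine ⟨p, hp, h1, fun x hx => ?_⟩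
  obtain ⟨i, hi, rfl⟩ := hf x hx
  exact h2 i hi

theorem tame {p : HeightOneSpectrum (𝓞 k)} (h2 : p.valuation k 2 = 1) {e u : kˣ} (he : Odd (logv p e))
    (hu : p.valuation k u = 1) (h : cls u ∈ N e) : cls u ∈ L (.inl p : Pl k) := by
  obtain ⟨x, r, h⟩ := mem_N.1 h
  rw [mem_L_inl]
  have h4 : p.valuation k 4 = 1 := by rw [val_four, h2, one_mul]
  have hodd : ∀ r : kˣ, ∀ y : kˣ, p.valuation k ((e : k) * (r : k) ^ 2) ≠ p.valuation k ((y : k) ^ 2) := by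
    intro r y heq
    have : logv p (e * r ^ 2) = logv p (y ^ 2) := by
      rw [← WithZero.exp_inj, exp_logv, exp_logv]; exact heq
    rw [logv_mul, logv_pow, logv_pow] at this
    obtain ⟨m, hm⟩ := he
    push_cast at this
    lia
  by_cases hr : r = 0
  · have hx : x ≠ 0 := by
      rintro rfl; exact u.ne_zero (by rw [h, hr]; ring)
    rw [h, hr]
    have := LS.of_sq (p.valuation k) (val_two_ne p) hx
    convert this using 1; ring
  have hx : x ≠ 0 := by
    rintro rfl
    apply hodd (Units.mk0 r hr) 1
    have : (e : k) * r ^ 2 = - u := by rw [h]; ring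
    simp only [Units.val_mk0, Units.val_one, one_pow, map_one]
    rw [this, Valuation.map_neg, hu]
  rcases lt_trichotomy (p.valuation k (x ^ 2)) (p.valuation k ((e : k) * r ^ 2)) with hlt | heq | hgt
  · exfalso
    have h3 := (p.valuation k).map_sub_eq_of_lt_right hlt
    rw [← h, hu] at h3
    apply hodd (Units.mk0 r hr) 1
    simp [← h3]
  · exact absurd heq.symm (hodd (Units.mk0 r hr) (Units.mk0 x hx))
  · have h3 := (p.valuation k).map_sub_eq_of_lt_left hgt
    rw [← h, hu] at h3
    refine ⟨x⁻¹, inv_ne_zero hx, ?_⟩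
    have e1 : (u : k) * x⁻¹ ^ 2 - 1 = -((e : k) * r ^ 2) / x ^ 2 := by
      rw [h]; field_simp; ring
    rw [e1, h4, map_div₀, Valuation.map_neg, ← h3, div_one, h3]
    exact hgt

theorem exists_basis_primes (S : Finset (HeightOneSpectrum (𝓞 k))) {a : Qk k}
    (ha : a ∈ V (S : Set (HeightOneSpectrum (𝓞 k)))) (ha0 : a ≠ 0) :
    ∃ (B : Finset (Qk k)) (w : Qk k → HeightOneSpectrum (𝓞 k)), a ∈ B ∧
      Submodule.span (ZMod 2) (B : Set (Qk k)) = V (S : Set (HeightOneSpectrum (𝓞 k))) ∧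
      B.card = S.card + Fintype.card (InfinitePlace k) ∧
      ∀ x ∈ B, w x ∉ S ∧ x ∉ L (.inl (w x) : Pl k) ∧ ∀ y ∈ B, y ≠ x → y ∈ L (.inl (w x) : Pl k) := by
  classical
  have h1 : LinearIndepOn (ZMod 2) id ({a} : Set (Qk k)) := LinearIndepOn.singleton (v := id) ha0
  obtain ⟨b, hb, hab, hsp, hli⟩ := exists_linearIndepOn_id_extension h1
    (t := (V (S : Set (HeightOneSpectrum (𝓞 k))) : Set (Qk k))) (by simpa using ha)
  have hbf : b.Finite := Set.Finite.subset (show (V (S : Set (HeightOneSpectrum (𝓞 k))) : Set (Qk k)).Finite from finite_V S) hb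
  obtain ⟨B, rfl⟩ := hbf.exists_finset_coe
  have hspan : Submodule.span (ZMod 2) (B : Set (Qk k)) = V (S : Set (HeightOneSpectrum (𝓞 k))) :=
    le_antisymm (Submodule.span_le.2 hb) hsp
  have hw : ∀ x : Qk k, ∃ w : HeightOneSpectrum (𝓞 k), x ∈ B → w ∉ S ∧ x ∉ L (.inl w : Pl k) ∧
      ∀ y ∈ B, y ≠ x → y ∈ L (.inl w : Pl k) := by
    intro x
    by_cases hx : x ∈ B
    · have h2 := hli.notMem_span (i := x) hx
      obtain ⟨p, hp, h3, h4⟩ := exists_sep_set (B.erase x) x (by simpa using h2) S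
      exact ⟨p, fun _ => ⟨hp, h3, fun y hy hyx => h4 y (Finset.mem_erase.2 ⟨hyx, hy⟩)⟩⟩
    · obtain ⟨p, -⟩ := exists_sep_set (∅ : Finset (Qk k)) a (by simpa using ha0) S
      exact ⟨p, fun h => absurd h hx⟩
  choose w hw using hw
  refine ⟨B, w, hab rfl, hspan, ?_, hw⟩
  rw [← finrank_span_finset_eq_card hli, hspan, finrank_V]

theorem dim_bound {B : Finset (Qk k)} {w : Qk k → HeightOneSpectrum (𝓞 k)}
    (hw : ∀ x ∈ B, x ∉ L (.inl (w x) : Pl k) ∧ ∀ y ∈ B, y ≠ x → y ∈ L (.inl (w x) : Pl k))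
    {Z : Finset (Qk k)} (hZ : Z ⊆ B) {U : Submodule (ZMod 2) (Qk k)}
    (hU : U ≤ Submodule.span (ZMod 2) (B : Set (Qk k))) (hUL : ∀ u ∈ U, ∀ x ∈ Z, u ∈ L (.inl (w x) : Pl k)) :
    Module.finrank (ZMod 2) U + Z.card ≤ B.card := by
  classical
  have h1 : U ≤ Submodule.span (ZMod 2) ((B \ Z : Finset (Qk k)) : Set (Qk k)) := by
    intro u hu
    obtain ⟨c, hc⟩ := Submodule.mem_span_finset'.1 (hU hu)
    have h0 : ∀ x : B, x.1 ∈ Z → c x = 0 := by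
      intro x hx
      by_contra hcx
      have hcx : c x = 1 := by
        generalize c x = t at hcx
        revert t; decide
      have h2 := hUL u hu x.1 hx
      rw [← hc, ← Finset.add_sum_erase _ _ (Finset.mem_univ x), hcx, one_smul] at h2
      refine (hw x.1 x.2).1 ((Submodule.add_mem_iff_left _ ?_).1 h2)
      refine Submodule.sum_mem _ fun y hy => Submodule.smul_mem _ _ ((hw x.1 x.2).2 y.1 y.2 ?_)
      intro h
      exact (Finset.mem_erase.1 hy).1 (Subtype.ext h)
    rw [← hc]
    refine Submodule.sum_mem _ fun y _ => ?_
    by_cases hy : y.1 ∈ Z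
    · rw [h0 y hy, zero_smul]; exact Submodule.zero_mem _
    · exact Submodule.smul_mem _ _ (Submodule.subset_span (by simp [hy]))
  have h2 := Submodule.finrank_mono h1
  have h3 : Module.finrank (ZMod 2) (Submodule.span (ZMod 2) ((B \ Z : Finset (Qk k)) : Set (Qk k))) ≤ (B \ Z).card :=
    finrank_span_finset_le_card _
  have h4 := Finset.card_sdiff_add_card_eq_card hZ
  lia

theorem V_inf_LL {S : Finset (HeightOneSpectrum (𝓞 k))} (hS : Good S) {B : Finset (Qk k)}
    {w : Qk k → HeightOneSpectrum (𝓞 k)}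
    (hspan : Submodule.span (ZMod 2) (B : Set (Qk k)) = V (S : Set (HeightOneSpectrum (𝓞 k))))
    (hcard : B.card = S.card + Fintype.card (InfinitePlace k))
    (hw : ∀ x ∈ B, w x ∉ S ∧ x ∉ L (.inl (w x) : Pl k) ∧ ∀ y ∈ B, y ≠ x → y ∈ L (.inl (w x) : Pl k))
    {B' : Finset (Qk k)} (hB' : B' ⊆ B) [DecidableEq (HeightOneSpectrum (𝓞 k))] {e : Qk k}
    (he : e ∈ V ((S ∪ B'.image w : Finset _) : Set (HeightOneSpectrum (𝓞 k)))) (heL : e ∈ LL S) : e = 0 := by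
  classical
  by_contra he0
  obtain ⟨e0, he0', rfl⟩ := mem_sub.1 he
  have hinj : Set.InjOn w B := by
    intro x hx y hy h
    by_contra hne
    apply (hw x hx).2.1
    rw [h]
    exact (hw y hy).2.2 x hx hne
  let Z := B'.filter (fun x => Odd (logv (w x) e0))
  have hZB' : Z ⊆ B' := Finset.filter_subset _ _
  have hZB : Z ⊆ B := hZB'.trans hB'
  let T := S ∪ Z.image w
  have hST : S ⊆ T := Finset.subset_union_left
  have hT : Good T := hS.mono hST
  have hTcard : T.card = S.card + Z.card := by
    rw [Finset.card_union_of_disjoint, Finset.card_image_of_injOn (hinj.mono hZB)]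
    rw [Finset.disjoint_right]
    intro p hp
    obtain ⟨x, hx, rfl⟩ := Finset.mem_image.1 hp
    exact (hw x (hZB hx)).1
  have heT : cls e0 ∈ V (T : Set (HeightOneSpectrum (𝓞 k))) := by
    apply hT.mem_V
    intro p hp
    by_cases hpB : p ∈ S ∪ B'.image w
    · rcases Finset.mem_union.1 hpB with h | h
      · exact absurd (hST h) hp
      · obtain ⟨x, hx, rfl⟩ := Finset.mem_image.1 h
        rw [← Int.not_odd_iff_even]
        intro hodd
        exact hp (Finset.mem_union_right _ (Finset.mem_image_of_mem _ (Finset.mem_filter.2 ⟨hx, hodd⟩)))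
    · rw [logv_eq_zero.2 (he0' p hpB)]; exact Even.zero
  obtain ⟨e1, he1, hee⟩ := mem_sub.1 heT
  have hlog : ∀ p, Odd (logv p e0) → Odd (logv p e1) := by
    intro p h
    obtain ⟨z, rfl⟩ := cls_eq.1 hee
    rw [logv_mul, logv_pow]
    exact h.add_even (by simp)
  rw [← hee] at he0 heL
  have hA := boundA hT he1 he0
  have hn : (nsq T (cls e1)).card ≤ Z.card := by
    refine (Finset.card_le_card (t := Z.image (fun x => (.inl (w x) : Pl k))) ?_).trans Finset.card_image_le
    intro v hv
    obtain ⟨hv1, hv2⟩ := mem_nsq.1 hv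
    rw [mem_LL] at heL
    cases v with
    | inl p =>
      rw [mem_iS_inl] at hv1
      rcases Finset.mem_union.1 hv1 with h | h
      · exact absurd (heL _ (mem_iS_inl.2 h)) hv2
      · obtain ⟨x, hx, rfl⟩ := Finset.mem_image.1 h
        exact Finset.mem_image.2 ⟨x, hx, rfl⟩
    | inr φ => exact absurd (heL _ (mem_iS_inr φ)) hv2
  let A : Submodule (ZMod 2) (Qk k) := N e1 ⊓ V (T : Set (HeightOneSpectrum (𝓞 k)))
  have hfd : FiniteDimensional (ZMod 2) (V (T : Set (HeightOneSpectrum (𝓞 k)))) := Module.Finite.of_finite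
  have hfd2 : FiniteDimensional (ZMod 2) (V (S : Set (HeightOneSpectrum (𝓞 k)))) := Module.Finite.of_finite
  have hfd3 : FiniteDimensional (ZMod 2) A := Submodule.finiteDimensional_of_le (inf_le_right : A ≤ V (T : Set _))
  have h1 := Submodule.finrank_sup_add_finrank_inf_eq A (V (S : Set (HeightOneSpectrum (𝓞 k))))
  have h2 : Module.finrank (ZMod 2) (A ⊔ V (S : Set (HeightOneSpectrum (𝓞 k))) : Submodule (ZMod 2) (Qk k)) ≤
      Module.finrank (ZMod 2) (V (T : Set (HeightOneSpectrum (𝓞 k)))) :=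
    Submodule.finrank_mono (sup_le inf_le_right (V_mono (by exact_mod_cast hST)))
  rw [finrank_V] at h1 h2
  have h3 := dim_bound (fun x hx => (hw x hx).2) hZB (U := A ⊓ V (S : Set (HeightOneSpectrum (𝓞 k))))
    (by rw [hspan]; exact inf_le_right) (by
      rintro u ⟨⟨hu1, -⟩, hu2⟩ x hx
      obtain ⟨u, hu, rfl⟩ := mem_sub.1 hu2
      have hxS := (hw x (hZB hx)).1
      exact tame (hS.1 _ hxS) (hlog _ (Finset.mem_filter.1 hx).2) (hu _ hxS) hu1)
  have hA' : T.card + Fintype.card (InfinitePlace k) + 1 ≤ Module.finrank (ZMod 2) A + (nsq T (cls e1)).card := hA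
  lia

theorem main_ker {S : Finset (HeightOneSpectrum (𝓞 k))} (hS : Good S) {a : kˣ}
    (ha : a ∈ EG (S : Set (HeightOneSpectrum (𝓞 k)))) (ha0 : cls a ≠ 0)
    (F : Qk k →ₗ[ZMod 2] (nsq S (cls a) → ZMod 2)) (hFs : Function.Surjective F)
    (hFN : N a ≤ LinearMap.ker F) (hFL : ∀ v : nsq S (cls a), ∀ x ∈ L (v : Pl k), F x v = 0) :
    ∃ T : Finset (HeightOneSpectrum (𝓞 k)), S ⊆ T ∧
      (∀ e ∈ V (T : Set (HeightOneSpectrum (𝓞 k))), e ∈ LL S → e = 0) ∧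
      LinearMap.ker F ≤ (N a ⊓ V (T : Set (HeightOneSpectrum (𝓞 k)))) ⊔ LL S := by
  classical
  obtain ⟨B, w, haB, hspan, hcard, hw⟩ := exists_basis_primes S (cls_mem_of_mem ha) ha0
  let T := S ∪ (B.erase (cls a)).image w
  have hST : S ⊆ T := Finset.subset_union_left
  have hV : ∀ e ∈ V (T : Set (HeightOneSpectrum (𝓞 k))), e ∈ LL S → e = 0 := fun e he heL =>
    V_inf_LL hS hspan hcard hw (Finset.erase_subset _ _) he heL
  refine ⟨T, hST, hV, ?_⟩
  have hinj : Set.InjOn w B := by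
    intro x hx y hy h
    by_contra hne
    apply (hw x hx).2.1
    rw [h]
    exact (hw y hy).2.2 x hx hne
  have hTcard : T.card + 1 = S.card + B.card := by
    rw [Finset.card_union_of_disjoint, Finset.card_image_of_injOn (hinj.mono (Finset.erase_subset _ _)), add_assoc,
      Finset.card_erase_add_one haB]
    rw [Finset.disjoint_right]
    intro p hp
    obtain ⟨x, hx, rfl⟩ := Finset.mem_image.1 hp
    exact (hw x (Finset.erase_subset _ _ hx)).1
  have hn : nsq T (cls a) = nsq S (cls a) := by
    ext v
    rw [mem_nsq, mem_nsq]
    cases v with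
    | inl p =>
      rw [mem_iS_inl, mem_iS_inl]
      constructor
      · rintro ⟨h1, h⟩
        refine ⟨?_, h⟩
        rcases Finset.mem_union.1 h1 with h1 | h1
        · exact h1
        · obtain ⟨x, hx, rfl⟩ := Finset.mem_image.1 h1
          obtain ⟨hx1, hx2⟩ := Finset.mem_erase.1 hx
          exact absurd ((hw x hx2).2.2 _ haB hx1.symm) h
      · rintro ⟨h1, h⟩; exact ⟨hST h1, h⟩
    | inr φ => simp [mem_iS_inr]
  have hA := boundA (hS.mono hST) (a := a) (fun p hp => ha p (fun h => hp (hST h))) ha0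
  rw [hn] at hA
  set P : Submodule (ZMod 2) (Qk k) := N a ⊓ V (T : Set (HeightOneSpectrum (𝓞 k))) with hP
  have hLL : LL S ≤ LinearMap.ker F := by
    intro x hx
    rw [LinearMap.mem_ker]
    ext v
    exact hFL v x (mem_LL.1 hx v.1 (mem_nsq.1 v.2).1)
  obtain ⟨hfin, hidx⟩ := index_LL S
  have hfd : FiniteDimensional (ZMod 2) (Qk k ⧸ LL S) := Module.Finite.of_finite
  let Fb := (LL S).liftQ F hLL
  have hFbs : Function.Surjective Fb := by
    intro t
    obtain ⟨x, hx⟩ := hFs t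
    exact ⟨(LL S).mkQ x, hx⟩
  have h1 := LinearMap.finrank_range_add_finrank_ker Fb
  rw [LinearMap.range_eq_top.2 hFbs, finrank_top, Module.finrank_pi, Fintype.card_coe] at h1
  have h2 : P.map (LL S).mkQ ≤ LinearMap.ker Fb := by
    rintro _ ⟨x, hx, rfl⟩
    exact hFN hx.1
  have h3 : Module.finrank (ZMod 2) (P.map (LL S).mkQ) = Module.finrank (ZMod 2) P := by
    have : Function.Injective ((LL S).mkQ.domRestrict P) := by
      rw [← LinearMap.ker_eq_bot, LinearMap.ker_eq_bot']
      rintro ⟨x, hx⟩ h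
      have : x ∈ LL S := by
        rw [LinearMap.domRestrict_apply, Submodule.mkQ_apply, Submodule.Quotient.mk_eq_zero] at h
        exact h
      exact Subtype.ext (hV x hx.2 this)
    rw [← LinearMap.range_domRestrict]
    exact LinearMap.finrank_range_of_inj this
  have h4 := Submodule.eq_of_le_of_finrank_le h2 (by rw [h3]; lia)
  intro x hx
  have h5 : (LL S).mkQ x ∈ P.map (LL S).mkQ := by rw [h4]; exact hx
  obtain ⟨y, hy, hxy⟩ := h5
  rw [Submodule.mkQ_apply, Submodule.mkQ_apply, Submodule.Quotient.eq] at hxy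
  rw [Submodule.mem_sup]
  refine ⟨y, hy, x - y, ?_, by abel⟩
  rw [← neg_sub]
  exact Submodule.neg_mem _ hxy

theorem hasse {a b : kˣ} (h : ∀ v : Pl k, cls a ∉ L v → cls b ∈ N a ⊔ L v) : NS (a : k) (b : k) := by
  classical
  by_cases ha0 : cls a = 0
  · exact N_of_isSquare ha0 _
  rw [← mem_N]
  obtain ⟨S, hS0, hS⟩ := exists_good_ge (bad a ∪ bad b)
  have ha := mem_EG_bad (Finset.subset_union_left.trans hS0)
  have hb := mem_EG_bad (Finset.subset_union_right.trans hS0)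
  obtain ⟨F, hFs, hFN, hFL⟩ := exists_F (a := a) (nsq S (cls a)) (fun v hv => (mem_nsq.1 hv).2)
  obtain ⟨T, hST, hV, hker⟩ := main_ker hS ha ha0 F hFs hFN hFL
  have hbF : cls b ∈ LinearMap.ker F := by
    rw [LinearMap.mem_ker]
    ext v
    obtain ⟨x, hx, y, hy, hxy⟩ := Submodule.mem_sup.1 (h v.1 (mem_nsq.1 v.2).2)
    rw [← hxy, map_add, Pi.add_apply, hFL v y hy, LinearMap.mem_ker.1 (hFN hx)]
    simp
  obtain ⟨x, hx, y, hy, hxy⟩ := Submodule.mem_sup.1 (hker hbF)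
  have hbV : cls b ∈ V (T : Set (HeightOneSpectrum (𝓞 k))) := V_mono (by exact_mod_cast hST) (cls_mem_of_mem hb)
  have hyV : y ∈ V (T : Set (HeightOneSpectrum (𝓞 k))) := by
    rw [← hxy] at hbV
    exact (Submodule.add_mem_iff_right _ hx.2).1 hbV
  rw [hV y hyV hy, add_zero] at hxy
  rw [← hxy]
  exact hx.1

/-- local norm index at most two -/
theorem NL_index {v : Pl k} {a : kˣ} (ha : cls a ∉ L v) {x y : Qk k} (hx : x ∉ N a ⊔ L v)
    (hy : y ∉ N a ⊔ L v) : x + y ∈ N a ⊔ L v := by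
  classical
  have ha0 : cls a ≠ 0 := by intro h; rw [h] at ha; exact ha (Submodule.zero_mem _)
  obtain ⟨S, hS0, hS⟩ := exists_good_ge (bad a ∪ (match v with | .inl p => {p} | .inr _ => ∅))
  have hvS : v ∈ nsq S (cls a) := by
    rw [mem_nsq]
    refine ⟨?_, ha⟩
    cases v with
    | inl p => rw [mem_iS_inl]; exact hS0 (by simp)
    | inr φ => exact mem_iS_inr φ
  have haS := mem_EG_bad (Finset.subset_union_left.trans hS0)
  obtain ⟨F, hFs, hFN, hFL⟩ := exists_F (a := a) (nsq S (cls a)) (fun v hv => (mem_nsq.1 hv).2)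
  obtain ⟨T, hST, hV, hker⟩ := main_ker hS haS ha0 F hFs hFN hFL
  have key : ∀ z : Qk k, F z ⟨v, hvS⟩ = 0 → z ∈ N a ⊔ L v := by
    intro z hz
    obtain ⟨y, hy⟩ := weak_approxQ (nsq S (cls a)) (fun u => if u = v then z else 0)
    have hyv : y + z ∈ L v := by simpa using hy v hvS
    have hF : y ∈ LinearMap.ker F := by
      rw [LinearMap.mem_ker]
      ext u
      by_cases hu : u.1 = v
      · obtain ⟨u, hu'⟩ := u
        simp only at hu
        subst hu
        have := hFL ⟨u, hu'⟩ _ hyv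
        rw [map_add, Pi.add_apply, hz, add_zero] at this
        exact this
      · have := hy u.1 u.2
        rw [if_neg hu, add_zero] at this
        exact hFL u y this
    obtain ⟨n, hn, l, hl, rfl⟩ := Submodule.mem_sup.1 (hker hF)
    have hlv := mem_LL.1 hl v (mem_nsq.1 hvS).1
    have : z = n + (-l + (n + l + z)) - (n + n) := by abel
    rw [this, Qk_add_self, sub_zero]
    exact Submodule.add_mem_sup hn.1 (Submodule.add_mem _ (Submodule.neg_mem _ hlv) hyv)
  apply key
  have h1 : F x ⟨v, hvS⟩ ≠ 0 := fun h => hx (key x h)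
  have h2 : F y ⟨v, hvS⟩ ≠ 0 := fun h => hy (key y h)
  rw [map_add, Pi.add_apply]
  generalize F x ⟨v, hvS⟩ = s at *
  generalize F y ⟨v, hvS⟩ = t at *
  revert s t; decide

end Hasse

end TwoConics

end

section

open IsDedekindDomain NumberField
open scoped WithZero

namespace TwoConics

section Final

variable {k : Type} [Field k] [NumberField k]

open Classical in
/-- local norm group, everything if `a` is a local square -/
noncomputable def LN (v : Pl k) (a : kˣ) : Submodule (ZMod 2) (Qk k) :=
  if cls a ∈ L v then ⊤ else N a ⊔ L v

theorem LN_index {v : Pl k} {a : kˣ} {x y : Qk k} (hx : x ∉ LN v a) (hy : y ∉ LN v a) :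
    x + y ∈ LN v a := by
  unfold LN at *
  split_ifs at * with h
  · trivial
  · exact NL_index h hx hy

theorem L_le_LN (v : Pl k) (a : kˣ) : L v ≤ LN v a := by
  unfold LN
  split_ifs
  · exact le_top
  · exact le_sup_right

theorem neg_mem_LN (v : Pl k) (a : kˣ) : cls (-a) ∈ LN v a := by
  unfold LN
  split_ifs
  · trivial
  · exact Submodule.mem_sup_left (neg_mem_N a)

theorem coset_meet {M M' : Submodule (ZMod 2) (Qk k)} (hM' : ∀ x y, x ∉ M' → y ∉ M' → x + y ∈ M')
    (h : ¬ M ≤ M') (c c' : Qk k) : ∃ D, c + D ∈ M ∧ c' + D ∈ M' := by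
  obtain ⟨m, hm, hm'⟩ := SetLike.not_le_iff_exists.1 h
  by_cases hc : c' + c ∈ M'
  · exact ⟨c, by rw [Qk_add_self]; exact Submodule.zero_mem _, hc⟩
  · refine ⟨c + m, ?_, ?_⟩
    · rw [← add_assoc, Qk_add_self, zero_add]; exact hm
    · rw [← add_assoc]; exact hM' _ _ hc hm'

theorem coset_meet_LN (v : Pl k) {a b : kˣ} (h : LN v a ≠ LN v b) (c c' : Qk k) :
    ∃ D, c + D ∈ LN v a ∧ c' + D ∈ LN v b := by
  by_cases h1 : LN v a ≤ LN v b
  · have h2 : ¬ LN v b ≤ LN v a := fun h2 => h (le_antisymm h1 h2)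
    obtain ⟨D, hD, hD'⟩ := coset_meet (fun _ _ => LN_index) h2 c' c
    exact ⟨D, hD', hD⟩
  · exact coset_meet (fun _ _ => LN_index) h1 c c'

/-- `D` locally splits the conic -/
def Ok (v : Pl k) (a b : kˣ) (D : Qk k) : Prop := cls b + D ∈ LN v a ∨ cls a + D ∈ LN v b

theorem exists_local (v : Pl k) (a b a' b' : kˣ) : ∃ D, Ok v a b D ∧ Ok v a' b' D := by
  by_cases h1 : LN v a = LN v a'
  · by_cases h2 : LN v b = LN v a'
    · by_cases h3 : LN v a = LN v b'
      · refine ⟨cls b, Or.inl ?_, Or.inl ?_⟩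
        · rw [Qk_add_self]; exact Submodule.zero_mem _
        · have hb := neg_mem_LN v b
          have hb' := neg_mem_LN v b'
          rw [h2] at hb
          rw [← h3, h1] at hb'
          have := Submodule.add_mem _ hb' hb
          rwa [← cls_mul, neg_mul_neg, cls_mul] at this
      · obtain ⟨D, h, h'⟩ := coset_meet_LN v h3 (cls b) (cls a')
        exact ⟨D, Or.inl h, Or.inr h'⟩
    · obtain ⟨D, h, h'⟩ := coset_meet_LN v h2 (cls a) (cls b')
      exact ⟨D, Or.inr h, Or.inl h'⟩
  · obtain ⟨D, h, h'⟩ := coset_meet_LN v h1 (cls b) (cls b')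
    exact ⟨D, Or.inl h, Or.inl h'⟩

theorem Ok.congr {v : Pl k} {a b : kˣ} {D E : Qk k} (h : Ok v a b D) (hE : E + D ∈ L v) : Ok v a b E := by
  have key : ∀ c : Qk k, c + E = (c + D) + (E + D) := by
    intro c
    have : (c + D) + (E + D) = c + E + (D + D) := by abel
    rw [this, Qk_add_self, add_zero]
  rcases h with h | h
  · left; rw [key]; exact Submodule.add_mem _ h (L_le_LN _ _ hE)
  · right; rw [key]; exact Submodule.add_mem _ h (L_le_LN _ _ hE)

theorem res_LN {K : Type} [Field K] [NumberField K] [Algebra k K] {w : Pl K} {a b : kˣ} {D : Qk k}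
    (hD : res k K D = 0) (ha : cls (um K a) ∉ L w) (h : cls b + D ∈ LN (belowPl k w) a) :
    cls (um K b) ∈ N (um K a) ⊔ L w := by
  have ha' : cls a ∉ L (belowPl k w) := fun h' => ha (by rw [← res_cls]; exact res_L h')
  rw [LN, if_neg ha'] at h
  have := res_NL h
  rwa [map_add, hD, add_zero, res_cls] at this

theorem split_of_ok {K : Type} [Field K] [NumberField K] [Algebra k K] {a b : kˣ} {D : Qk k}
    (hD : res k K D = 0) (S : Finset (HeightOneSpectrum (𝓞 k)))
    (h2 : ∀ p ∉ S, p.valuation k (2 : k) = 1) (ha : ∀ p ∉ S, p.valuation k (a : k) = 1)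
    (hb : ∀ p ∉ S, p.valuation k (b : k) = 1) (hok : ∀ v ∈ iS S, Ok v a b D) :
    NS (algebraMap k K a) (algebraMap k K b) := by
  have := hasse (a := um K a) (b := um K b) ?_
  · exact this
  intro w hw
  by_cases hwS : belowPl k w ∈ iS S
  · rcases hok _ hwS with h | h
    · exact res_LN hD hw h
    · by_cases hbw : cls (um K b) ∈ L w
      · exact Submodule.mem_sup_right hbw
      · exact NL_symm hw (res_LN hD hbw h)
  · cases w with
    | inl p =>
      have hp : below k p ∉ S := fun h => hwS (mem_iS_inl.2 h)
      refine NL_unram ?_ ?_ ?_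
      · have := (val_below_eq_one p (2 : k)).2 (h2 _ hp)
        rwa [map_ofNat] at this
      · exact (val_below_eq_one p (a : k)).2 (ha _ hp)
      · exact (val_below_eq_one p (b : k)).2 (hb _ hp)
    | inr ψ => exact absurd (mem_iS_inr _) hwS

theorem exists_nonsquare (k : Type) [Field k] [NumberField k] : ∃ d : kˣ, cls d ≠ 0 := by
  obtain ⟨m, hm⟩ := Ideal.exists_maximal (𝓞 k)
  have hm0 : m ≠ ⊥ := Ring.ne_bot_of_isMaximal_of_not_isField hm (RingOfIntegers.not_isField k)
  let p : HeightOneSpectrum (𝓞 k) := ⟨m, hm.isPrime, hm0⟩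
  obtain ⟨π, hπ⟩ := p.valuation_exists_uniformizer k
  have hπ0 : π ≠ 0 := by
    rintro rfl
    rw [map_zero] at hπ
    exact absurd hπ.symm (by simp)
  refine ⟨Units.mk0 π hπ0, fun h => ?_⟩
  obtain ⟨y, hy⟩ := cls_eq_zero.1 h
  have hy' : π = (y : k) ^ 2 := by
    have := congrArg Units.val hy
    simpa using this
  have hy0 : p.valuation k (y : k) ≠ 0 := by simp
  rw [hy', map_pow] at hπ
  obtain ⟨n, hn⟩ : ∃ n : ℤ, p.valuation k (y : k) = WithZero.exp n :=
    ⟨WithZero.log (p.valuation k (y : k)), (WithZero.exp_log hy0).symm⟩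
  rw [hn, ← WithZero.exp_nsmul, WithZero.exp_inj] at hπ
  simp at hπ
  omega

theorem exists_quad_res (D : Qk k) : ∃ (K : Type) (_ : Field K) (_ : NumberField K) (_ : Algebra k K),
    Module.finrank k K = 2 ∧ res k K D = 0 := by
  by_cases hD : D = 0
  · obtain ⟨d, hd⟩ := exists_nonsquare k
    obtain ⟨K, i1, i2, i3, β, σ, hq⟩ := exists_quad hd
    exact ⟨K, i1, i2, i3, hq.rank, by rw [hD, map_zero]⟩
  · obtain ⟨d, rfl⟩ := cls_surj D
    obtain ⟨K, i1, i2, i3, β, σ, hq⟩ := exists_quad hD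
    exact ⟨K, i1, i2, i3, hq.rank, hq.res_base⟩

theorem main_units (a b a' b' : kˣ) : ∃ (K : Type) (_ : Field K) (_ : Algebra k K),
    Module.finrank k K = 2 ∧ NS (algebraMap k K a) (algebraMap k K b) ∧
      NS (algebraMap k K a') (algebraMap k K b') := by
  classical
  have two0 : (2 : k) ≠ 0 := two_ne_zero
  let S := bad (Units.mk0 (2 : k) two0) ∪ bad a ∪ bad b ∪ bad a' ∪ bad b'
  choose Dv h h' using fun v : Pl k => exists_local v a b a' b'
  obtain ⟨D, hD⟩ := weak_approxQ (iS S) Dv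
  obtain ⟨K, i1, i2, i3, hr, hres⟩ := exists_quad_res D
  have e : ∀ x : kˣ, bad x ⊆ S → ∀ p ∉ S, p.valuation k (x : k) = 1 :=
    fun x hx p hp => val_of_not_bad (fun h => hp (hx h))
  have s2 : bad (Units.mk0 (2 : k) two0) ⊆ S := by intro p hp; simp only [S, Finset.mem_union]; tauto
  have sa : bad a ⊆ S := by intro p hp; simp only [S, Finset.mem_union]; tauto
  have sb : bad b ⊆ S := by intro p hp; simp only [S, Finset.mem_union]; tauto
  have sa' : bad a' ⊆ S := by intro p hp; simp only [S, Finset.mem_union]; tauto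
  have sb' : bad b' ⊆ S := by intro p hp; simp only [S, Finset.mem_union]; tauto
  exact ⟨K, i1, i3, hr,
    split_of_ok hres S (e _ s2) (e _ sa) (e _ sb) (fun v hv => (h v).congr (hD v hv)),
    split_of_ok hres S (e _ s2) (e _ sa') (e _ sb') (fun v hv => (h' v).congr (hD v hv))⟩

theorem NS.point {K : Type} [Field K] {a b : K} (h : NS a b) :
    ∃ x y z : K, (x, y, z) ≠ (0, 0, 0) ∧ a * x ^ 2 + b * y ^ 2 = z ^ 2 := by
  obtain ⟨p, r, h⟩ := h
  refine ⟨r, 1, p, ?_, by rw [h]; ring⟩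
  intro h
  simp at h

end Final

end TwoConics

end

/-- Over a number field `k`, for any two conics `z² = a x² + b y²` and
`z² = a' x² + b' y²` (with `a, b, a', b'` nonzero) there is a single quadratic extension
`K/k` over which both acquire a nontrivial rational point, i.e. both become isomorphic to
the projective line over `K`. -/
theorem two_conics_split_over_common_quadratic_extension {k : Type} [Field k]
    [NumberField k] (a b a' b' : k) (ha : a ≠ 0) (hb : b ≠ 0) (ha' : a' ≠ 0)
    (hb' : b' ≠ 0) :
    ∃ (K : Type) (_ : Field K) (_ : Algebra k K),
      Module.finrank k K = 2 ∧
      (∃ x y z : K, (x, y, z) ≠ (0, 0, 0) ∧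
        algebraMap k K a * x ^ 2 + algebraMap k K b * y ^ 2 = z ^ 2) ∧
      (∃ x y z : K, (x, y, z) ≠ (0, 0, 0) ∧
        algebraMap k K a' * x ^ 2 + algebraMap k K b' * y ^ 2 = z ^ 2) := by
  obtain ⟨K, i1, i2, hr, h, h'⟩ := TwoConics.main_units (Units.mk0 a ha) (Units.mk0 b hb)
    (Units.mk0 a' ha') (Units.mk0 b' hb')
  exact ⟨K, i1, i2, hr, TwoConics.NS.point h, TwoConics.NS.point h'⟩
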